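/- arXiv:1102.3447 — 4 statements merged into one kernel-verified Lean document; each statement's English description precedes it below -/
import Mathlib

section
/- Let p be an odd prime, q = p^n for some n ≥ 1, k the field with q elements, and G = SL_2(q). Then the natural 2-dimensional kG-module V_1 = k^2 (with G acting by matrix multiplication) is algebraic. -/
open CategoryTheory CategoryTheory.MonoidalCategory

namespace AlgebraicModule

variable {k G : Type} [Field k] [Monoid G]

/-- `N` is a direct summand of `M`, i.e. a retract of `M`. -/
def IsSummand (N M : FDRep k G) : Prop :=
  ∃ (i : N ⟶ M) (r : M ⟶ N), i ≫ r = 𝟙 N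

/-- `M` is an indecomposable module: it is nonzero and is not the direct sum of two
nonzero submodules (equivalently, its only idempotent endomorphisms are `0` and `1`). -/
def Indecomposable (M : FDRep k G) : Prop :=
  ¬ Limits.IsZero M ∧ ∀ e : M ⟶ M, e ≫ e = e → e = 0 ∨ e = 𝟙 M

/-- `tensorPow M n` is the tensor power `M^{⊗ (n + 1)}`, with diagonal `G`-action. -/
noncomputable def tensorPow (M : FDRep k G) : ℕ → FDRep k G
  | 0 => M
  | n + 1 => tensorPow M n ⊗ M

/-- `M` is algebraic: only finitely many isomorphism classes of indecomposable modules
occur as direct summands of the tensor powers `M^{⊗ n}` for `n ≥ 1`. -/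
noncomputable def IsAlgebraic (M : FDRep k G) : Prop :=
  ∃ L : List (FDRep k G), ∀ N : FDRep k G, Indecomposable N →
    (∃ n : ℕ, IsSummand N (tensorPow M n)) → ∃ N' ∈ L, Nonempty (N ≅ N')

end AlgebraicModule

open AlgebraicModule

/-- The natural representation of `SL_n(k)` on `k^n`, by matrix multiplication. -/
noncomputable def SLnatRep (k : Type) [Field k] (n : ℕ) :
    Representation k (Matrix.SpecialLinearGroup (Fin n) k) (Fin n → k) where
  toFun g := Matrix.mulVecLin (g : Matrix (Fin n) (Fin n) k)
  map_one' := by ext v i; simp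
  map_mul' g h := by ext v i; simp [Matrix.mulVecLin_mul]


structure ClOp (M : Type*) [CommMonoid M] where
  cl : Set M → Set M
  sub : ∀ (A : Set M) (x : M), x ∈ A → x ∈ cl A
  bindmul : ∀ (A B : Set M) (x y : M), x ∈ cl A → (∀ a ∈ A, a * y ∈ cl B) → x * y ∈ cl B

namespace ClOp
variable {M : Type*} [CommMonoid M] (C : ClOp M)

theorem bind {A B : Set M} {x : M} (h : x ∈ C.cl A) (h2 : ∀ a ∈ A, a ∈ C.cl B) : x ∈ C.cl B := by
  have := C.bindmul A B x 1 h (by simpa using h2)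
  simpa using this

theorem bindmul' {A B : Set M} {x : M} (y z : M) (hz : z = x * y) (h : x ∈ C.cl A)
    (h2 : ∀ a ∈ A, a * y ∈ C.cl B) : z ∈ C.cl B := by
  rw [hz]; exact C.bindmul A B x y h h2

theorem mono {A B : Set M} {x : M} (h : x ∈ C.cl A) (h2 : A ⊆ B) : x ∈ C.cl B :=
  C.bind h (fun _ ha => C.sub _ _ (h2 ha))

/-- the basic hypotheses relating `s, v, w` (`w` the Frobenius twist of `v`) -/
structure Step (p : ℕ) (s v w : M) : Prop where
  a : v ^ (p - 1) ∈ C.cl ({s} ∪ {x | ∃ i < p - 1, x = v ^ i})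
  b : s ∈ C.cl {v ^ (p - 1)}
  i : s * w ∈ C.cl {s * v ^ p}
  ii : s * v ^ p ∈ C.cl ({s * w} ∪ {x | ∃ i < p, x = s * v ^ i})

/-- the inductive package, `P = p ^ r`. -/
structure Pack (P : ℕ) (s v w : M) : Prop where
  a : v ^ (P - 1) ∈ C.cl ({s} ∪ {x | ∃ i < P - 1, x = v ^ i})
  b : s ∈ C.cl {v ^ (P - 1)}
  i : s * w ∈ C.cl {s * v ^ P}
  ii : s * v ^ P ∈ C.cl ({s * w} ∪ {x | ∃ i < P, x = s * v ^ i})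

theorem Pack.one (v : M) : C.Pack 1 1 v v where
  a := C.sub _ _ (by simp)
  b := C.sub _ _ (by simp)
  i := C.sub _ _ (by simp)
  ii := C.sub _ _ (by simp)

variable {C}

theorem Pack.ipow {P : ℕ} {s v w : M} (h : C.Pack P s v w) (b : ℕ) :
    s * w ^ b ∈ C.cl {s * v ^ (P * b)} := by
  induction b with
  | zero => exact C.sub _ _ (by simp)
  | succ b ih =>
    refine C.bindmul' w _ (by rw [pow_succ, mul_assoc]) ih ?_
    rintro _ rfl
    refine C.bindmul' (v ^ (P * b)) _ (by ac_rfl) h.i ?_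
    rintro _ rfl
    refine C.sub _ _ ?_
    simp only [Set.mem_singleton_iff, mul_add, mul_one, pow_add]
    ac_rfl

theorem Pack.ipow' {P : ℕ} {s v w : M} (h : C.Pack P s v w) (b : ℕ) (y : M) {B : Set M}
    (hB : s * v ^ (P * b) * y ∈ B) : s * w ^ b * y ∈ C.cl B := by
  refine C.bindmul' y _ rfl (h.ipow b) ?_
  rintro _ rfl
  exact C.sub _ _ hB

theorem Pack.b' {P : ℕ} {s v w : M} (h : C.Pack P s v w) (y : M) {B : Set M}
    (hB : v ^ (P - 1) * y ∈ B) : s * y ∈ C.cl B := by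
  refine C.bindmul' y _ rfl h.b ?_
  rintro _ rfl
  exact C.sub _ _ hB

theorem Pack.iipow {P : ℕ} {s v w : M} (h : C.Pack P s v w) (b : ℕ) :
    s * v ^ (P * b) ∈ C.cl ({s * w ^ b} ∪ {x | ∃ i < P * b, x = s * v ^ i}) := by
  induction b with
  | zero => exact C.sub _ _ (by simp)
  | succ b ih =>
    refine C.bindmul' (v ^ P) _ (by rw [mul_add, mul_one, pow_add, mul_assoc]) ih ?_
    rintro _ (rfl | ⟨i, hi, rfl⟩)
    · refine C.bindmul' (w ^ b) _ (by ac_rfl) h.ii ?_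
      rintro _ (rfl | ⟨i, hi, rfl⟩)
      · refine C.sub _ _ (Or.inl ?_)
        simp only [Set.mem_singleton_iff, pow_succ]; ac_rfl
      · have e : s * v ^ i * w ^ b = s * w ^ b * v ^ i := by ac_rfl
        rw [e]
        refine h.ipow' b _ (Or.inr ⟨P * b + i, ?_, ?_⟩)
        · rw [mul_add]; omega
        · rw [pow_add]; ac_rfl
    · refine C.sub _ _ (Or.inr ⟨i + P, ?_, ?_⟩)
      · rw [mul_add]; omega
      · rw [pow_add]; ac_rfl

theorem Pack.succ {p P : ℕ} (hp : 1 ≤ p) (hP : 1 ≤ P) {s v w t u : M} (h : C.Pack P s v w)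
    (k : C.Step p t w u) : C.Pack (P * p) (s * t) v u := by
  obtain ⟨p, rfl⟩ : ∃ p', p = p' + 1 := ⟨p - 1, by omega⟩
  obtain ⟨P, rfl⟩ : ∃ P', P = P' + 1 := ⟨P - 1, by omega⟩
  obtain ⟨ka, kb, ki, kii⟩ := k
  simp only [Nat.add_sub_cancel] at ka kb
  have e0 : (P + 1) * (p + 1) - 1 = P + (P + 1) * p := by
    rw [mul_add]; omega
  have hb : ∀ (y : M) {B : Set M}, v ^ P * y ∈ B → s * y ∈ C.cl B := fun y B hB => h.b' y hB
  refine ⟨?_, ?_, ?_, ?_⟩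
  · rw [e0]
    refine C.bindmul' (v ^ ((P + 1) * p)) _ (by rw [pow_add, Nat.add_sub_cancel]) h.a ?_
    rintro a (ha | ⟨i, hi, rfl⟩)
    · rw [Set.mem_singleton_iff.1 ha]
      refine C.bind (h.iipow p) ?_
      rintro _ (rfl | ⟨i, hi, rfl⟩)
      · refine C.bindmul' s _ (mul_comm _ _) ka ?_
        rintro _ (rfl | ⟨i, hi, rfl⟩)
        · exact C.sub _ _ (Or.inl (by simp [mul_comm]))
        · have := h.ipow i
          rw [mul_comm _ s]
          refine C.bind this ?_
          rintro _ rfl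
          refine hb _ (Or.inr ⟨P + (P + 1) * i, ?_, ?_⟩)
          · have : (P + 1) * i < (P + 1) * p := Nat.mul_lt_mul_of_pos_left hi (by omega)
            omega
          · rw [pow_add]
      · refine hb _ (Or.inr ⟨P + i, by omega, by rw [pow_add]⟩)
    · refine C.sub _ _ (Or.inr ⟨i + (P + 1) * p, by omega, by rw [pow_add]⟩)
  · rw [e0]
    refine C.bindmul' s _ (mul_comm _ _) kb ?_
    rintro _ rfl
    rw [mul_comm _ s]
    refine C.bind (h.ipow p) ?_
    rintro _ rfl
    exact hb _ (by simp [pow_add])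
  · refine C.bindmul' s _ (by ac_rfl) ki ?_
    rintro _ rfl
    have e : t * w ^ (p + 1) * s = s * w ^ (p + 1) * t := by ac_rfl
    rw [e]
    refine h.ipow' _ _ ?_
    simp only [Set.mem_singleton_iff]; ac_rfl
  · refine C.bindmul' t _ (by ac_rfl) (h.iipow (p + 1)) ?_
    rintro _ (rfl | ⟨i, hi, rfl⟩)
    · refine C.bindmul' s _ (by ac_rfl) kii ?_
      rintro _ (rfl | ⟨i, hi, rfl⟩)
      · exact C.sub _ _ (Or.inl (by simp only [Set.mem_singleton_iff]; ac_rfl))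
      · have e : t * w ^ i * s = s * w ^ i * t := by ac_rfl
        rw [e]
        refine h.ipow' _ _ (Or.inr ⟨(P + 1) * i, ?_, by ac_rfl⟩)
        exact Nat.mul_lt_mul_of_pos_left hi (by omega)
    · exact C.sub _ _ (Or.inr ⟨i, hi, by ac_rfl⟩)

theorem Pack.final {q : ℕ} (hq : 2 ≤ q) {s v : M} (h : C.Pack q s v v) (m : ℕ) :
    v ^ m ∈ C.cl {x | ∃ i < 2 * q - 1, x = v ^ i} := by
  induction m using Nat.strong_induction_on with
  | _ m ih =>
  by_cases hm : m < 2 * q - 1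
  · exact C.sub _ _ ⟨m, hm, rfl⟩
  have key : v ^ (2 * q - 1) ∈ C.cl {x | ∃ i < 2 * q - 1, x = v ^ i} := by
    have e : 2 * q - 1 = (q - 1) + q := by omega
    refine C.bindmul' (v ^ q) _ (by rw [e, pow_add]) h.a ?_
    have hl : ∀ i < q, s * v ^ i ∈ C.cl {x | ∃ i < 2 * q - 1, x = v ^ i} := fun i hi =>
      h.b' _ ⟨q - 1 + i, by omega, by rw [pow_add]⟩
    rintro a (ha | ⟨i, hi, rfl⟩)
    · rw [Set.mem_singleton_iff.1 ha]
      refine C.bind h.ii ?_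
      rintro _ (rfl | ⟨i, hi, rfl⟩)
      · simpa using hl 1 (by omega)
      · exact hl i hi
    · exact C.sub _ _ ⟨i + q, by omega, by rw [pow_add]⟩
  obtain ⟨d, rfl⟩ : ∃ d, m = 2 * q - 1 + d := ⟨m - (2 * q - 1), by omega⟩
  refine C.bindmul' (v ^ d) _ (by rw [pow_add]) key ?_
  rintro _ ⟨i, hi, rfl⟩
  rw [← pow_add]
  exact ih _ (by omega)

end ClOp

section CatCl
variable {C : Type*} [Category C] [Preadditive C]

def addMor (X : C) (A : Set C) : AddSubmonoid (X ⟶ X) :=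
  AddSubmonoid.closure {h | ∃ Y ∈ A, ∃ (f : X ⟶ Y) (g : Y ⟶ X), h = f ≫ g}

theorem addMor_sandwich {X Z : C} {A : Set C} (f : X ⟶ Z) (g : Z ⟶ X) (h : Z ⟶ Z)
    (hh : h ∈ addMor Z A) : f ≫ h ≫ g ∈ addMor X A := by
  refine AddSubmonoid.closure_induction (motive := fun h _ => f ≫ h ≫ g ∈ addMor X A) ?_ ?_ ?_ hh
  · rintro _ ⟨Y, hY, a, b, rfl⟩
    exact AddSubmonoid.subset_closure ⟨Y, hY, f ≫ a, b ≫ g, by simp⟩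
  · simpa using (addMor X A).zero_mem
  · intro a b _ _ ha hb
    simpa using (addMor X A).add_mem ha hb

theorem addMor_retract {X Z : C} {A : Set C} (f : X ⟶ Z) (g : Z ⟶ X) (hfg : f ≫ g = 𝟙 X)
    (hh : 𝟙 Z ∈ addMor Z A) : 𝟙 X ∈ addMor X A := by
  have := addMor_sandwich f g _ hh
  simpa [hfg] using this

variable [MonoidalCategory C] [MonoidalPreadditive C]

theorem addMor_tensor {X Y : C} {A B : Set C}
    (hB : ∀ Z ∈ A, 𝟙 (Z ⊗ Y) ∈ addMor (Z ⊗ Y) B) (h : X ⟶ X)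
    (hh : h ∈ addMor X A) : h ▷ Y ∈ addMor (X ⊗ Y) B := by
  refine AddSubmonoid.closure_induction (motive := fun h _ => h ▷ Y ∈ addMor (X ⊗ Y) B) ?_ ?_ ?_ hh
  · rintro _ ⟨Z, hZ, a, b, rfl⟩
    have := addMor_sandwich (a ▷ Y) (b ▷ Y) _ (hB Z hZ)
    simpa using this
  · simpa using (addMor (X ⊗ Y) B).zero_mem
  · intro a b _ _ ha hb
    simpa [MonoidalPreadditive.add_whiskerRight] using (addMor (X ⊗ Y) B).add_mem ha hb

variable [BraidedCategory C]

theorem mem_cl_iff (X : C) (A : Set (Skeleton C)) :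
    𝟙 ((fromSkeleton C).obj (toSkeleton X)) ∈ addMor ((fromSkeleton C).obj (toSkeleton X))
      {Y | toSkeleton Y ∈ A} ↔ 𝟙 X ∈ addMor X {Y | toSkeleton Y ∈ A} := by
  let e := fromSkeletonToSkeletonIso X
  exact ⟨addMor_retract e.inv e.hom (by simp), addMor_retract e.hom e.inv (by simp)⟩

variable (C) in
noncomputable def catCl : ClOp (Skeleton C) where
  cl A := {x | 𝟙 ((fromSkeleton C).obj x) ∈ addMor ((fromSkeleton C).obj x)
      {Y | toSkeleton Y ∈ A}}
  sub A x hx := AddSubmonoid.subset_closure ⟨(fromSkeleton C).obj x, by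
    simpa [toSkeleton_fromSkeleton_obj] using hx, 𝟙 _, 𝟙 _, by simp⟩
  bindmul A B x y hx h := by
    obtain ⟨X, rfl⟩ : ∃ X, toSkeleton X = x := ⟨(fromSkeleton C).obj x, toSkeleton_fromSkeleton_obj _⟩
    obtain ⟨Y, rfl⟩ : ∃ X, toSkeleton X = y := ⟨(fromSkeleton C).obj y, toSkeleton_fromSkeleton_obj _⟩
    have hx' := (mem_cl_iff _ _).1 hx
    have h' : ∀ Z ∈ {Y | toSkeleton Y ∈ A}, 𝟙 (Z ⊗ Y) ∈ addMor (Z ⊗ Y) {Y | toSkeleton Y ∈ B} := by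
      intro Z hZ
      have := h _ hZ
      rw [← Skeleton.toSkeleton_tensorObj] at this
      exact (mem_cl_iff _ _).1 this
    have := addMor_tensor h' _ hx'
    show toSkeleton X * toSkeleton Y ∈ {x | _}
    rw [← Skeleton.toSkeleton_tensorObj]
    refine (mem_cl_iff _ _).2 ?_
    simpa using this

theorem mem_catCl (X : C) (A : Set (Skeleton C)) :
    toSkeleton X ∈ (catCl C).cl A ↔ 𝟙 X ∈ addMor X {Y | toSkeleton Y ∈ A} := mem_cl_iff X A

theorem mem_catCl_of_three {X Y₁ Y₂ Y₃ : C} {A : Set (Skeleton C)} (h₁ : toSkeleton Y₁ ∈ A)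
    (h₂ : toSkeleton Y₂ ∈ A) (h₃ : toSkeleton Y₃ ∈ A) (f₁ : X ⟶ Y₁) (g₁ : Y₁ ⟶ X)
    (f₂ : X ⟶ Y₂) (g₂ : Y₂ ⟶ X) (f₃ : X ⟶ Y₃) (g₃ : Y₃ ⟶ X)
    (h : f₁ ≫ g₁ + f₂ ≫ g₂ + f₃ ≫ g₃ = 𝟙 X) : toSkeleton X ∈ (catCl C).cl A := by
  rw [mem_catCl, ← h]
  refine add_mem (add_mem ?_ ?_) ?_
  · exact AddSubmonoid.subset_closure ⟨_, h₁, _, _, rfl⟩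
  · exact AddSubmonoid.subset_closure ⟨_, h₂, _, _, rfl⟩
  · exact AddSubmonoid.subset_closure ⟨_, h₃, _, _, rfl⟩

end CatCl

section Bridge
variable {k G : Type} [Field k] [Monoid G] {U W Y₁ Y₂ Y₃ : Type}
  [AddCommGroup U] [Module k U] [Module.Finite k U] [AddCommGroup W] [Module k W]
  [Module.Finite k W] [AddCommGroup Y₁] [Module k Y₁] [Module.Finite k Y₁]
  [AddCommGroup Y₂] [Module k Y₂] [Module.Finite k Y₂]
  [AddCommGroup Y₃] [Module k Y₃] [Module.Finite k Y₃]

noncomputable def repHom (ρ : Representation k G U) (σ : Representation k G W) (f : U →ₗ[k] W)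
    (hf : ∀ g, f ∘ₗ ρ g = σ g ∘ₗ f) : FDRep.of ρ ⟶ FDRep.of σ :=
  ⟨InducedCategory.homMk (ModuleCat.ofHom f), fun g => by
    ext x
    exact LinearMap.congr_fun (hf g) x⟩

theorem repHom_comp (ρ : Representation k G U) (σ : Representation k G W)
    (τ : Representation k G Y₁) (f : U →ₗ[k] W) (hf : ∀ g, f ∘ₗ ρ g = σ g ∘ₗ f)
    (f' : W →ₗ[k] Y₁) (hf' : ∀ g, f' ∘ₗ σ g = τ g ∘ₗ f') :
    repHom ρ σ f hf ≫ repHom σ τ f' hf' = repHom ρ τ (f' ∘ₗ f) (fun g => by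
      rw [LinearMap.comp_assoc, hf, ← LinearMap.comp_assoc, hf', LinearMap.comp_assoc]) := rfl

theorem repHom_id (ρ : Representation k G U) : repHom ρ ρ LinearMap.id (fun _ => rfl) = 𝟙 _ := rfl

noncomputable def cls (ρ : Representation k G U) : Skeleton (FDRep k G) :=
  toSkeleton (FDRep.of ρ)

theorem cls_tprod (ρ : Representation k G U) (σ : Representation k G W) :
    cls (ρ.tprod σ) = cls ρ * cls σ :=
  Skeleton.toSkeleton_tensorObj (FDRep.of ρ) (FDRep.of σ)

theorem cls_trivial : cls (Representation.trivial k G k) = 1 := rfl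

theorem cls_eq (ρ : Representation k G U) (σ : Representation k G W) (e : U ≃ₗ[k] W)
    (he : ∀ g, e.toLinearMap ∘ₗ ρ g = σ g ∘ₗ e.toLinearMap) : cls ρ = cls σ := by
  refine congr_toSkeleton_of_iso ⟨repHom ρ σ e.toLinearMap he,
    repHom σ ρ e.symm.toLinearMap ?_, ?_, ?_⟩
  · intro g
    ext x
    apply e.injective
    have := LinearMap.congr_fun (he g) (e.symm x)
    simpa using this.symm
  · rw [repHom_comp]; simp only [LinearEquiv.symm_comp]; rfl
  · rw [repHom_comp]; simp only [LinearEquiv.comp_symm]; rfl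

theorem cls_mem3 {ρ : Representation k G U} {σ₁ : Representation k G Y₁}
    {σ₂ : Representation k G Y₂} {σ₃ : Representation k G Y₃} {A : Set (Skeleton (FDRep k G))}
    (h₁ : cls σ₁ ∈ A) (h₂ : cls σ₂ ∈ A) (h₃ : cls σ₃ ∈ A)
    (f₁ : U →ₗ[k] Y₁) (g₁ : Y₁ →ₗ[k] U) (f₂ : U →ₗ[k] Y₂) (g₂ : Y₂ →ₗ[k] U)
    (f₃ : U →ₗ[k] Y₃) (g₃ : Y₃ →ₗ[k] U)
    (hf₁ : ∀ g, f₁ ∘ₗ ρ g = σ₁ g ∘ₗ f₁) (hg₁ : ∀ g, g₁ ∘ₗ σ₁ g = ρ g ∘ₗ g₁)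
    (hf₂ : ∀ g, f₂ ∘ₗ ρ g = σ₂ g ∘ₗ f₂) (hg₂ : ∀ g, g₂ ∘ₗ σ₂ g = ρ g ∘ₗ g₂)
    (hf₃ : ∀ g, f₃ ∘ₗ ρ g = σ₃ g ∘ₗ f₃) (hg₃ : ∀ g, g₃ ∘ₗ σ₃ g = ρ g ∘ₗ g₃)
    (h : g₁ ∘ₗ f₁ + g₂ ∘ₗ f₂ + g₃ ∘ₗ f₃ = LinearMap.id) : cls ρ ∈ (catCl _).cl A := by
  refine mem_catCl_of_three h₁ h₂ h₃ (repHom ρ σ₁ f₁ hf₁) (repHom σ₁ ρ g₁ hg₁)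
    (repHom ρ σ₂ f₂ hf₂) (repHom σ₂ ρ g₂ hg₂) (repHom ρ σ₃ f₃ hf₃) (repHom σ₃ ρ g₃ hg₃) ?_
  rw [← repHom_id, repHom_comp, repHom_comp, repHom_comp]
  simp only [← h]
  rfl

theorem cls_mem2 {ρ : Representation k G U} {σ₁ : Representation k G Y₁}
    {σ₂ : Representation k G Y₂} {A : Set (Skeleton (FDRep k G))}
    (h₁ : cls σ₁ ∈ A) (h₂ : cls σ₂ ∈ A)
    (f₁ : U →ₗ[k] Y₁) (g₁ : Y₁ →ₗ[k] U) (f₂ : U →ₗ[k] Y₂) (g₂ : Y₂ →ₗ[k] U)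
    (hf₁ : ∀ g, f₁ ∘ₗ ρ g = σ₁ g ∘ₗ f₁) (hg₁ : ∀ g, g₁ ∘ₗ σ₁ g = ρ g ∘ₗ g₁)
    (hf₂ : ∀ g, f₂ ∘ₗ ρ g = σ₂ g ∘ₗ f₂) (hg₂ : ∀ g, g₂ ∘ₗ σ₂ g = ρ g ∘ₗ g₂)
    (h : g₁ ∘ₗ f₁ + g₂ ∘ₗ f₂ = LinearMap.id) : cls ρ ∈ (catCl _).cl A :=
  cls_mem3 h₁ h₂ h₂ f₁ g₁ f₂ g₂ 0 0 hf₁ hg₁ hf₂ hg₂ (by simp) (by simp) (by simpa using h)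

theorem cls_mem1 {ρ : Representation k G U} {σ₁ : Representation k G Y₁}
    {A : Set (Skeleton (FDRep k G))} (h₁ : cls σ₁ ∈ A)
    (f₁ : U →ₗ[k] Y₁) (g₁ : Y₁ →ₗ[k] U)
    (hf₁ : ∀ g, f₁ ∘ₗ ρ g = σ₁ g ∘ₗ f₁) (hg₁ : ∀ g, g₁ ∘ₗ σ₁ g = ρ g ∘ₗ g₁)
    (h : g₁ ∘ₗ f₁ = LinearMap.id) : cls ρ ∈ (catCl _).cl A :=
  cls_mem2 h₁ h₁ f₁ g₁ 0 0 hf₁ hg₁ (by simp) (by simp) (by simpa using h)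

end Bridge

section Finiteness

theorem exists_pow_idem {M : Type*} [Monoid M] [Finite M] (x : M) :
    ∃ n : ℕ, 0 < n ∧ x ^ n * x ^ n = x ^ n := by
  obtain ⟨a, b, hne, hab⟩ := Finite.exists_ne_map_eq_of_infinite (fun n : ℕ => x ^ n)
  wlog h : a < b generalizing a b
  · exact this b a hne.symm hab.symm (by omega)
  obtain ⟨d, rfl⟩ : ∃ d, b = a + d := ⟨b - a, by omega⟩
  have hd : 0 < d := by omega
  replace hab : x ^ a = x ^ (a + d) := hab
  have h1 : ∀ j, x ^ (a + d * j) = x ^ a := by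
    intro j
    induction j with
    | zero => simp
    | succ j ih => rw [mul_add, mul_one, ← add_assoc, pow_add, ih, ← pow_add, ← hab]
  have h2 : ∀ c j, a ≤ c → x ^ (c + d * j) = x ^ c := by
    intro c j hc
    obtain ⟨e, rfl⟩ : ∃ e, c = a + e := ⟨c - a, by omega⟩
    rw [show a + e + d * j = a + d * j + e by ring, pow_add, h1, pow_add]
  refine ⟨d * (a + 1), by positivity, ?_⟩
  rw [← pow_add]
  exact h2 _ _ (by nlinarith)

variable {k G : Type} [Field k] [Monoid G]

theorem unit_or_nilp [Finite k] {N : FDRep k G} (hN : AlgebraicModule.Indecomposable N) (h : End N) :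
    IsUnit h ∨ IsNilpotent h := by
  have : Finite (N ⟶ N) := Module.finite_of_finite k
  have : Finite (End N) := this
  obtain ⟨n, hn, e⟩ := exists_pow_idem h
  rcases hN.2 (h ^ n) e with h0 | h1
  · exact Or.inr ⟨n, h0⟩
  · left
    have h1' : h ^ n = 1 := h1
    exact (isUnit_pow_iff hn.ne').1 (h1' ▸ isUnit_one)

theorem nonunit_add [Finite k] {N : FDRep k G} (hN : AlgebraicModule.Indecomposable N) (a b : End N)
    (ha : ¬ IsUnit a) (hb : ¬ IsUnit b) : ¬ IsUnit (a + b) := by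
  rintro ⟨u, hu⟩
  have h1 : (↑u⁻¹ * a : End N) + ↑u⁻¹ * b = 1 := by
    rw [← mul_add, ← hu]; simp
  rcases unit_or_nilp hN (↑u⁻¹ * a : End N) with h | h
  · exact ha ((Units.isUnit_units_mul u⁻¹ a).1 h)
  · apply hb
    rw [← Units.isUnit_units_mul u⁻¹ b, eq_sub_of_add_eq' h1]
    exact h.isUnit_one_sub

theorem summand_of_mem [Finite k] {N : FDRep k G} (hN : AlgebraicModule.Indecomposable N)
    {A : Set (FDRep k G)} (h : 𝟙 N ∈ addMor N A) : ∃ Y ∈ A, IsSummand N Y := by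
  by_contra hcon
  push Not at hcon
  have key : ∀ e : N ⟶ N, e ∈ addMor N A → ¬ IsUnit (show End N from e) := by
    intro e he
    refine AddSubmonoid.closure_induction
      (motive := fun e _ => ¬ IsUnit (show End N from e)) ?_ ?_ ?_ he
    · rintro _ ⟨Y, hY, f, g, rfl⟩ ⟨u, hu⟩
      refine hcon Y hY ⟨f, g ≫ (show N ⟶ N from (↑u⁻¹ : End N)), ?_⟩
      have : (↑u⁻¹ : End N) * ↑u = 1 := by simp
      rw [hu] at this
      rw [← Category.assoc]
      exact this
    · intro h0
      apply hN.1
      rw [Limits.IsZero.iff_id_eq_zero]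
      have : (0 : End N) = 1 := isUnit_zero_iff.1 h0
      exact this.symm
    · intro a b _ _ ha hb
      exact nonunit_add hN a b ha hb
  exact key _ h isUnit_one

theorem list_of_summand [Finite k] [Finite G] (W : FDRep k G) :
    ∃ L : List (FDRep k G), ∀ N, IsSummand N W → ∃ N' ∈ L, Nonempty (N ≅ N') := by
  let T := Σ d : Fin (Module.finrank k W + 1), Representation k G (Fin d → k)
  have : ∀ d : Fin (Module.finrank k W + 1), Finite (Representation k G (Fin d → k)) := by
    intro d
    have : Finite ((Fin d → k) →ₗ[k] (Fin d → k)) := Module.finite_of_finite k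
    exact DFunLike.finite _
  have hT : Finite T := inferInstance
  have := Fintype.ofFinite T
  refine ⟨(Finset.univ : Finset T).toList.map (fun t => FDRep.of t.2), ?_⟩
  rintro N ⟨i, r, hir⟩
  have hle : Module.finrank k N ≤ Module.finrank k W := by
    refine LinearMap.finrank_le_finrank_of_injective (f := i.hom.hom.hom) ?_
    intro x y hxy
    have h1 := congrArg (fun f : N ⟶ N => f.hom.hom.hom) hir
    have h2 : ∀ z, r.hom.hom.hom (i.hom.hom.hom z) = z := fun z => LinearMap.congr_fun h1 z
    rw [← h2 x, ← h2 y, hxy]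
  let e : N ≃ₗ[k] (Fin (Module.finrank k N) → k) := (Module.finBasis k N).equivFun
  let σ : Representation k G (Fin (Module.finrank k N) → k) :=
    e.conjRingEquiv.toMonoidHom.comp N.ρ
  refine ⟨FDRep.of σ, ?_, ?_⟩
  · rw [List.mem_map]
    exact ⟨⟨⟨Module.finrank k N, by omega⟩, σ⟩, by simp, rfl⟩
  · have := cls_eq N.ρ σ e (by
      intro g; ext x; simp [σ])
    exact toSkeleton_eq_toSkeleton_iff.1 this

end Finiteness

section Sym
open MvPolynomial TensorProduct

variable (k : Type) [Field k]

def Sy (j : ℕ) : Type := ↥(homogeneousSubmodule (Fin 2) k j)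

noncomputable instance Sy_grp (j : ℕ) : AddCommGroup (Sy k j) :=
  inferInstanceAs (AddCommGroup ↥(homogeneousSubmodule (Fin 2) k j))

noncomputable instance Sy_mod (j : ℕ) : Module k (Sy k j) :=
  inferInstanceAs (Module k ↥(homogeneousSubmodule (Fin 2) k j))

variable {k} in
def Sy.val {j : ℕ} (f : Sy k j) : MvPolynomial (Fin 2) k := Subtype.val f

variable {k} in
theorem Sy.prop {j : ℕ} (f : Sy k j) : f.val.IsHomogeneous j := Subtype.property f

variable {k} in
def Sy.mk {j : ℕ} (f : MvPolynomial (Fin 2) k) (hf : f.IsHomogeneous j) : Sy k j := ⟨f, hf⟩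

variable {k} in
@[simp] theorem Sy.val_mk {j : ℕ} (f : MvPolynomial (Fin 2) k) (hf : f.IsHomogeneous j) :
    (Sy.mk f hf).val = f := rfl

variable {k} in
theorem Sy.ext {j : ℕ} {f g : Sy k j} (h : f.val = g.val) : f = g := Subtype.ext h

variable {k} in
@[simp] theorem Sy.val_add {j : ℕ} (f g : Sy k j) : (f + g).val = f.val + g.val := rfl

variable {k} in
@[simp] theorem Sy.val_zero {j : ℕ} : (0 : Sy k j).val = 0 := rfl

variable {k} in
@[simp] theorem Sy.val_smul {j : ℕ} (c : k) (f : Sy k j) : (c • f).val = c • f.val := rfl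

/-- the inclusion into the polynomial ring -/
noncomputable def inc (j : ℕ) : Sy k j →ₗ[k] MvPolynomial (Fin 2) k where
  toFun f := f.val
  map_add' _ _ := rfl
  map_smul' _ _ := rfl

theorem inc_inj (j : ℕ) : Function.Injective (inc k j) := fun _ _ h => Sy.ext h

variable {k} in
/-- restricting a linear map -/
noncomputable def syMap {i j : ℕ} (F : MvPolynomial (Fin 2) k →ₗ[k] MvPolynomial (Fin 2) k)
    (hF : ∀ f : MvPolynomial (Fin 2) k, f.IsHomogeneous i → (F f).IsHomogeneous j) :
    Sy k i →ₗ[k] Sy k j where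
  toFun f := Sy.mk (F f.val) (hF _ f.prop)
  map_add' _ _ := Sy.ext (by simp)
  map_smul' _ _ := Sy.ext (by simp)

instance Sy_finite (j : ℕ) : Module.Finite k (Sy k j) :=
  Module.Finite.iff_fg.2 (homogeneousSubmodule_fg (Fin 2) k j)

/-- substitution action of a matrix on polynomials -/
noncomputable def actM (M : Matrix (Fin 2) (Fin 2) k) :
    MvPolynomial (Fin 2) k →ₐ[k] MvPolynomial (Fin 2) k :=
  aeval (fun j => C (M 0 j) * X 0 + C (M 1 j) * X 1)

theorem actM_X (M : Matrix (Fin 2) (Fin 2) k) (j : Fin 2) :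
    actM k M (X j) = C (M 0 j) * X 0 + C (M 1 j) * X 1 := by simp [actM]

theorem actM_one : actM k 1 = AlgHom.id k _ := by
  ext j : 1
  fin_cases j <;> simp [actM_X]

theorem actM_mul (M N : Matrix (Fin 2) (Fin 2) k) :
    actM k (M * N) = (actM k M).comp (actM k N) := by
  ext j : 1
  simp only [actM_X, AlgHom.comp_apply, Matrix.mul_apply, Fin.sum_univ_two, map_add, map_mul,
    algHom_C, algebraMap_eq]
  ring

theorem actM_homog (M : Matrix (Fin 2) (Fin 2) k) {j : ℕ} {f : MvPolynomial (Fin 2) k}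
    (hf : f.IsHomogeneous j) : (actM k M f).IsHomogeneous j := by
  have := hf.aeval (n := 1) (fun j : Fin 2 => (C (M 0 j) * X 0 + C (M 1 j) * X 1 : MvPolynomial (Fin 2) k))
    (fun i => (isHomogeneous_C_mul_X _ _).add (isHomogeneous_C_mul_X _ _))
  simpa [actM] using this

theorem pderiv_actM (M : Matrix (Fin 2) (Fin 2) k) (i : Fin 2) (f : MvPolynomial (Fin 2) k) :
    pderiv i (actM k M f) = C (M i 0) * actM k M (pderiv 0 f)
      + C (M i 1) * actM k M (pderiv 1 f) := by
  induction f using MvPolynomial.induction_on with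
  | C a => simp
  | add p q hp hq => simp only [map_add, hp, hq]; ring
  | mul_X p j hp =>
    have key : pderiv i (actM k M (X j)) = C (M i j) := by
      rw [actM_X]
      fin_cases i <;> simp [pderiv_X]
    simp only [map_mul, Derivation.leibniz, key, hp, smul_eq_mul, map_add]
    fin_cases j <;> simp [pderiv_X] <;> ring

abbrev SL := Matrix.SpecialLinearGroup (Fin 2) k

noncomputable def symRep (j : ℕ) : Representation k (SL k) (Sy k j) where
  toFun g := syMap (actM k g.1).toLinearMap (fun _ hf => actM_homog k g.1 hf)
  map_one' := by
    apply LinearMap.ext; intro f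
    apply Sy.ext
    simp [syMap, actM_one]
  map_mul' g h := by
    apply LinearMap.ext; intro f
    apply Sy.ext
    simp [syMap, actM_mul]

theorem symRep_coe (j : ℕ) (g : SL k) (f : Sy k j) :
    (symRep k j g f ).val = actM k g.1 f.val := rfl

noncomputable def mulX (j : ℕ) (i : Fin 2) : Sy k j →ₗ[k] Sy k (j + 1) :=
  syMap (LinearMap.mulLeft k (X i : MvPolynomial (Fin 2) k)) (fun f hf => by
    have := (isHomogeneous_X k i).mul (show f.IsHomogeneous j from hf)
    rw [add_comm] at this
    exact this)

noncomputable def der (j : ℕ) (i : Fin 2) : Sy k (j + 1) →ₗ[k] Sy k j :=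
  syMap ((pderiv i : Derivation k (MvPolynomial (Fin 2) k) _) :
    MvPolynomial (Fin 2) k →ₗ[k] MvPolynomial (Fin 2) k) (fun f hf => hf.pderiv)

theorem mulX_coe (j : ℕ) (i : Fin 2) (f : Sy k j) :
    (mulX k j i f ).val = X i * f.val := rfl

theorem der_coe (j : ℕ) (i : Fin 2) (f : Sy k (j + 1)) :
    (der k j i f ).val = pderiv i f.val := rfl

theorem symRep_mulX (j : ℕ) (i : Fin 2) (g : SL k) (f : Sy k j) :
    symRep k (j + 1) g (mulX k j i f) =
      g.1 0 i • mulX k j 0 (symRep k j g f) + g.1 1 i • mulX k j 1 (symRep k j g f) := by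
  apply Sy.ext
  simp only [symRep_coe, mulX_coe, map_mul, actM_X, Sy.val_add, Sy.val_smul,
    smul_eq_C_mul]
  ring

theorem der_symRep (j : ℕ) (i : Fin 2) (g : SL k) (f : Sy k (j + 1)) :
    der k j i (symRep k (j + 1) g f) =
      g.1 i 0 • symRep k j g (der k j 0 f) + g.1 i 1 • symRep k j g (der k j 1 f) := by
  apply Sy.ext
  simp only [symRep_coe, der_coe, pderiv_actM, Sy.val_add, Sy.val_smul,
    smul_eq_C_mul]

theorem der_mulX (j : ℕ) (i l : Fin 2) (f : Sy k (j + 1)) :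
    der k (j + 1) i (mulX k (j + 1) l f) =
      mulX k j l (der k j i f) + (if i = l then f else 0) := by
  apply Sy.ext
  simp only [der_coe, mulX_coe, Derivation.leibniz, Sy.val_add, smul_eq_mul, pderiv_X]
  by_cases h : i = l
  · subst h; simp
  · simp [h, Pi.single_apply]

theorem euler (j : ℕ) (f : Sy k (j + 1)) :
    mulX k j 0 (der k j 0 f) + mulX k j 1 (der k j 1 f) = ((j : k) + 1) • f := by
  apply Sy.ext
  have := f.prop.sum_X_mul_pderiv
  rw [Fin.sum_univ_two] at this
  simp only [der_coe, mulX_coe, Sy.val_add, this, Sy.val_smul]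
  simp [add_smul, nsmul_eq_mul, smul_eq_C_mul, add_mul]

theorem mulX_comm (j : ℕ) (i l : Fin 2) (f : Sy k j) :
    mulX k (j + 1) i (mulX k j l f) = mulX k (j + 1) l (mulX k j i f) := by
  apply Sy.ext
  simp only [mulX_coe]; ring

section VV
variable {k} {W : Type} [AddCommGroup W] [Module k W]

abbrev V2 (k : Type) : Type := Fin 2 → k

variable (W) in
noncomputable def evV (i : Fin 2) : W ⊗[k] V2 k →ₗ[k] W :=
  (TensorProduct.rid k W).toLinearMap ∘ₗ LinearMap.lTensor W (LinearMap.proj i)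

@[simp] theorem evV_tmul (i : Fin 2) (w : W) (v : V2 k) : evV W i (w ⊗ₜ v) = v i • w := by
  simp [evV]

variable (W) in
noncomputable def insV (i : Fin 2) : W →ₗ[k] W ⊗[k] V2 k :=
  (TensorProduct.mk k W (V2 k)).flip (Pi.single i 1)

theorem insV_apply (i : Fin 2) (w : W) : insV W i w = w ⊗ₜ[k] (Pi.single i 1 : V2 k) := rfl

theorem tmul_V (w : W) (v : V2 k) : w ⊗ₜ[k] v = v 0 • insV W 0 w + v 1 • insV W 1 w := by
  rw [insV_apply, insV_apply, ← tmul_smul, ← tmul_smul, ← tmul_add]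
  congr 1
  ext i; fin_cases i <;> simp

@[simp] theorem evV_insV (i j : Fin 2) (w : W) :
    evV W i (insV (k := k) W j w) = if i = j then w else 0 := by
  rw [insV_apply, evV_tmul, Pi.single_apply]
  split_ifs <;> simp

theorem insV_evV (x : W ⊗[k] V2 k) :
    insV W 0 (evV W 0 x) + insV W 1 (evV W 1 x) = x := by
  induction x with
  | zero => simp
  | tmul w v => rw [tmul_V w v]; simp
  | add x y hx hy =>
    simp only [map_add]
    rw [add_add_add_comm, hx, hy]

theorem ext_V {Y : Type} [AddCommGroup Y] [Module k Y] {f g : W ⊗[k] V2 k →ₗ[k] Y}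
    (h : ∀ i w, f (insV W i w) = g (insV W i w)) : f = g := by
  apply LinearMap.ext; intro x
  rw [← insV_evV x]
  simp [h]
end VV
end Sym

section Maps
open MvPolynomial TensorProduct
variable {k : Type} [Field k]

section gen
variable {W : Type} [AddCommGroup W] [Module k W]

theorem map_insV (ρ : Representation k (SL k) W) (g : SL k) (i : Fin 2) (w : W) :
    (ρ.tprod (SLnatRep k 2)) g (insV W i w) =
      g.1 0 i • insV W 0 (ρ g w) + g.1 1 i • insV W 1 (ρ g w) := by
  rw [insV_apply, Representation.tprod_apply, TensorProduct.map_tmul, tmul_V]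
  simp [SLnatRep]

theorem evV_map (ρ : Representation k (SL k) W) (g : SL k) (i : Fin 2) (x : W ⊗[k] V2 k) :
    evV W i ((ρ.tprod (SLnatRep k 2)) g x) =
      g.1 i 0 • ρ g (evV W 0 x) + g.1 i 1 • ρ g (evV W 1 x) := by
  conv_lhs => rw [← insV_evV x]
  simp only [map_add, map_insV, map_smul, evV_insV]
  fin_cases i <;> simp
end gen

theorem SL_det (g : SL k) : g.1 0 0 * g.1 1 1 - g.1 0 1 * g.1 1 0 = 1 := by
  rw [← Matrix.det_fin_two]; exact g.2

variable (k) in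
noncomputable def muM (j : ℕ) : Sy k j ⊗[k] V2 k →ₗ[k] Sy k (j + 1) :=
  mulX k j 0 ∘ₗ evV _ 0 + mulX k j 1 ∘ₗ evV _ 1
variable (k) in
noncomputable def deM (j : ℕ) : Sy k (j + 1) →ₗ[k] Sy k j ⊗[k] V2 k :=
  insV _ 0 ∘ₗ der k j 0 + insV _ 1 ∘ₗ der k j 1
variable (k) in
noncomputable def alM (j : ℕ) : Sy k j →ₗ[k] Sy k (j + 1) ⊗[k] V2 k :=
  insV _ 1 ∘ₗ mulX k j 0 - insV _ 0 ∘ₗ mulX k j 1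
variable (k) in
noncomputable def beM (j : ℕ) : Sy k (j + 1) ⊗[k] V2 k →ₗ[k] Sy k j :=
  der k j 1 ∘ₗ evV _ 0 - der k j 0 ∘ₗ evV _ 1

theorem muM_eq (j : ℕ) (g : SL k) :
    muM k j ∘ₗ ((symRep k j).tprod (SLnatRep k 2)) g = symRep k (j + 1) g ∘ₗ muM k j := by
  apply LinearMap.ext; intro x
  simp only [muM, LinearMap.comp_apply, LinearMap.add_apply, evV_map, map_add, map_smul, symRep_mulX]
  module

theorem deM_eq (j : ℕ) (g : SL k) :
    deM k j ∘ₗ symRep k (j + 1) g = ((symRep k j).tprod (SLnatRep k 2)) g ∘ₗ deM k j := by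
  apply LinearMap.ext; intro x
  simp only [deM, LinearMap.comp_apply, LinearMap.add_apply, map_insV, map_add, map_smul, der_symRep]
  module

theorem alM_eq (j : ℕ) (g : SL k) :
    alM k j ∘ₗ symRep k j g = ((symRep k (j + 1)).tprod (SLnatRep k 2)) g ∘ₗ alM k j := by
  apply LinearMap.ext; intro x
  simp only [alM, LinearMap.comp_apply, LinearMap.sub_apply, map_insV, map_sub, map_smul,
    symRep_mulX, map_add]
  linear_combination (norm := module) (-SL_det g) • (insV _ 1 (mulX k j 0 (symRep k j g x)) -
    insV _ 0 (mulX k j 1 (symRep k j g x)) : Sy k (j + 1) ⊗[k] V2 k)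

theorem beM_eq (j : ℕ) (g : SL k) :
    beM k j ∘ₗ ((symRep k (j + 1)).tprod (SLnatRep k 2)) g = symRep k j g ∘ₗ beM k j := by
  apply LinearMap.ext; intro x
  simp only [beM, LinearMap.comp_apply, LinearMap.sub_apply, evV_map, map_add, map_sub, map_smul,
    der_symRep]
  linear_combination (norm := module) (SL_det g) • (symRep k j g (der k j 1 (evV _ 0 x)) -
    symRep k j g (der k j 0 (evV _ 1 x)))

theorem deM_muM (j : ℕ) : deM k (j + 1) ∘ₗ muM k (j + 1) - alM k j ∘ₗ beM k j
    = ((j : k) + 2) • LinearMap.id := by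
  apply ext_V
  intro i w
  have h := euler k j w
  have h0 := congrArg (insV (k := k) (Sy k (j + 1)) 0) h
  have h1 := congrArg (insV (k := k) (Sy k (j + 1)) 1) h
  simp only [map_add, map_smul] at h0 h1
  fin_cases i
  · simp [deM, muM, alM, beM, der_mulX]
    linear_combination (norm := module) h0
  · simp [deM, muM, alM, beM, der_mulX]
    linear_combination (norm := module) h1

theorem muM_deM (j : ℕ) : muM k j ∘ₗ deM k j = ((j : k) + 1) • LinearMap.id := by
  apply LinearMap.ext; intro w
  simpa [deM, muM] using euler k j w

theorem muM_alM (j : ℕ) : muM k (j + 1) ∘ₗ alM k j = 0 := by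
  apply LinearMap.ext; intro w
  simp [alM, muM, mulX_comm k j 0 1]

theorem beM_alM (j : ℕ) : beM k (j + 1) ∘ₗ alM k (j + 1) = (-((j : k) + 3)) • LinearMap.id := by
  apply LinearMap.ext; intro w
  have h := euler k j w
  simp [alM, beM, der_mulX]
  linear_combination (norm := module) -h

/-- degree zero -/
theorem deM_muM0 : deM k 0 ∘ₗ muM k 0 = LinearMap.id := by
  have key : ∀ (i l : Fin 2) (w : Sy k 0), der k 0 i (mulX k 0 l w) = if i = l then w else 0 := by
    intro i l w
    have hw : pderiv i w.val = 0 := by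
      obtain ⟨c, hc⟩ : ∃ c, w.val = C c := ⟨_, totalDegree_eq_zero_iff_eq_C.1
        (Nat.le_zero.1 (w.prop.totalDegree_le))⟩
      rw [hc]; simp
    apply Sy.ext
    simp only [der_coe, mulX_coe, Derivation.leibniz, smul_eq_mul, pderiv_X, hw]
    by_cases h : i = l
    · subst h; simp
    · simp [h, Pi.single_apply]
  apply ext_V
  intro i w
  fin_cases i <;> simp [deM, muM, key]

/-- constants -/
noncomputable def sy0 : k ≃ₗ[k] Sy k 0 :=
  LinearEquiv.ofBijective
    { toFun := fun c => Sy.mk (C c) (isHomogeneous_C (Fin 2) c)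
      map_add' := fun a b => Sy.ext (by simp)
      map_smul' := fun a b => Sy.ext (by simp [smul_eq_C_mul]) } ⟨by
      intro a b h
      have := congrArg Sy.val h
      simpa using this, by
      intro w
      refine ⟨coeff 0 w.val, ?_⟩
      apply Sy.ext
      exact (totalDegree_eq_zero_iff_eq_C.1
        (Nat.le_zero.1 (w.prop.totalDegree_le))).symm⟩

theorem sy0_coe (c : k) : (sy0 c).val = C c := rfl

theorem sy0_eq (g : SL k) : sy0.toLinearMap ∘ₗ (Representation.trivial k (SL k) k) g
    = symRep k 0 g ∘ₗ sy0.toLinearMap := by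
  ext1
  apply Sy.ext
  simp [symRep_coe, sy0_coe]

end Maps

section LA
variable {k : Type} [Field k] {X U Y : Type} [AddCommGroup X] [Module k X] [AddCommGroup U]
  [Module k U] [AddCommGroup Y] [Module k Y] [Module.Finite k X] [Module.Finite k U]
  [Module.Finite k Y]

theorem la_split (a : U →ₗ[k] X) (b : X →ₗ[k] U) (τ : X →ₗ[k] X) (m : X →ₗ[k] Y)
    (hτ : ∀ x, τ (τ x) = x) (hm : Function.Surjective m) (hma : ∀ u, m (a u) = 0)
    (hmτ : ∀ x, m (τ x) = m x) (hba : ∀ u, b (a u) = 0)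
    (hθ : Function.Injective (b ∘ₗ τ ∘ₗ a))
    (hd : Module.finrank k X = 2 * Module.finrank k U + Module.finrank k Y) :
    ∃ (t : U →ₗ[k] U) (s : Y →ₗ[k] X),
      s ∘ₗ m + a ∘ₗ (t ∘ₗ b ∘ₗ τ) + (τ ∘ₗ a ∘ₗ t) ∘ₗ b = LinearMap.id ∧
      m ∘ₗ s = LinearMap.id ∧
      ∀ (x : X →ₗ[k] X) (u : U →ₗ[k] U) (y : Y →ₗ[k] Y), a ∘ₗ u = x ∘ₗ a → b ∘ₗ x = u ∘ₗ b →
        τ ∘ₗ x = x ∘ₗ τ → m ∘ₗ x = y ∘ₗ m → t ∘ₗ u = u ∘ₗ t ∧ s ∘ₗ y = x ∘ₗ s := by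
  let Θ : U ≃ₗ[k] U := LinearEquiv.ofInjectiveEndo _ hθ
  have hΘ : ∀ u, Θ u = b (τ (a u)) := fun u => rfl
  let t : U →ₗ[k] U := Θ.symm.toLinearMap
  have ht1 : ∀ u, t (b (τ (a u))) = u := fun u => by
    rw [← hΘ]; exact Θ.symm_apply_apply u
  have ht2 : ∀ u, b (τ (a (t u))) = u := fun u => by
    rw [← hΘ]; exact Θ.apply_symm_apply u
  let e : X →ₗ[k] X := LinearMap.id - a ∘ₗ (t ∘ₗ b ∘ₗ τ) - (τ ∘ₗ a ∘ₗ t) ∘ₗ b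
  have he : ∀ x, e x = x - a (t (b (τ x))) - τ (a (t (b x))) := fun x => rfl
  let c : U × U →ₗ[k] X := a.coprod (τ ∘ₗ a)
  have hc : ∀ u, c u = a u.1 + τ (a u.2) := fun u => by simp [c]
  have hcinj : Function.Injective c := by
    rw [← LinearMap.ker_eq_bot, LinearMap.ker_eq_bot']
    rintro ⟨u, v⟩ h
    rw [hc] at h
    have h1 : v = 0 := by
      have := congrArg (fun z => t (b z)) h
      simpa [hba, ht1] using this
    have h2 : u = 0 := by
      have := congrArg (fun z => t (b (τ z))) h
      simpa [hba, ht1, hτ] using this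
    rw [h1, h2]; rfl
  have hle : LinearMap.range c ≤ LinearMap.ker m := by
    rintro _ ⟨u, rfl⟩
    rw [LinearMap.mem_ker, hc]
    simp [hma, hmτ]
  have hker : LinearMap.range c = LinearMap.ker m := by
    apply Submodule.eq_of_le_of_finrank_eq hle
    have h1 := LinearMap.finrank_range_add_finrank_ker m
    have h2 := LinearMap.finrank_range_of_inj hcinj
    rw [LinearMap.range_eq_top.2 hm, finrank_top] at h1
    rw [Module.finrank_prod] at h2
    omega
  have hek : LinearMap.ker m ≤ LinearMap.ker e := by
    rw [← hker]
    rintro _ ⟨u, rfl⟩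
    rw [LinearMap.mem_ker, he, hc]
    simp [hba, ht1, hτ]
  obtain ⟨r, hr⟩ := m.exists_rightInverse_of_surjective (LinearMap.range_eq_top.2 hm)
  have hr' : ∀ y, m (r y) = y := fun y => LinearMap.congr_fun hr y
  have hs : ∀ x, e (r (m x)) = e x := by
    intro x
    rw [← sub_eq_zero, ← map_sub]
    apply hek
    simp [hr']
  refine ⟨t, e ∘ₗ r, ?_, ?_, ?_⟩
  · apply LinearMap.ext; intro x
    simp only [LinearMap.add_apply, LinearMap.comp_apply, hs, he, LinearMap.id_apply]
    abel
  · apply LinearMap.ext; intro y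
    simp [he, hma, hmτ, hr']
  · intro x u y ha hb ht hm'
    have ha' : ∀ z, a (u z) = x (a z) := fun z => LinearMap.congr_fun ha z
    have hb' : ∀ z, b (x z) = u (b z) := fun z => LinearMap.congr_fun hb z
    have ht' : ∀ z, τ (x z) = x (τ z) := fun z => LinearMap.congr_fun ht z
    have hm'' : ∀ z, m (x z) = y (m z) := fun z => LinearMap.congr_fun hm' z
    have htu : ∀ z, t (u z) = u (t z) := by
      intro z
      conv_lhs => rw [← ht2 z, ← hb', ← ht', ← ha', ht1]
    have hex : ∀ z, e (x z) = x (e z) := by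
      intro z
      simp only [he, map_sub, ht', hb', htu, ha']
    refine ⟨LinearMap.ext htu, LinearMap.ext fun z => ?_⟩
    obtain ⟨z, rfl⟩ := hm z
    simp only [LinearMap.comp_apply]
    rw [← hm'', hs, hs, hex]

end LA

theorem sl2_inj {k X : Type} [Field k] [AddCommGroup X] [Module k X] (p : ℕ) [CharP k p] [Fact p.Prime] (E F H : X →ₗ[k] X)
    (hEF : ∀ x, E (F x) = F (E x) + H x) (hHF : ∀ x, H (F x) = F (H x) - (2 : k) • F x)
    (h : X) (hh : H h = - h) (hE : E h = 0) (hF : (F ^ (p - 1)) h = 0) : h = 0 := by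
  have h1 : ∀ r : ℕ, H ((F ^ r) h) = (-(1 + 2 * (r : k))) • (F ^ r) h := by
    intro r
    induction r with
    | zero => simp [hh]
    | succ r ih =>
      rw [pow_succ', Module.End.mul_apply, hHF, ih]
      simp only [map_smul]
      push_cast
      module
  have h2 : ∀ r : ℕ, E ((F ^ (r + 1)) h) = (-((r : k) + 1) ^ 2) • (F ^ r) h := by
    intro r
    induction r with
    | zero => simp [hEF, hE, hh]
    | succ r ih =>
      rw [pow_succ', Module.End.mul_apply, hEF, ih, h1, map_smul, ← Module.End.mul_apply F,
        ← pow_succ']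
      push_cast
      module
  have h3 : ∀ d : ℕ, ∀ r, r + d = p - 1 → (F ^ r) h = 0 := by
    intro d
    induction d with
    | zero => intro r hr; rw [show r = p - 1 by omega]; exact hF
    | succ d ih =>
      intro r hr
      have := h2 r
      rw [ih (r + 1) (by omega), map_zero] at this
      have hne : (-((r : k) + 1) ^ 2) ≠ 0 := by
        have : ((r + 1 : ℕ) : k) ≠ 0 := by
          rw [Ne, CharP.cast_eq_zero_iff k p]
          intro hd
          have := Nat.le_of_dvd (by omega) hd
          omega
        push_cast at this
        exact neg_ne_zero.2 (pow_ne_zero _ this)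
      exact (smul_eq_zero.1 this.symm).resolve_left hne
  simpa using h3 (p - 1) 0 (by omega)

section Theta
open MvPolynomial TensorProduct
variable {k : Type} [Field k]

variable (k) in
abbrev PA : Type := MvPolynomial (Fin 2) k

noncomputable def DD (i : Fin 2) : PA k →ₗ[k] PA k :=
  ((pderiv i : Derivation k (PA k) _) : PA k →ₗ[k] PA k)
noncomputable def XX (i : Fin 2) : PA k →ₗ[k] PA k := LinearMap.mulLeft k (X i)

theorem DD_apply (i : Fin 2) (f : PA k) : DD i f = pderiv i f := rfl
theorem XX_apply (i : Fin 2) (f : PA k) : XX i f = X i * f := rfl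

theorem DD_XX (i l : Fin 2) (f : PA k) : DD i (XX l f) = XX l (DD i f) + if i = l then f else 0 := by
  simp only [DD_apply, XX_apply, Derivation.leibniz, smul_eq_mul, pderiv_X]
  by_cases h : i = l
  · subst h; simp
  · simp [h]

variable (k) in
noncomputable def EE : PA k ⊗[k] PA k →ₗ[k] PA k ⊗[k] PA k :=
  TensorProduct.map (DD 0) (XX 0) + TensorProduct.map (DD 1) (XX 1)
variable (k) in
noncomputable def FF : PA k ⊗[k] PA k →ₗ[k] PA k ⊗[k] PA k :=
  TensorProduct.map (XX 0) (DD 0) + TensorProduct.map (XX 1) (DD 1)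
variable (k) in
noncomputable def eul : PA k →ₗ[k] PA k := XX 0 ∘ₗ DD 0 + XX 1 ∘ₗ DD 1
variable (k) in
noncomputable def HH : PA k ⊗[k] PA k →ₗ[k] PA k ⊗[k] PA k :=
  TensorProduct.map LinearMap.id (eul k) - TensorProduct.map (eul k) LinearMap.id

theorem EF_comm (x : PA k ⊗[k] PA k) : EE k (FF k x) = FF k (EE k x) + HH k x := by
  induction x with
  | zero => simp
  | add x y hx hy => simp only [map_add, hx, hy]; abel
  | tmul f z =>
    simp [EE, FF, HH, eul, DD_XX, add_tmul, tmul_add]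
    abel

theorem XX_comm (i l : Fin 2) (f : PA k) : XX i (XX l f) = XX l (XX i f) := by
  simp only [XX_apply]; ring

theorem DD_comm (i l : Fin 2) (f : PA k) : DD i (DD l f) = DD l (DD i f) := by
  simp only [DD_apply]
  induction f using MvPolynomial.induction_on with
  | C a => simp
  | add p q hp hq => simp only [map_add, hp, hq]
  | mul_X p j hp =>
    have h : ∀ a b : Fin 2, pderiv a (Pi.single (M := fun _ => PA k) b 1 j) = 0 := by
      intro a b
      rw [Pi.single_apply]; split_ifs <;> simp
    simp only [Derivation.leibniz, pderiv_X, smul_eq_mul, map_add, hp, h]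
    ring

theorem eul_XX (i : Fin 2) (f : PA k) : eul k (XX i f) = XX i (eul k f) + XX i f := by
  fin_cases i <;> simp [eul, DD_XX, XX_comm 1 0] <;> abel

theorem eul_DD (i : Fin 2) (f : PA k) : eul k (DD i f) = DD i (eul k f) - DD i f := by
  fin_cases i <;> simp [eul, DD_XX, DD_comm 1 0] <;> abel

theorem HF_comm (x : PA k ⊗[k] PA k) : HH k (FF k x) = FF k (HH k x) - (2 : k) • FF k x := by
  induction x with
  | zero => simp
  | add x y hx hy => simp only [map_add, hx, hy, smul_add]; abel
  | tmul f z =>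
    simp only [FF, HH, LinearMap.add_apply, LinearMap.sub_apply, map_tmul, map_add, map_sub,
      LinearMap.id_apply, eul_XX, eul_DD, add_tmul, tmul_sub]
    module

theorem eul_hom {j : ℕ} {f : PA k} (hf : f.IsHomogeneous j) : eul k f = (j : k) • f := by
  have := hf.sum_X_mul_pderiv
  rw [Fin.sum_univ_two] at this
  simp only [eul, LinearMap.add_apply, LinearMap.comp_apply, DD_apply, XX_apply, this]
  simp [smul_eq_C_mul]

theorem FF_nil (m : ℕ) : ∀ (f z : PA k), z.IsHomogeneous m → (FF k ^ (m + 1)) (f ⊗ₜ z) = 0 := by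
  have h0 : ∀ (i : Fin 2) (z : PA k), z.IsHomogeneous 0 → DD i z = 0 := by
    intro i z hz
    rw [totalDegree_eq_zero_iff_eq_C.1 (Nat.le_zero.1 hz.totalDegree_le)]
    simp [DD_apply]
  induction m with
  | zero =>
    intro f z hz
    simp [FF, h0 _ z hz]
  | succ m ih =>
    intro f z hz
    rw [pow_succ, Module.End.mul_apply]
    have hd : ∀ i, (DD i z).IsHomogeneous m := fun i => hz.pderiv
    simp only [FF, LinearMap.add_apply, map_tmul, map_add]
    rw [← FF, ih _ _ (hd 0), ih _ _ (hd 1), add_zero]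

variable (k) in
noncomputable def inc2 (a b : ℕ) : Sy k a ⊗[k] Sy k b →ₗ[k] PA k ⊗[k] PA k :=
  TensorProduct.map (inc k a) (inc k b)

theorem inc2_inj (a b : ℕ) : Function.Injective (inc2 k a b) :=
  TensorProduct.map_injective_of_flat_flat _ _ (inc_inj k a) (inc_inj k b)

theorem inc2_HH (a b : ℕ) (x : Sy k a ⊗[k] Sy k b) :
    HH k (inc2 k a b x) = ((b : k) - a) • inc2 k a b x := by
  induction x with
  | zero => simp
  | add x y hx hy => simp only [map_add, hx, hy, smul_add]
  | tmul f z =>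
    simp only [inc2, map_tmul, HH, LinearMap.sub_apply, LinearMap.id_apply]
    rw [eul_hom (show (inc k a f).IsHomogeneous a from f.prop),
      eul_hom (show (inc k b z).IsHomogeneous b from z.prop), tmul_smul, ← smul_tmul']
    module

theorem inc2_FF (a b : ℕ) (x : Sy k a ⊗[k] Sy k b) : (FF k ^ (b + 1)) (inc2 k a b x) = 0 := by
  induction x with
  | zero => simp
  | add x y hx hy => simp only [map_add, hx, hy, add_zero]
  | tmul f z => exact FF_nil b _ _ z.prop

theorem EE_inj (r : ℕ) [CharP k (r + 2)] [Fact (r + 2).Prime] (x : Sy k (r + 1) ⊗[k] Sy k r)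
    (hx : EE k (inc2 k _ _ x) = 0) : x = 0 := by
  apply inc2_inj
  rw [map_zero]
  refine sl2_inj (r + 2) (EE k) (FF k) (HH k) EF_comm HF_comm _ ?_ hx (inc2_FF _ _ x)
  rw [inc2_HH]
  push_cast
  module

variable (k) in
noncomputable def aT (r : ℕ) : Sy k (r + 1) ⊗[k] Sy k r →ₗ[k] Sy k (r + 1) ⊗[k] (Sy k (r + 1) ⊗[k] V2 k) :=
  LinearMap.lTensor _ (alM k r)
variable (k) in
noncomputable def bT (r : ℕ) : Sy k (r + 1) ⊗[k] (Sy k (r + 1) ⊗[k] V2 k) →ₗ[k] Sy k (r + 1) ⊗[k] Sy k r :=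
  LinearMap.lTensor _ (beM k r)
variable (k) in
noncomputable def tT (r : ℕ) : Sy k (r + 1) ⊗[k] (Sy k (r + 1) ⊗[k] V2 k) →ₗ[k]
    Sy k (r + 1) ⊗[k] (Sy k (r + 1) ⊗[k] V2 k) :=
  (TensorProduct.leftComm k _ _ _).toLinearMap

theorem theta_eq (r : ℕ) (x : Sy k (r + 1) ⊗[k] Sy k r) :
    TensorProduct.comm k _ _ (inc2 k _ _ (bT k r (tT k r (aT k r x)))) = - EE k (inc2 k _ _ x) := by
  induction x with
  | zero => simp
  | add x y hx hy => simp only [map_add, hx, hy, neg_add]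
  | tmul f z =>
    simp [aT, bT, tT, alM, beM, insV_apply, tmul_sub, inc2, EE]
    rfl

theorem theta_inj (r : ℕ) [CharP k (r + 2)] [Fact (r + 2).Prime] :
    Function.Injective (bT k r ∘ₗ tT k r ∘ₗ aT k r) := by
  rw [← LinearMap.ker_eq_bot, LinearMap.ker_eq_bot']
  intro x hx
  apply EE_inj
  rw [← neg_eq_zero, ← theta_eq]
  simp only [LinearMap.comp_apply] at hx
  rw [hx]; simp
end Theta

section Psi
open MvPolynomial TensorProduct
variable {k : Type} [Field k]

theorem deg2 (d : Fin 2 →₀ ℕ) : d.degree = d 0 + d 1 := by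
  rw [Finsupp.degree_eq_sum, Fin.sum_univ_two]

noncomputable def ex2 (a b : ℕ) : Fin 2 →₀ ℕ := Finsupp.single 0 a + Finsupp.single 1 b

theorem ex2_0 (a b : ℕ) : ex2 a b 0 = a := by simp [ex2]
theorem ex2_1 (a b : ℕ) : ex2 a b 1 = b := by simp [ex2]

theorem ex2_eq (d : Fin 2 →₀ ℕ) : ex2 (d 0) (d 1) = d := by
  ext i; fin_cases i
  · exact ex2_0 _ _
  · exact ex2_1 _ _

theorem finrank_Sy (j : ℕ) : Module.finrank k (Sy k j) = j + 1 := by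
  have hdeg : ∀ (i : Fin (j + 1)) (c : k), (monomial (ex2 i.1 (j - i.1)) c :
      MvPolynomial (Fin 2) k).IsHomogeneous j := by
    intro i c
    apply isHomogeneous_monomial
    have := i.2
    rw [deg2, ex2_0, ex2_1]
    omega
  obtain ⟨mo, hmo⟩ : ∃ mo : Fin (j + 1) → k → Sy k j, ∀ i c, (mo i c).val =
      monomial (ex2 i.1 (j - i.1)) c := ⟨fun i c => Sy.mk _ (hdeg i c), fun i c => rfl⟩
  clear hdeg
  let c : Sy k j →ₗ[k] (Fin (j + 1) → k) := LinearMap.pi fun i =>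
    (lcoeff k (ex2 i.1 (j - i.1))) ∘ₗ inc k j
  have hcc : ∀ f i, c f i = coeff (ex2 i.1 (j - i.1)) f.val := fun f i => rfl
  have hc : Function.Bijective c := by
    constructor
    · rw [← LinearMap.ker_eq_bot, LinearMap.ker_eq_bot']
      intro f hf
      apply Sy.ext
      apply MvPolynomial.ext
      intro d
      by_cases hd : d.degree = j
      · rw [deg2] at hd
        have := congrFun hf ⟨d 0, by omega⟩
        rw [hcc] at this
        simp only at this
        rw [show j - d 0 = d 1 by omega, ex2_eq] at this
        simpa using this
      · rw [f.prop.coeff_eq_zero hd]; simp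
    · intro y
      refine ⟨∑ i : Fin (j + 1), mo i (y i), ?_⟩
      ext l
      rw [map_sum, Finset.sum_apply, Finset.sum_eq_single l]
      · rw [hcc, hmo, coeff_monomial, if_pos rfl]
      · intro b _ hb
        rw [hcc, hmo, coeff_monomial, if_neg]
        intro h
        have := DFunLike.congr_fun h 0
        rw [ex2_0, ex2_0] at this
        exact hb (Fin.ext this)
      · simp
  rw [(LinearEquiv.ofBijective c hc).finrank_eq]
  simp

theorem mem_of_monomials (j : ℕ) (P : Submodule k (PA k))
    (h : ∀ a b, a + b = j → (X 0 ^ a * X 1 ^ b : PA k) ∈ P) (f : PA k) (hf : f.IsHomogeneous j) :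
    f ∈ P := by
  rw [f.as_sum]
  refine Submodule.sum_mem _ fun d hd => ?_
  have h1 := hf (mem_support_iff.1 hd)
  have h2 : d.degree = j := by
    by_contra hne
    exact (mem_support_iff.1 hd) (hf.coeff_eq_zero hne)
  rw [deg2] at h2
  have := P.smul_mem (coeff d f) (h _ _ h2)
  convert this using 1
  rw [monomial_eq, smul_eq_C_mul, Finsupp.prod_fintype _ _ (by simp), Fin.prod_univ_two]

/-- multiplication by `X_i^m` -/
noncomputable def powX (a b m : ℕ) (h : b = a + m) (i : Fin 2) : Sy k a →ₗ[k] Sy k b :=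
  syMap (LinearMap.mulLeft k (X i ^ m)) (fun f hf => by
    have := (isHomogeneous_X_pow (R := k) i m).mul hf
    rw [h, add_comm]; exact this)

theorem powX_val (a b m : ℕ) (h : b = a + m) (i : Fin 2) (f : Sy k a) :
    (powX a b m h i f).val = X i ^ m * f.val := rfl

noncomputable def psiM (a b m : ℕ) (h : b = a + m) : Sy k a ⊗[k] V2 k →ₗ[k] Sy k b :=
  powX a b m h 0 ∘ₗ evV _ 0 + powX a b m h 1 ∘ₗ evV _ 1

theorem psiM_surj (a b m : ℕ) (h : b = a + m) (hm : m = a + 1) :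
    Function.Surjective (psiM (k := k) a b m h) := by
  have key : LinearMap.range (inc k b ∘ₗ psiM (k := k) a b m h) =
      LinearMap.range (inc k b) := by
    apply le_antisymm
    · exact LinearMap.range_comp_le_range _ _
    · rintro _ ⟨f, rfl⟩
      refine mem_of_monomials b _ ?_ _ f.prop
      intro c d hcd
      by_cases hc : m ≤ c
      · have hh : (X 0 ^ (c - m) * X 1 ^ d : PA k).IsHomogeneous a := by
          have := (isHomogeneous_X_pow (R := k) (0 : Fin 2) (c - m)).mul
            (isHomogeneous_X_pow (R := k) (1 : Fin 2) d)
          convert this using 1; omega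
        refine ⟨insV _ 0 (Sy.mk _ hh), ?_⟩
        simp only [psiM, LinearMap.comp_apply, LinearMap.add_apply, evV_insV]
        simp only [if_true, one_ne_zero, if_false, map_zero, add_zero]
        show (powX a b m h 0 _).val = _
        rw [powX_val, Sy.val_mk, ← mul_assoc, ← pow_add]
        congr 2; omega
      · have hh : (X 0 ^ c * X 1 ^ (d - m) : PA k).IsHomogeneous a := by
          have := (isHomogeneous_X_pow (R := k) (0 : Fin 2) c).mul
            (isHomogeneous_X_pow (R := k) (1 : Fin 2) (d - m))
          convert this using 1; omega
        refine ⟨insV _ 1 (Sy.mk _ hh), ?_⟩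
        simp only [psiM, LinearMap.comp_apply, LinearMap.add_apply, evV_insV]
        simp only [if_true, zero_ne_one, if_false, map_zero, zero_add]
        show (powX a b m h 1 _).val = _
        rw [powX_val, Sy.val_mk, mul_left_comm, ← pow_add]
        congr 2; omega
  intro f
  have : inc k b f ∈ LinearMap.range (inc k b ∘ₗ psiM (k := k) a b m h) := by
    rw [key]; exact ⟨f, rfl⟩
  obtain ⟨x, hx⟩ := this
  exact ⟨x, inc_inj k b hx⟩

theorem psiM_bij (a b m : ℕ) (h : b = a + m) (hm : m = a + 1) :
    Function.Bijective (psiM (k := k) a b m h) := by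
  have hs := psiM_surj (k := k) a b m h hm
  refine ⟨(LinearMap.injective_iff_surjective_of_finrank_eq_finrank ?_).2 hs, hs⟩
  rw [Module.finrank_tensorProduct, finrank_Sy, finrank_Sy]
  simp; omega

theorem evV_map' {W : Type} [AddCommGroup W] [Module k W] (L : W →ₗ[k] W) (g : SL k) (i : Fin 2)
    (x : W ⊗[k] V2 k) :
    evV W i (TensorProduct.map L (SLnatRep k 2 g) x) =
      g.1 i 0 • L (evV W 0 x) + g.1 i 1 • L (evV W 1 x) := by
  induction x with
  | zero => simp
  | add x y hx hy => simp only [map_add, hx, hy]; module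
  | tmul w v =>
    simp only [TensorProduct.map_tmul, evV_tmul, map_smul]
    simp [SLnatRep, Matrix.mulVec, dotProduct]
    module

variable (k) in
noncomputable def frobSL (p : ℕ) [Fact p.Prime] [CharP k p] : SL k →* SL k :=
  Matrix.SpecialLinearGroup.map (frobenius k p)

theorem frobSL_apply (p : ℕ) [Fact p.Prime] [CharP k p] (g : SL k) (i j : Fin 2) :
    (frobSL k p g).1 i j = (g.1 i j) ^ p := by
  simp [frobSL, frobenius_def]

theorem psiM_eq (a b p : ℕ) [Fact p.Prime] [CharP k p] (h : b = a + p) (g : SL k) :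
    psiM (k := k) a b p h ∘ₗ ((symRep k a).tprod ((SLnatRep k 2).comp (frobSL k p))) g
      = symRep k b g ∘ₗ psiM a b p h := by
  apply LinearMap.ext; intro x
  have h1 : ∀ i, evV _ i (((symRep k a).tprod ((SLnatRep k 2).comp (frobSL k p))) g x) =
      (g.1 i 0) ^ p • symRep k a g (evV _ 0 x) + (g.1 i 1) ^ p • symRep k a g (evV _ 1 x) := by
    intro i
    rw [← frobSL_apply, ← frobSL_apply]
    exact evV_map' _ _ _ _
  have h2 : ∀ i (f : Sy k a), symRep k b g (powX a b p h i f) =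
      (g.1 0 i) ^ p • powX a b p h 0 (symRep k a g f) +
      (g.1 1 i) ^ p • powX a b p h 1 (symRep k a g f) := by
    intro i f
    apply Sy.ext
    simp only [symRep_coe, powX_val, map_mul, map_pow, actM_X, Sy.val_add, Sy.val_smul,
      smul_eq_C_mul]
    rw [add_pow_char]
    ring
  simp only [psiM, LinearMap.comp_apply, LinearMap.add_apply, h1, map_add, map_smul, h2]
  module

variable (k) in
noncomputable def mulS (a b : ℕ) : Sy k a →ₗ[k] Sy k b →ₗ[k] Sy k (a + b) :=
  LinearMap.mk₂ k (fun f g => Sy.mk (f.val * g.val) (f.prop.mul g.prop))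
    (fun _ _ _ => Sy.ext (by simp [add_mul])) (fun _ _ _ => Sy.ext (by simp))
    (fun _ _ _ => Sy.ext (by simp [mul_add])) (fun _ _ _ => Sy.ext (by simp))

theorem mulS_val (a b : ℕ) (f : Sy k a) (g : Sy k b) : (mulS k a b f g).val = f.val * g.val := rfl

variable (k) in
noncomputable def mT (r : ℕ) : Sy k (r + 1) ⊗[k] (Sy k (r + 1) ⊗[k] V2 k) →ₗ[k]
    Sy k (r + 1 + (r + 1 + 1)) :=
  TensorProduct.lift (mulS k (r + 1) (r + 1 + 1)) ∘ₗ LinearMap.lTensor _ (muM k (r + 1))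

theorem mT_val (r : ℕ) (f g : Sy k (r + 1)) (v : V2 k) :
    (mT k r (f ⊗ₜ (g ⊗ₜ v))).val = f.val * g.val * (C (v 0) * X 0 + C (v 1) * X 1) := by
  simp [mT, mulS_val, muM, mulX_coe, smul_eq_C_mul]
  ring

theorem mT_aT (r : ℕ) (u) : mT k r (aT k r u) = 0 := by
  have : LinearMap.lTensor (Sy k (r + 1)) (muM k (r + 1)) ∘ₗ aT k r = 0 := by
    rw [aT, ← LinearMap.lTensor_comp, muM_alM, LinearMap.lTensor_zero]
  have h := LinearMap.congr_fun this u
  simp only [LinearMap.comp_apply] at h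
  simp [mT, h]

theorem tri_ind {W Y : Type} [AddCommGroup W] [Module k W] [AddCommGroup Y] [Module k Y]
    {F G : W ⊗[k] (W ⊗[k] V2 k) →ₗ[k] Y}
    (h : ∀ f g v, F (f ⊗ₜ (g ⊗ₜ v)) = G (f ⊗ₜ (g ⊗ₜ v))) : F = G := by
  apply TensorProduct.ext'
  intro f x
  induction x with
  | zero => simp
  | add x y hx hy => simp only [tmul_add, map_add, hx, hy]
  | tmul g v => exact h f g v

theorem mT_tT (r : ℕ) (x) : mT k r (tT k r x) = mT k r x := by
  refine LinearMap.congr_fun (tri_ind (F := mT k r ∘ₗ tT k r) (G := mT k r) ?_) x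
  intro f g v
  apply Sy.ext
  simp only [LinearMap.comp_apply]
  rw [mT_val]
  simp only [tT, LinearEquiv.coe_coe, leftComm_tmul]
  rw [mT_val]
  ring

theorem tT_tT (r : ℕ) (x) : tT k r (tT k r x) = x := by
  refine LinearMap.congr_fun (tri_ind (F := tT k r ∘ₗ tT k r) (G := LinearMap.id) ?_) x
  intro f g v
  simp [tT]

theorem bT_aT (r : ℕ) [CharP k (r + 1 + 2)] (u) : bT k (r + 1) (aT k (r + 1) u) = 0 := by
  have : bT k (r + 1) ∘ₗ aT k (r + 1) = 0 := by
    have h0 : (r : k) + 3 = 0 := by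
      have := CharP.cast_eq_zero k (r + 1 + 2)
      push_cast at this
      rw [← this]; ring
    rw [aT, bT, ← LinearMap.lTensor_comp, beM_alM, h0]
    simp
  exact LinearMap.congr_fun this u

theorem mT_surj (r : ℕ) : Function.Surjective (mT k r) := by
  intro y
  obtain ⟨x, rfl⟩ := psiM_surj (k := k) (r + 1) _ (r + 1 + 1) rfl rfl y
  have hh : ∀ i : Fin 2, (X i ^ (r + 1) : PA k).IsHomogeneous (r + 1) := fun i =>
    isHomogeneous_X_pow i _
  refine ⟨evV _ 0 x ⊗ₜ insV _ 0 (Sy.mk _ (hh 0)) + evV _ 1 x ⊗ₜ insV _ 1 (Sy.mk _ (hh 1)), ?_⟩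
  apply Sy.ext
  simp only [map_add, insV_apply, Sy.val_add, mT_val, psiM, LinearMap.comp_apply,
    LinearMap.add_apply, powX_val, Sy.val_mk]
  simp
  ring

theorem dims (r : ℕ) : Module.finrank k (Sy k (r + 1) ⊗[k] (Sy k (r + 1) ⊗[k] V2 k)) =
    2 * Module.finrank k (Sy k (r + 1) ⊗[k] Sy k r) +
      Module.finrank k (Sy k (r + 1 + (r + 1 + 1))) := by
  simp only [Module.finrank_tensorProduct, finrank_Sy]
  simp
  ring

end Psi

section StepS
open MvPolynomial TensorProduct
variable {k : Type} [Field k] (φ : SL k →* SL k)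

abbrev pb {W : Type} [AddCommGroup W] [Module k W] (ρ : Representation k (SL k) W) :
    Representation k (SL k) W := MonoidHom.comp ρ φ

noncomputable def yc (j : ℕ) : Skeleton (FDRep k (SL k)) := cls (pb φ (symRep k j))
noncomputable def vc : Skeleton (FDRep k (SL k)) := cls (pb φ (SLnatRep k 2))

theorem yc_zero : yc φ 0 = 1 := by
  rw [← cls_trivial]
  exact (cls_eq _ _ sy0 (fun g => sy0_eq (φ g))).symm

theorem yc_mul (j : ℕ) : yc φ j * vc φ =
    cls ((pb φ (symRep k j)).tprod (pb φ (SLnatRep k 2))) := (cls_tprod _ _).symm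

theorem yc_succ (j : ℕ) (hj : (j : k) + 1 ≠ 0) {A} (hA : yc φ j * vc φ ∈ A) :
    yc φ (j + 1) ∈ (catCl _).cl A := by
  rw [yc_mul] at hA
  refine cls_mem1 hA (deM k j) (((j : k) + 1)⁻¹ • muM k j) (fun g => deM_eq j (φ g)) (fun g => ?_) ?_
  · rw [LinearMap.smul_comp, LinearMap.comp_smul]
    exact congrArg _ (muM_eq j (φ g))
  · rw [LinearMap.smul_comp, muM_deM, smul_smul, inv_mul_cancel₀ hj, one_smul]

theorem yc_mul_zero {A} (hA : yc φ 1 ∈ A) : yc φ 0 * vc φ ∈ (catCl _).cl A := by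
  rw [yc_mul]
  exact cls_mem1 hA (muM k 0) (deM k 0) (fun g => muM_eq 0 (φ g)) (fun g => deM_eq 0 (φ g)) deM_muM0

theorem yc_mul_succ (j : ℕ) (hj : (j : k) + 2 ≠ 0) {A} (hA : yc φ (j + 2) ∈ A) (hA' : yc φ j ∈ A) :
    yc φ (j + 1) * vc φ ∈ (catCl _).cl A := by
  rw [yc_mul]
  refine cls_mem2 hA hA' (muM k (j + 1)) (((j : k) + 2)⁻¹ • deM k (j + 1)) (beM k j)
    (-((j : k) + 2)⁻¹ • alM k j)
    (fun g => muM_eq _ (φ g)) (fun g => ?_) (fun g => beM_eq _ (φ g)) (fun g => ?_) ?_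
  · rw [LinearMap.smul_comp, LinearMap.comp_smul]
    exact congrArg _ (deM_eq _ (φ g))
  · rw [LinearMap.smul_comp, LinearMap.comp_smul]
    exact congrArg _ (alM_eq _ (φ g))
  · have := deM_muM (k := k) j
    apply LinearMap.ext; intro x
    have h2 := LinearMap.congr_fun this x
    simp only [LinearMap.sub_apply, LinearMap.comp_apply, LinearMap.smul_apply,
      LinearMap.id_apply] at h2
    simp only [LinearMap.add_apply, LinearMap.comp_apply, LinearMap.smul_apply, LinearMap.id_apply]
    have h3 : x = ((j : k) + 2)⁻¹ • ((j : k) + 2) • x := by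
      rw [smul_smul, inv_mul_cancel₀ hj, one_smul]
    conv_rhs => rw [h3, ← h2]
    module

variable (r : ℕ) [Fact (r + 1 + 2).Prime] [CharP k (r + 1 + 2)]

theorem cast_ne_of_lt {j : ℕ} (h0 : 0 < j) (hj : j < r + 1 + 2) : (j : k) ≠ 0 := by
  rw [Ne, CharP.cast_eq_zero_iff k (r + 1 + 2)]
  exact fun h => absurd (Nat.le_of_dvd h0 h) (by omega)

theorem yc_mem (j : ℕ) (hj : j < r + 1 + 2) : yc φ j ∈ (catCl _).cl {vc φ ^ j} := by
  induction j with
  | zero => exact (catCl _).sub _ _ (by simp [yc_zero])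
  | succ j ih =>
    have := cast_ne_of_lt (k := k) r (j := j + 1) (by omega) hj
    push_cast at this
    refine (catCl _).bind (yc_succ φ j this (Set.mem_singleton _)) ?_
    rintro _ rfl
    refine (catCl _).bindmul' _ _ rfl (ih (by omega)) ?_
    rintro _ rfl
    exact (catCl _).sub _ _ (by simp [pow_succ])

theorem vc_mem (j : ℕ) (hj : j < r + 1 + 2) :
    vc φ ^ j ∈ (catCl _).cl ({yc φ j} ∪ {x | ∃ i < j, x = vc φ ^ i}) := by
  induction j with
  | zero => exact (catCl _).sub _ _ (by simp [yc_zero])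
  | succ j ih =>
    refine (catCl _).bindmul' (vc φ) _ (pow_succ _ _) (ih (by omega)) ?_
    rintro x (hx | ⟨i, hi, rfl⟩)
    · rw [Set.mem_singleton_iff.1 hx]
      cases j with
      | zero => exact yc_mul_zero φ (Or.inl rfl)
      | succ j =>
        have := cast_ne_of_lt (k := k) r (j := j + 2) (by omega) hj
        push_cast at this
        refine (catCl _).bind (yc_mul_succ φ j this (A := {yc φ (j + 2), yc φ j}) (by simp)
          (by simp)) ?_
        rintro x (hx | hx)
        · rw [hx]; exact (catCl _).sub _ _ (Or.inl rfl)
        · rw [Set.mem_singleton_iff.1 hx]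
          refine (catCl _).bind (yc_mem φ r j (by omega)) ?_
          rintro _ rfl
          exact (catCl _).sub _ _ (Or.inr ⟨j, by omega, rfl⟩)
    · exact (catCl _).sub _ _ (Or.inr ⟨i + 1, by omega, by rw [pow_succ]⟩)

noncomputable def repX : Representation k (SL k)
    (Sy k (r + 1 + 1) ⊗[k] (Sy k (r + 1 + 1) ⊗[k] V2 k)) :=
  (pb φ (symRep k (r + 1 + 1))).tprod ((pb φ (symRep k (r + 1 + 1))).tprod
    (pb φ (SLnatRep k 2)))

noncomputable def repU : Representation k (SL k) (Sy k (r + 1 + 1) ⊗[k] Sy k (r + 1)) :=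
  (pb φ (symRep k (r + 1 + 1))).tprod (pb φ (symRep k (r + 1)))

theorem big_eq : yc φ (r + 1 + 1 + (r + 1 + 1 + 1)) =
    yc φ (r + 1 + 1) * vc ((frobSL k (r + 1 + 2)).comp φ) := by
  refine Eq.trans ?_ (cls_tprod _ _)
  refine (cls_eq _ _ (LinearEquiv.ofBijective _ (psiM_bij (k := k) (r + 1 + 1) _ (r + 1 + 2) rfl rfl))
    (fun g => ?_)).symm
  exact psiM_eq (k := k) (r + 1 + 1) _ (r + 1 + 2) rfl (φ g)

theorem lT_eq {W A B : Type} [AddCommGroup W] [Module k W] [AddCommGroup A] [Module k A]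
    [AddCommGroup B] [Module k B] (f : A →ₗ[k] B) (w : W →ₗ[k] W) (a : A →ₗ[k] A)
    (b : B →ₗ[k] B) (h : f ∘ₗ a = b ∘ₗ f) :
    LinearMap.lTensor W f ∘ₗ TensorProduct.map w a = TensorProduct.map w b ∘ₗ LinearMap.lTensor W f := by
  rw [LinearMap.lTensor, ← TensorProduct.map_comp, ← TensorProduct.map_comp, h]
  simp

theorem mT_eq (r : ℕ) (g : SL k) : mT k r ∘ₗ
    TensorProduct.map (symRep k (r + 1) g) (TensorProduct.map (symRep k (r + 1) g) (SLnatRep k 2 g))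
      = symRep k _ g ∘ₗ mT k r := by
  have h := lT_eq (muM k (r + 1)) (symRep k (r + 1) g) (TensorProduct.map (symRep k (r + 1) g)
    (SLnatRep k 2 g)) (symRep k (r + 1 + 1) g) (muM_eq (r + 1) g)
  rw [mT, LinearMap.comp_assoc, h, ← LinearMap.comp_assoc,
    ← LinearMap.comp_assoc]
  congr 1
  apply TensorProduct.ext'
  intro f h
  apply Sy.ext
  simp [symRep_coe, mulS_val]

theorem split_main : (yc φ (r + 1 + 1 + (r + 1 + 1 + 1)) ∈
      (catCl _).cl {yc φ (r + 1 + 1) * (yc φ (r + 1 + 1) * vc φ)}) ∧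
    (yc φ (r + 1 + 1) * (yc φ (r + 1 + 1) * vc φ) ∈
      (catCl _).cl {yc φ (r + 1 + 1 + (r + 1 + 1 + 1)), yc φ (r + 1 + 1) * yc φ (r + 1)}) := by
  have hX : yc φ (r + 1 + 1) * (yc φ (r + 1 + 1) * vc φ) = cls (repX φ r) := by
    rw [yc_mul, yc, ← cls_tprod]; rfl
  have hU : yc φ (r + 1 + 1) * yc φ (r + 1) = cls (repU φ r) := (cls_tprod _ _).symm
  obtain ⟨t, s, h1, h2, h3⟩ := la_split (aT k (r + 1)) (bT k (r + 1)) (tT k (r + 1)) (mT k (r + 1))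
    (tT_tT _) (mT_surj _) (mT_aT _) (mT_tT _) (bT_aT r) (theta_inj (r + 1)) (dims _)
  have ea : ∀ g, aT k (r + 1) ∘ₗ repU φ r g = repX φ r g ∘ₗ aT k (r + 1) := fun g =>
    lT_eq _ _ _ _ (alM_eq _ (φ g))
  have eb : ∀ g, bT k (r + 1) ∘ₗ repX φ r g = repU φ r g ∘ₗ bT k (r + 1) := fun g =>
    lT_eq _ _ _ _ (beM_eq _ (φ g))
  have et : ∀ g, tT k (r + 1) ∘ₗ repX φ r g = repX φ r g ∘ₗ tT k (r + 1) := fun g => by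
    apply tri_ind
    intro f h v
    simp [tT, repX]
  have em : ∀ g, mT k (r + 1) ∘ₗ repX φ r g = (pb φ (symRep k _)) g ∘ₗ mT k (r + 1) := fun g =>
    mT_eq _ (φ g)
  have ett : ∀ g, t ∘ₗ repU φ r g = repU φ r g ∘ₗ t := fun g =>
    (h3 _ _ _ (ea g) (eb g) (et g) (em g)).1
  have es : ∀ g, s ∘ₗ (pb φ (symRep k _)) g = repX φ r g ∘ₗ s := fun g =>
    (h3 _ _ _ (ea g) (eb g) (et g) (em g)).2
  constructor
  · rw [hX]
    exact cls_mem1 (Set.mem_singleton _) s (mT k (r + 1)) es em h2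
  · rw [hX, hU]
    refine cls_mem3 (σ₁ := pb φ (symRep k _)) (σ₂ := repU φ r) (σ₃ := repU φ r)
      (Or.inl rfl) (Or.inr rfl) (Or.inr rfl) (mT k (r + 1)) s _ (aT k (r + 1)) (bT k (r + 1)) _
      em es ?_ ea eb ?_ h1
    · intro g
      apply LinearMap.ext; intro z
      have a1 := LinearMap.congr_fun (et g) z
      have a2 := LinearMap.congr_fun (eb g) (tT k (r + 1) z)
      have a3 := LinearMap.congr_fun (ett g) (bT k (r + 1) (tT k (r + 1) z))
      simp only [LinearMap.comp_apply] at a1 a2 a3 ⊢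
      rw [a1, a2, a3]
    · intro g
      apply LinearMap.ext; intro z
      have a1 := LinearMap.congr_fun (ett g) z
      have a2 := LinearMap.congr_fun (ea g) (t z)
      have a3 := LinearMap.congr_fun (et g) (aT k (r + 1) (t z))
      simp only [LinearMap.comp_apply] at a1 a2 a3 ⊢
      rw [a1, a2, a3]

theorem step_main : (catCl (FDRep k (SL k))).Step (r + 1 + 2) (yc φ (r + 1 + 1)) (vc φ)
    (vc ((frobSL k (r + 1 + 2)).comp φ)) := by
  obtain ⟨m1, m2⟩ := split_main φ r
  rw [big_eq] at m1 m2
  refine ⟨vc_mem φ r (r + 1 + 1) (by omega), yc_mem φ r (r + 1 + 1) (by omega), ?_, ?_⟩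
  · refine (catCl _).bind m1 ?_
    rintro _ rfl
    refine (catCl _).bindmul' (yc φ (r + 1 + 1) * vc φ) _ rfl (yc_mem φ r (r + 1 + 1) (by omega)) ?_
    rintro _ rfl
    refine (catCl _).sub _ _ ?_
    rw [Set.mem_singleton_iff, pow_succ]
    show vc φ ^ (r + 1 + 1) * _ = _
    exact mul_left_comm _ _ _
  · refine (catCl _).bindmul' (yc φ (r + 1 + 1) * vc φ) _ ?_ (vc_mem φ r (r + 1 + 1) (by omega)) ?_
    · rw [pow_succ]
      show _ * (vc φ ^ (r + 1 + 1) * _) = _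
      exact mul_left_comm _ _ _
    rintro x (hx | ⟨i, hi, rfl⟩)
    · rw [Set.mem_singleton_iff.1 hx]
      refine (catCl _).bind m2 ?_
      rintro x (hx | hx)
      · rw [hx]; exact (catCl _).sub _ _ (Or.inl rfl)
      · rw [Set.mem_singleton_iff.1 hx]
        refine (catCl _).bindmul' (yc φ (r + 1 + 1)) _ (mul_comm _ _) (yc_mem φ r (r + 1) (by omega)) ?_
        rintro _ rfl
        exact (catCl _).sub _ _ (Or.inr ⟨r + 1, by omega, mul_comm _ _⟩)
    · refine (catCl _).sub _ _ (Or.inr ⟨i + 1, by omega, ?_⟩)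
      rw [pow_succ]; exact mul_left_comm _ _ _
end StepS

section Final

theorem toSkeleton_tensorPow {k G : Type} [Field k] [Monoid G] (M : FDRep k G) (m : ℕ) :
    toSkeleton (tensorPow M m) = (toSkeleton M) ^ (m + 1) := by
  induction m with
  | zero => simp [tensorPow]
  | succ m ih => rw [tensorPow, Skeleton.toSkeleton_tensorObj, ih, pow_succ _ (m + 1)]

theorem algebraic_of_pow {k G : Type} [Field k] [Monoid G] [Finite k] [Finite G] (M : FDRep k G)
    (B : ℕ) (h : ∀ m, (toSkeleton M) ^ m ∈ (catCl (FDRep k G)).cl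
      {x | ∃ i < B, x = (toSkeleton M) ^ i}) : IsAlgebraic M := by
  choose L hL using fun i : ℕ =>
    list_of_summand ((fromSkeleton (FDRep k G)).obj ((toSkeleton M) ^ i))
  refine ⟨(List.range B).flatMap L, ?_⟩
  rintro N hN ⟨m, f, g, hfg⟩
  have h1 := h (m + 1)
  rw [← toSkeleton_tensorPow, mem_catCl] at h1
  obtain ⟨Y, ⟨i, hi, hY⟩, a, b, hab⟩ := summand_of_mem hN (addMor_retract f g hfg h1)
  have e : Y ≅ (fromSkeleton (FDRep k G)).obj ((toSkeleton M) ^ i) := by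
    rw [← hY]; exact (fromSkeletonToSkeletonIso Y).symm
  obtain ⟨N', hN', hiso⟩ := hL i N ⟨a ≫ e.hom, e.inv ≫ b, by simp [hab]⟩
  exact ⟨N', List.mem_flatMap.2 ⟨i, List.mem_range.2 hi, hN'⟩, hiso⟩

noncomputable def phiF (k : Type) [Field k] (p : ℕ) [Fact p.Prime] [CharP k p] : ℕ → (SL k →* SL k)
  | 0 => MonoidHom.id _
  | j + 1 => (frobSL k p).comp (phiF k p j)

theorem phiF_apply (k : Type) [Field k] (p : ℕ) [Fact p.Prime] [CharP k p] (j : ℕ) (g : SL k)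
    (a b : Fin 2) : (phiF k p j g).1 a b = (g.1 a b) ^ p ^ j := by
  induction j with
  | zero => simp [phiF]
  | succ j ih =>
    rw [phiF, MonoidHom.comp_apply, frobSL_apply, ih, ← pow_mul, pow_succ]

theorem pack_phi (k : Type) [Field k] (r : ℕ) [Fact (r + 1 + 2).Prime] [CharP k (r + 1 + 2)]
    (j : ℕ) : ∃ s, (catCl (FDRep k (SL k))).Pack ((r + 1 + 2) ^ j) s (vc (MonoidHom.id _))
      (vc (phiF k (r + 1 + 2) j)) := by
  induction j with
  | zero => exact ⟨1, by simpa [phiF] using ClOp.Pack.one _ _⟩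
  | succ j ih =>
    obtain ⟨s, hs⟩ := ih
    refine ⟨s * yc (phiF k (r + 1 + 2) j) (r + 1 + 1), ?_⟩
    rw [pow_succ]
    exact ClOp.Pack.succ (by omega) (Nat.one_le_pow _ _ (by omega)) hs
      (step_main (phiF k (r + 1 + 2) j) r)

end Final

/-- For `p` an odd prime, `q = p^n` and `k = F_q`, the natural `2`-dimensional
module `k^2` for `SL_2(q)` is algebraic. -/
theorem natural_module_SL2_algebraic (p n : ℕ) [Fact p.Prime] (hp : Odd p) (hn : 1 ≤ n) :
    IsAlgebraic (FDRep.of (SLnatRep (GaloisField p n) 2)) := by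
  have h2 := (Fact.out : p.Prime).two_le
  obtain ⟨r, rfl⟩ : ∃ r, p = r + 1 + 2 := by
    obtain ⟨c, hc⟩ := hp
    exact ⟨p - 3, by omega⟩
  have hn0 : n ≠ 0 := by omega
  haveI : Fintype (GaloisField (r + 1 + 2) n) := Fintype.ofFinite _
  haveI : Finite (SL (GaloisField (r + 1 + 2) n)) := by
    unfold SL; exact Subtype.finite
  obtain ⟨s, hs⟩ := pack_phi (GaloisField (r + 1 + 2) n) r n
  have hid : phiF (GaloisField (r + 1 + 2) n) (r + 1 + 2) n = MonoidHom.id _ := by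
    refine MonoidHom.ext fun g => Subtype.ext (Matrix.ext fun a b => ?_)
    rw [phiF_apply, ← GaloisField.card (r + 1 + 2) n hn0, Nat.card_eq_fintype_card,
      FiniteField.pow_card]
    rfl
  rw [hid] at hs
  refine algebraic_of_pow _ (2 * (r + 1 + 2) ^ n - 1) fun m => ?_
  exact ClOp.Pack.final (h2.trans (Nat.le_self_pow hn0 _)) hs m
end

section
/- Let p be a prime, k a finite field of characteristic p, and G a finite group. Then every 2-dimensional kG-module is algebraic. -/
open CategoryTheory CategoryTheory.MonoidalCategory

namespace TwoDim
open Equiv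

def phi {N : ℕ} (σ : Perm (Fin N)) : ℤ := ∑ l : Fin N, ((l : ℕ) : ℤ) * ((σ l : ℕ) : ℤ)

lemma phi_swap {N : ℕ} (σ : Perm (Fin N)) (a b : Fin N) (hab : a < b) (h : σ b < σ a) :
    phi σ < phi (σ * swap a b) := by
  have h1 : phi (σ * swap a b) - phi σ =
      ∑ l : Fin N, ((l : ℕ) : ℤ) * (((σ (swap a b l) : ℕ) : ℤ) - ((σ l : ℕ) : ℤ)) := by
    simp [phi, mul_sub]
  have h2 : ∑ l : Fin N, ((l : ℕ) : ℤ) * (((σ (swap a b l) : ℕ) : ℤ) - ((σ l : ℕ) : ℤ)) =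
      ((a : ℕ) : ℤ) * (((σ b : ℕ) : ℤ) - ((σ a : ℕ) : ℤ)) +
      ((b : ℕ) : ℤ) * (((σ a : ℕ) : ℤ) - ((σ b : ℕ) : ℤ)) := by
    rw [Finset.sum_eq_add a b hab.ne]
    · simp
    · rintro c - ⟨hc1, hc2⟩
      rw [swap_apply_of_ne_of_ne hc1 hc2]; simp
    · simp
    · simp
  have h3 : (((a : ℕ) : ℤ)) < ((b : ℕ) : ℤ) := by exact_mod_cast hab
  have h4 : (((σ b : ℕ) : ℤ)) < ((σ a : ℕ) : ℤ) := by exact_mod_cast h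
  nlinarith

lemma phi_bound (N : ℕ) : ∃ B : ℤ, ∀ σ : Perm (Fin N), phi σ ≤ B := by
  obtain ⟨B, hB⟩ := (Set.finite_range (phi (N := N))).bddAbove
  exact ⟨B, fun σ => hB ⟨σ, rfl⟩⟩

lemma phi_bound' (N : ℕ) : ∃ B : ℤ, ∀ σ : Perm (Fin N), B ≤ phi σ := by
  obtain ⟨B, hB⟩ := (Set.finite_range (phi (N := N))).bddBelow
  exact ⟨B, fun σ => hB ⟨σ, rfl⟩⟩

lemma phi_up {N : ℕ} (P : Perm (Fin N) → Prop)
    (h : ∀ σ, (∀ τ, phi σ < phi τ → P τ) → P σ) (σ : Perm (Fin N)) : P σ := by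
  obtain ⟨B, hB⟩ := phi_bound N
  have : ∀ n : ℕ, ∀ σ, (B - phi σ).toNat = n → P σ := by
    intro n
    induction n using Nat.strong_induction_on with
    | _ n ih =>
      intro σ hσ
      refine h σ fun τ hτ => ih _ ?_ τ rfl
      have := hB τ
      omega
  exact this _ σ rfl

lemma phi_down {N : ℕ} (P : Perm (Fin N) → Prop)
    (h : ∀ σ, (∀ τ, phi τ < phi σ → P τ) → P σ) (σ : Perm (Fin N)) : P σ := by
  obtain ⟨B, hB⟩ := phi_bound' N
  have : ∀ n : ℕ, ∀ σ, (phi σ - B).toNat = n → P σ := by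
    intro n
    induction n using Nat.strong_induction_on with
    | _ n ih =>
      intro σ hσ
      refine h σ fun τ hτ => ih _ ?_ τ rfl
      have := hB τ
      omega
  exact this _ σ rfl

def Avoid {N : ℕ} (σ : Perm (Fin N)) : Prop :=
  ¬ ∃ a b c : Fin N, a < b ∧ b < c ∧ σ b < σ a ∧ σ c < σ b

/-- matrix of a formal combination of permutations on words -/
def comb {N : ℕ} {K : Type*} [AddCommMonoid K] (c : Perm (Fin N) → K) (i j : Fin N → Fin 2) : K :=
  ∑ σ : Perm (Fin N), if i = j ∘ σ then c σ else 0

lemma comp_swap_eq {N : ℕ} (w : Fin N → Fin 2) (a b : Fin N) (h : w a = w b) :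
    w ∘ (swap a b) = w := by
  funext l
  simp only [Function.comp, swap_apply_def]
  split_ifs <;> simp_all

lemma six {N : ℕ} {K : Type*} [Ring K] (i w : Fin N → Fin 2) (a b c : Fin N)
    (hab : a ≠ b) (hbc : b ≠ c) (hac : a ≠ c) :
    (if i = w then (1 : K) else 0) =
      (if i = w ∘ (swap a b) then 1 else 0) + (if i = w ∘ (swap b c) then 1 else 0)
      + (if i = w ∘ (swap a c) then 1 else 0) - (if i = w ∘ (swap a b * swap b c : Perm (Fin N)) then 1 else 0)
      - (if i = w ∘ (swap b c * swap a b : Perm (Fin N)) then 1 else 0) := by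
  have e1 : (w ∘ (swap a b * swap b c : Perm (Fin N))) = (w ∘ swap a b) ∘ swap b c := rfl
  have e2 : (w ∘ (swap b c * swap a b : Perm (Fin N))) = (w ∘ swap b c) ∘ swap a b := rfl
  have e3 : (swap b c * swap a b : Perm (Fin N)) = swap a b * swap a c := by
    ext l; simp only [Perm.mul_apply, swap_apply_def]; split_ifs <;> simp_all
  have e4 : (swap a b * swap b c : Perm (Fin N)) = swap a c * swap a b := by
    ext l; simp only [Perm.mul_apply, swap_apply_def]; split_ifs <;> simp_all
  have e5 : (swap a b * swap b c : Perm (Fin N)) = swap b c * swap a c := by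
    ext l; simp only [Perm.mul_apply, swap_apply_def]; split_ifs <;> simp_all
  have e6 : (swap b c * swap a b : Perm (Fin N)) = swap a c * swap b c := by
    ext l; simp only [Perm.mul_apply, swap_apply_def]; split_ifs <;> simp_all
  by_cases h1 : w a = w b
  · have e7 : (w ∘ (swap b c * swap a b : Perm (Fin N))) = (w ∘ swap a b) ∘ swap a c := by
      rw [e3]; rfl
    rw [e1, e7, comp_swap_eq w a b h1]; abel
  · by_cases h2 : w b = w c
    · have e7 : (w ∘ (swap a b * swap b c : Perm (Fin N))) = (w ∘ swap b c) ∘ swap a c := by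
        rw [e5]; rfl
      rw [e2, e7, comp_swap_eq w b c h2]; abel
    · have h3 : w a = w c := by omega
      have e7 : (w ∘ (swap a b * swap b c : Perm (Fin N))) = (w ∘ swap a c) ∘ swap a b := by
        rw [e4]; rfl
      have e8 : (w ∘ (swap b c * swap a b : Perm (Fin N))) = (w ∘ swap a c) ∘ swap b c := by
        rw [e6]; rfl
      rw [e7, e8, comp_swap_eq w a c h3]; abel

lemma comb_add {N : ℕ} {K : Type*} [Ring K] (c d : Perm (Fin N) → K) (i j : Fin N → Fin 2) :
    comb (c + d) i j = comb c i j + comb d i j := by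
  simp only [comb, ← Finset.sum_add_distrib]
  refine Finset.sum_congr rfl fun σ _ => ?_
  split_ifs <;> simp

lemma comb_sub {N : ℕ} {K : Type*} [Ring K] (c d : Perm (Fin N) → K) (i j : Fin N → Fin 2) :
    comb (c - d) i j = comb c i j - comb d i j := by
  simp only [comb, ← Finset.sum_sub_distrib]
  refine Finset.sum_congr rfl fun σ _ => ?_
  split_ifs <;> simp

lemma straighten {N : ℕ} {K : Type*} [Ring K] (σ : Perm (Fin N)) :
    ∃ c : Perm (Fin N) → K, (∀ τ, ¬ Avoid τ → c τ = 0) ∧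
      ∀ i j, comb c i j = if i = j ∘ σ then 1 else 0 := by
  induction σ using phi_up with
  | h σ ih =>
    by_cases hσ : Avoid σ
    · classical
      refine ⟨Pi.single σ 1, fun τ hτ => ?_, fun i j => ?_⟩
      · rw [Pi.single_eq_of_ne]; rintro rfl; exact hτ hσ
      · rw [comb, Finset.sum_eq_single σ]
        · simp
        · intro τ _ hτ; simp [hτ]
        · simp
    · simp only [Avoid, not_not] at hσ
      obtain ⟨a, b, c, hab, hbc, h1, h2⟩ := hσ
      have hac := hab.trans hbc
      have p1 := phi_swap σ a b hab h1
      have p2 := phi_swap σ b c hbc h2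
      have p3 := phi_swap σ a c hac (h2.trans h1)
      have p4 := phi_swap (σ * swap a b) b c hbc (by
        simpa [swap_apply_of_ne_of_ne hac.ne' hbc.ne'] using h2.trans h1)
      have p5 := phi_swap (σ * swap b c) a b hab (by
        simpa [swap_apply_of_ne_of_ne hab.ne hac.ne] using h2.trans h1)
      obtain ⟨c1, s1, f1⟩ := ih _ p1
      obtain ⟨c2, s2, f2⟩ := ih _ p2
      obtain ⟨c3, s3, f3⟩ := ih _ p3
      obtain ⟨c4, s4, f4⟩ := ih _ (p1.trans p4)
      obtain ⟨c5, s5, f5⟩ := ih _ (p2.trans p5)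
      refine ⟨c1 + c2 + c3 - c4 - c5, fun τ hτ => ?_, fun i j => ?_⟩
      · simp [s1 τ hτ, s2 τ hτ, s3 τ hτ, s4 τ hτ, s5 τ hτ]
      · rw [comb_sub, comb_sub, comb_add, comb_add, f1, f2, f3, f4, f5,
          six i (j ∘ σ) a b c hab.ne hbc.ne hac.ne]
        rfl

lemma perm_eq_one {N : ℕ} (τ : Perm (Fin N)) (i : Fin N → Fin 2) (hi : i ∘ τ = i)
    (hm : ∀ a b, i a = i b → a < b → τ a < τ b) : τ = 1 := by
  by_contra hne
  have hex : ∃ n : ℕ, ∃ h : n < N, τ ⟨n, h⟩ ≠ ⟨n, h⟩ := by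
    by_contra hcon
    push Not at hcon
    exact hne (Equiv.ext fun l => hcon l l.2)
  classical
  obtain ⟨hn, hl⟩ := Nat.find_spec hex
  have hmin : ∀ m : Fin N, (m : ℕ) < Nat.find hex → τ m = m := by
    intro m hm
    have := Nat.find_min hex hm
    push Not at this
    exact this m.2
  generalize Nat.find hex = n at *
  set l : Fin N := ⟨n, hn⟩ with hldef
  have h1 : l < τ l := by
    rcases lt_trichotomy (τ l) l with h | h | h
    · exact absurd (τ.injective (hmin (τ l) h)) hl
    · exact absurd h hl
    · exact h
  have h2 : τ (τ.symm l) = l := by simp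
  have h3 : l < τ.symm l := by
    rcases lt_trichotomy (τ.symm l) l with h | h | h
    · have := hmin _ h
      rw [h2] at this
      exact absurd this.symm h.ne
    · rw [h] at h2; exact absurd h2 hl
    · exact h
  have h4 : i (τ.symm l) = i l := by
    have := congrFun hi (τ.symm l)
    simpa using this.symm
  have := hm l (τ.symm l) h4.symm h3
  rw [h2] at this
  exact absurd this h1.le.not_gt

lemma phi_max {N : ℕ} (σ₀ : Perm (Fin N)) (i j : Fin N → Fin 2) (hi : i = j ∘ σ₀)
    (hm : ∀ a b, i a = i b → a < b → σ₀ a < σ₀ b) (σ : Perm (Fin N)) :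
    i = j ∘ σ → σ ≠ σ₀ → phi σ < phi σ₀ := by
  induction σ using phi_up with
  | h σ ih =>
    intro hσ hne
    by_cases hd : ∃ a b, i a = i b ∧ a < b ∧ σ b < σ a
    · obtain ⟨a, b, h1, h2, h3⟩ := hd
      have := phi_swap σ a b h2 h3
      by_cases he : σ * swap a b = σ₀
      · rwa [he] at this
      · refine this.trans (ih _ this ?_ he)
        have : (j ∘ (σ * swap a b : Perm (Fin N))) = (j ∘ σ) ∘ swap a b := rfl
        rw [this, ← hσ, comp_swap_eq _ _ _ h1]
    · push Not at hd
      exfalso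
      apply hne
      have : σ₀⁻¹ * σ = 1 := by
        apply perm_eq_one _ i
        · conv_lhs => rw [hi]
          rw [hσ]
          funext l; simp
        · intro a b hab hlt
          have h1 : i ((σ₀⁻¹ * σ) a) = i a := by
            conv_lhs => rw [hi]
            rw [hσ]; simp
          have h2 : i ((σ₀⁻¹ * σ) b) = i b := by
            conv_lhs => rw [hi]
            rw [hσ]; simp
          by_contra hle
          rcases (not_lt.1 hle).lt_or_eq with h | h
          · have := hm _ _ (by rw [h1, h2, hab]) h
            simp at this
            exact absurd (hd a b hab hlt) this.not_ge
          · exact hlt.ne' ((σ₀⁻¹ * σ).injective h)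
      exact (inv_mul_eq_one.1 this).symm

lemma avoid_col {N : ℕ} (σ : Perm (Fin N)) (h : Avoid σ) : ∃ i : Fin N → Fin 2,
    ∀ a b, i a = i b → a < b → σ a < σ b := by
  classical
  refine ⟨fun l => if ∃ a < l, σ l < σ a then 1 else 0, fun a b hab hlt => ?_⟩
  by_contra hcon
  have hlt' : σ b < σ a := lt_of_le_of_ne (not_lt.1 hcon) fun e => hlt.ne' (σ.injective e)
  have hb : ∃ c < b, σ b < σ c := ⟨a, hlt, hlt'⟩
  simp only [hb, if_true] at hab
  split_ifs at hab with h1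
  · obtain ⟨c, hc, hc'⟩ := h1
    exact h ⟨c, a, b, hc, hlt, hc', hlt'⟩
  · simp at hab

lemma integral_of {N : ℕ} {K : Type*} [Ring K] (R : Subring K) (c : Perm (Fin N) → K)
    (hc : ∀ τ, ¬ Avoid τ → c τ = 0) (hf : ∀ i j, comb c i j ∈ R) (σ : Perm (Fin N)) :
    c σ ∈ R := by
  classical
  induction σ using phi_down with
  | h σ ih =>
    by_cases hσ : Avoid σ
    · obtain ⟨i, hi⟩ := avoid_col σ hσ
      have hij : i = (i ∘ σ.symm) ∘ σ := by funext l; simp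
      have h1 := hf i (i ∘ σ.symm)
      rw [comb, ← Finset.add_sum_erase _ _ (Finset.mem_univ σ), if_pos hij] at h1
      refine (add_mem_cancel_right (H := R) ?_).1 h1
      refine Subring.sum_mem _ fun τ hτ => ?_
      split_ifs with h
      · exact ih τ (phi_max σ i _ hij hi τ h (Finset.ne_of_mem_erase hτ))
      · exact R.zero_mem
    · rw [hc σ hσ]; exact R.zero_mem

def wt {N : ℕ} (i : Fin N → Fin 2) : ℕ := Fintype.card {l // i l = 1}

lemma wt_le {N : ℕ} (i : Fin N → Fin 2) : wt i ≤ N := by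
  unfold wt
  simpa using Fintype.card_subtype_le (fun l : Fin N => i l = 1)

lemma card_zero {N : ℕ} (i : Fin N → Fin 2) : Fintype.card {l // i l = 0} = N - wt i := by
  unfold wt
  have := Fintype.card_subtype_compl (fun l : Fin N => i l = 1)
  rw [Fintype.card_fin] at this
  rw [← this]
  refine Fintype.card_congr (Equiv.subtypeEquivRight fun l => ?_)
  omega

lemma wt_comp {N : ℕ} (j : Fin N → Fin 2) (σ : Perm (Fin N)) : wt (j ∘ σ) = wt j := by
  unfold wt
  exact Fintype.card_congr (σ.subtypeEquiv fun l => by simp)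

lemma exists_perm {N : ℕ} (i j : Fin N → Fin 2) (h : wt i = wt j) : ∃ σ : Perm (Fin N), i = j ∘ σ := by
  classical
  have e : {l // i l = 1} ≃ {l // j l = 1} := Fintype.equivOfCardEq h
  refine ⟨e.extendSubtype, funext fun l => ?_⟩
  by_cases hl : i l = 1
  · have := e.extendSubtype_mem l hl
    simp [hl, this]
  · have := e.extendSubtype_not_mem l hl
    simp only [Function.comp]
    omega

lemma comb_const {N : ℕ} {K : Type*} [Field K] [CharZero K] (i j : Fin N → Fin 2) :
    comb (fun _ => ((N.factorial : K))⁻¹) i j =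
      if wt i = wt j then ((N.choose (wt i) : K))⁻¹ else 0 := by
  split_ifs with h
  · obtain ⟨σ₀, h0⟩ := exists_perm i j h
    have h1 : Fintype.card {σ : Perm (Fin N) // i = j ∘ σ} =
        (N - wt i).factorial * (wt i).factorial := by
      have h2 := DomMulAct.stabilizer_card i
      rw [Fin.prod_univ_two, card_zero] at h2
      rw [show wt i = Fintype.card {l // i l = 1} from rfl] at h2 ⊢
      rw [← h2]
      refine Fintype.card_congr ((Equiv.mulLeft σ₀⁻¹).subtypeEquiv fun σ => ?_)
      rw [h0]
      simp [Equiv.coe_mulLeft, funext_iff, eq_comm]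
    rw [comb, ← Finset.sum_filter, Finset.sum_const, ← Fintype.card_subtype, h1, nsmul_eq_mul]
    have h3 := Nat.choose_mul_factorial_mul_factorial (wt_le i)
    have h4 : (N.factorial : K) ≠ 0 := by exact_mod_cast N.factorial_ne_zero
    rw [← h3] at h4 ⊢
    push_cast at h4 ⊢
    have h5 := left_ne_zero_of_mul (left_ne_zero_of_mul h4)
    have h6 := right_ne_zero_of_mul (left_ne_zero_of_mul h4)
    have h7 := right_ne_zero_of_mul h4
    field_simp
  · rw [comb]
    refine Finset.sum_eq_zero fun σ _ => if_neg ?_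
    rintro rfl
    exact h (wt_comp j σ)

lemma comb_map {N : ℕ} {K L : Type*} [Ring K] [Ring L] (f : K →+* L) (c : Perm (Fin N) → K)
    (i j : Fin N → Fin 2) : f (comb c i j) = comb (fun σ => f (c σ)) i j := by
  simp only [comb]
  rw [map_sum]
  refine Finset.sum_congr rfl fun σ _ => ?_
  split_ifs <;> simp

lemma exists_coeff (p N : ℕ) [Fact p.Prime] (hN : ∀ w ≤ N, ¬ p ∣ N.choose w)
    (k : Type*) [Field k] [CharP k p] : ∃ c : Perm (Fin N) → k, ∀ i j,
      comb c i j * (N.choose (wt i) : k) = if wt i = wt j then 1 else 0 := by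
  classical
  choose s hs hs' using fun σ : Perm (Fin N) => straighten (K := ℚ_[p]) σ
  let c : Perm (Fin N) → ℚ_[p] := fun τ => ∑ σ, ((N.factorial : ℚ_[p]))⁻¹ * s σ τ
  have hc : ∀ τ, ¬ Avoid τ → c τ = 0 := fun τ hτ =>
    Finset.sum_eq_zero fun σ _ => by rw [hs σ τ hτ, mul_zero]
  have hc' : ∀ i j, comb c i j = if wt i = wt j then ((N.choose (wt i) : ℚ_[p]))⁻¹ else 0 := by
    intro i j
    rw [← comb_const]
    have : ∀ i j, comb c i j = ∑ σ, ((N.factorial : ℚ_[p]))⁻¹ * comb (s σ) i j := by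
      intro i j
      simp only [comb, c, Finset.mul_sum, mul_ite, mul_zero]
      rw [Finset.sum_comm]
      refine Finset.sum_congr rfl fun τ _ => ?_
      split_ifs <;> simp
    rw [this, comb]
    refine Finset.sum_congr rfl fun σ _ => ?_
    rw [hs']; split_ifs <;> simp
  have hint := integral_of (PadicInt.subring p) c hc (fun i j => by
    rw [hc']
    split_ifs
    · have : ‖(N.choose (wt i) : ℚ_[p])‖ = 1 := by
        rw [Padic.norm_natCast_eq_one_iff]
        exact (Nat.Prime.coprime_iff_not_dvd Fact.out).2 (hN _ (wt_le i))
      show ‖_‖ ≤ (1 : ℝ)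
      rw [norm_inv, this, inv_one]
    · exact Subring.zero_mem _)
  let d : Perm (Fin N) → ℤ_[p] := fun σ => ⟨c σ, hint σ⟩
  have hd : ∀ i j, comb d i j * (N.choose (wt i) : ℤ_[p]) = if wt i = wt j then 1 else 0 := by
    intro i j
    have hinj : Function.Injective (PadicInt.Coe.ringHom (p := p)) := fun x y h => PadicInt.ext h
    apply hinj
    have h1 : PadicInt.Coe.ringHom (comb d i j) = comb c i j := by
      rw [comb_map]; rfl
    have h2 : (N.choose (wt i) : ℚ_[p]) ≠ 0 := by
      exact_mod_cast (Nat.choose_pos (wt_le i)).ne'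
    rw [map_mul, h1, hc', map_natCast]
    split_ifs
    · rw [inv_mul_cancel₀ h2, map_one]
    · rw [zero_mul, map_zero]
  let f : ℤ_[p] →+* k := (ZMod.castHom dvd_rfl k).comp PadicInt.toZMod
  refine ⟨fun σ => f (d σ), fun i j => ?_⟩
  have := congrArg f (hd i j)
  rw [map_mul, map_natCast] at this
  have h1 : f (comb d i j) = comb (fun σ => f (d σ)) i j := comb_map f d i j
  rw [← h1, this]
  split_ifs <;> simp

lemma choose_sq (k : Type*) [Field k] [Fintype k] (p : ℕ) [Fact p.Prime] [CharP k p]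
    (w : ℕ) (hw : w ≤ Fintype.card k - 1) :
    (((Fintype.card k - 1).choose w : ℕ) : k) = (-1) ^ w := by
  obtain ⟨n, hp, hn⟩ := FiniteField.card k p
  induction w with
  | zero => simp
  | succ w ih =>
    have h1 := ih (by omega)
    have hpos : 0 < Fintype.card k := Fintype.card_pos
    have h2 : (Fintype.card k).choose (w + 1) =
        (Fintype.card k - 1).choose w + (Fintype.card k - 1).choose (w + 1) := by
      conv_lhs => rw [show Fintype.card k = (Fintype.card k - 1) + 1 by omega]
      exact Nat.choose_succ_succ _ _
    have h3 : p ∣ (Fintype.card k).choose (w + 1) := by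
      rw [hn]
      refine hp.dvd_choose_pow (by omega) ?_
      rw [← hn]; omega
    have h4 := (CharP.cast_eq_zero_iff k p _).2 h3
    rw [h2] at h4
    push_cast at h4
    rw [h1] at h4
    rw [pow_succ]
    linear_combination h4

open Equiv Matrix

set_option linter.unusedSectionVars false
section mat
variable {k : Type} [Field k] {ι κ : Type} [Fintype ι] [DecidableEq ι] [Fintype κ] [DecidableEq κ]

/-- Kronecker power of a 2 x 2 matrix. -/
def kr (ι : Type) [Fintype ι] (A : Matrix (Fin 2) (Fin 2) k) :
    Matrix (ι → Fin 2) (ι → Fin 2) k := Matrix.of fun i j => ∏ l, A (i l) (j l)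

lemma kr_mul (A B : Matrix (Fin 2) (Fin 2) k) : kr ι (A * B) = kr ι A * kr ι B := by
  ext i j
  simp only [kr, Matrix.of_apply, Matrix.mul_apply, ← Finset.prod_mul_distrib]
  rw [Finset.prod_univ_sum, Fintype.piFinset_univ]

lemma kr_one : kr ι (1 : Matrix (Fin 2) (Fin 2) k) = 1 := by
  ext i j
  simp only [kr, Matrix.of_apply, Matrix.one_apply]
  rw [Finset.prod_ite_zero]
  simp [funext_iff]

/-- permutation matrices on words -/
def Pm (k : Type) [Field k] (e : ι ≃ κ) : Matrix (ι → Fin 2) (κ → Fin 2) k :=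
  Matrix.of fun i j => if i = j ∘ e then 1 else 0

lemma kr_Pm (e : ι ≃ κ) (A : Matrix (Fin 2) (Fin 2) k) : kr ι A * Pm k e = Pm k e * kr κ A := by
  ext i j
  simp only [kr, Pm, Matrix.of_apply, Matrix.mul_apply, mul_ite, mul_one, mul_zero, ite_mul,
    one_mul, zero_mul]
  rw [Finset.sum_ite_eq' Finset.univ]
  have : ∀ h : κ → Fin 2, (i = h ∘ e) ↔ (h = i ∘ e.symm) := by
    intro h
    constructor
    · rintro rfl; funext l; simp
    · rintro rfl; funext l; simp
  simp only [this]
  rw [Finset.sum_ite_eq' Finset.univ]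
  simp only [Finset.mem_univ, if_true]
  exact Fintype.prod_equiv e _ _ (fun l => by simp)

lemma Pm_trans {μ : Type} [Fintype μ] [DecidableEq μ] (e : ι ≃ κ) (f : κ ≃ μ) :
    Pm k (e.trans f) = Pm k e * Pm k f := by
  ext i j
  simp only [Pm, Matrix.of_apply, Matrix.mul_apply, mul_ite, mul_one, mul_zero]
  rw [Finset.sum_ite_eq' Finset.univ]
  simp only [Finset.mem_univ, if_true, Equiv.coe_trans, Function.comp_assoc]
  congr

lemma Pm_refl : Pm k (Equiv.refl ι) = 1 := by
  ext i j
  simp [Pm, Matrix.one_apply]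

/-- endomorphisms factoring through representations of dimension at most `D` -/
def S (k : Type) [Field k] (D : ℕ) (ι : Type) [Fintype ι] [DecidableEq ι] : Set (Matrix (ι → Fin 2) (ι → Fin 2) k) :=
  {X | ∃ (d : ℕ) (_ : d ≤ D) (σ : GL (Fin 2) k →* Matrix (Fin d) (Fin d) k)
    (f : Matrix (Fin d) (ι → Fin 2) k) (g : Matrix (ι → Fin 2) (Fin d) k),
    X = g * f ∧ ∀ γ : GL (Fin 2) k, σ γ * f = f * kr ι γ.1 ∧ kr ι γ.1 * g = g * σ γ}

def Bd (k : Type) [Field k] (D : ℕ) (ι : Type) [Fintype ι] [DecidableEq ι] :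
    Submodule k (Matrix (ι → Fin 2) (ι → Fin 2) k) :=
  Submodule.span k (S k D ι)

lemma mem_S {D : ℕ} {X : Type} [Fintype X] [DecidableEq X] (hX : Fintype.card X ≤ D)
    (σ : GL (Fin 2) k →* Matrix X X k)
    (f : Matrix X (ι → Fin 2) k) (g : Matrix (ι → Fin 2) X k)
    (h : ∀ γ : GL (Fin 2) k, σ γ * f = f * kr ι γ.1 ∧ kr ι γ.1 * g = g * σ γ) :
    g * f ∈ S k D ι := by
  let e := Fintype.equivFin X
  refine ⟨_, hX, (Matrix.reindexAlgEquiv k k e).toAlgHom.toMonoidHom.comp σ,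
    f.submatrix e.symm id, g.submatrix id e.symm, ?_, fun γ => ⟨?_, ?_⟩⟩
  · rw [Matrix.submatrix_mul_equiv]; simp
  · have := (h γ).1
    change (σ γ).submatrix e.symm e.symm * f.submatrix e.symm id = _
    rw [Matrix.submatrix_mul_equiv, this]
    rfl
  · have := (h γ).2
    change _ = g.submatrix id e.symm * (σ γ).submatrix e.symm e.symm
    rw [Matrix.submatrix_mul_equiv, ← this]
    rfl

lemma Bd_conj {D : ℕ} (χ : GL (Fin 2) k →* k)
    (c : Matrix (ι → Fin 2) (κ → Fin 2) k) (d : Matrix (κ → Fin 2) (ι → Fin 2) k)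
    (hc : ∀ γ : GL (Fin 2) k, kr ι γ.1 * c = χ γ • (c * kr κ γ.1))
    (hd : ∀ γ : GL (Fin 2) k, χ γ • (kr κ γ.1 * d) = d * kr ι γ.1)
    (X : Matrix (κ → Fin 2) (κ → Fin 2) k) (hX : X ∈ Bd k D κ) : c * X * d ∈ Bd k D ι := by
  induction hX using Submodule.span_induction with
  | mem X hX =>
    obtain ⟨n, hn, σ, f, g, rfl, h⟩ := hX
    refine Submodule.subset_span ?_
    refine ⟨n, hn, ⟨⟨fun γ => χ γ • σ γ, by simp⟩, fun γ δ => ?_⟩, f * d, c * g, ?_, fun γ => ⟨?_, ?_⟩⟩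
    · simp [smul_smul, mul_comm]
    · simp only [Matrix.mul_assoc]
    · simp only [MonoidHom.coe_mk, OneHom.coe_mk]
      rw [Matrix.mul_assoc, ← hd, Matrix.smul_mul, ← Matrix.mul_assoc, (h γ).1, Matrix.mul_smul,
        Matrix.mul_assoc]
    · simp only [MonoidHom.coe_mk, OneHom.coe_mk]
      rw [← Matrix.mul_assoc, hc, Matrix.smul_mul, Matrix.mul_assoc, (h γ).2, Matrix.mul_smul,
        Matrix.mul_assoc]
  | zero => simp
  | add X Y _ _ hX hY => rw [Matrix.mul_add, Matrix.add_mul]; exact Submodule.add_mem _ hX hY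
  | smul a X _ hX => rw [Matrix.mul_smul, Matrix.smul_mul]; exact Submodule.smul_mem _ _ hX

lemma Bd_conj_one {D : ℕ} 
    (c : Matrix (ι → Fin 2) (κ → Fin 2) k) (d : Matrix (κ → Fin 2) (ι → Fin 2) k)
    (hc : ∀ γ : GL (Fin 2) k, kr ι γ.1 * c = (c * kr κ γ.1))
    (hd : ∀ γ : GL (Fin 2) k, (kr κ γ.1 * d) = d * kr ι γ.1)
    (X : Matrix (κ → Fin 2) (κ → Fin 2) k) (hX : X ∈ Bd k D κ) : c * X * d ∈ Bd k D ι :=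
  Bd_conj 1 c d (by simpa using hc) (by simpa using hd) X hX

lemma Bd_self {D : ℕ} (h : 2 ^ Fintype.card ι ≤ D) : (1 : Matrix (ι → Fin 2) (ι → Fin 2) k) ∈ Bd k D ι := by
  refine Submodule.subset_span ?_
  have := mem_S (k := k) (ι := ι) (D := D) (X := ι → Fin 2) (by simpa using h)
    ⟨⟨fun γ => kr ι γ.1, by simp [kr_one]⟩, fun γ δ => by simp [kr_mul]⟩ 1 1 (by simp)
  simpa using this

lemma Bd_equiv {D : ℕ} (e : ι ≃ κ) (h : (1 : Matrix (κ → Fin 2) (κ → Fin 2) k) ∈ Bd k D κ) :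
    (1 : Matrix (ι → Fin 2) (ι → Fin 2) k) ∈ Bd k D ι := by
  have := Bd_conj_one (Pm k e) (Pm k e.symm) (fun γ => kr_Pm _ _) (fun γ => kr_Pm _ _) 1 h
  rwa [Matrix.mul_one, ← Pm_trans, e.self_trans_symm, Pm_refl] at this


lemma Bd_trace [Fintype k] [DecidableEq k] {D : ℕ} (hD : Fintype.card (GL (Fin 2) k) ≤ D) (Θ : Matrix (ι → Fin 2) (ι → Fin 2) k) :
    ∑ γ : GL (Fin 2) k, kr ι γ.1 * Θ * kr ι (γ⁻¹).1 ∈ Bd k D ι := by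
  rw [Matrix.matrix_eq_sum_single Θ]
  simp only [Matrix.mul_sum, Matrix.sum_mul]
  rw [Finset.sum_comm]
  refine Submodule.sum_mem _ fun a _ => ?_
  rw [Finset.sum_comm]
  refine Submodule.sum_mem _ fun b _ => ?_
  have key : ∑ γ : GL (Fin 2) k, kr ι γ.1 * Matrix.single a b (1 : k) * kr ι (γ⁻¹).1 ∈ Bd k D ι := by
    let f : Matrix (GL (Fin 2) k) (ι → Fin 2) k := Matrix.of fun γ j => kr ι (γ⁻¹).1 b j
    let g : Matrix (ι → Fin 2) (GL (Fin 2) k) k := Matrix.of fun i γ => kr ι γ.1 i a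
    let σ : GL (Fin 2) k →* Matrix (GL (Fin 2) k) (GL (Fin 2) k) k :=
      ⟨⟨fun h => Matrix.of fun γ γ' => if γ = h * γ' then 1 else 0, by
        ext; simp [Matrix.one_apply]⟩, fun x y => by
          ext u v
          simp only [Matrix.of_apply, Matrix.mul_apply, mul_ite, mul_one, mul_zero]
          rw [Finset.sum_ite_eq' Finset.univ]
          simp [mul_assoc]⟩
    have h : g * f ∈ S k D ι := by
      refine mem_S hD σ f g fun γ => ⟨?_, ?_⟩
      · ext u j
        have e : ∀ x : GL (Fin 2) k, (u = γ * x) ↔ (x = γ⁻¹ * u) := by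
          intro x; rw [eq_inv_mul_iff_mul_eq, eq_comm]
        simp only [σ, f, MonoidHom.coe_mk, OneHom.coe_mk, Matrix.of_apply, Matrix.mul_apply, ite_mul,
          one_mul, zero_mul, e]
        rw [Finset.sum_ite_eq' Finset.univ]
        simp only [Finset.mem_univ, if_true, _root_.mul_inv_rev, inv_inv, Units.val_mul, kr_mul,
          Matrix.mul_apply]
      · ext i u
        simp only [σ, g, MonoidHom.coe_mk, OneHom.coe_mk, Matrix.of_apply, Matrix.mul_apply, mul_ite,
          mul_one, mul_zero]
        rw [Finset.sum_ite_eq' Finset.univ]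
        simp only [Finset.mem_univ, if_true, Units.val_mul, kr_mul, Matrix.mul_apply]
    have h2 : ∑ γ : GL (Fin 2) k, kr ι γ.1 * Matrix.single a b (1 : k) * kr ι (γ⁻¹).1 = g * f := by
      ext i j
      rw [Matrix.sum_apply, Matrix.mul_apply]
      refine Finset.sum_congr rfl fun γ _ => ?_
      rw [Matrix.mul_apply, Finset.sum_eq_single b]
      · simp [f, g]
      · intro x _ hx
        rw [Matrix.mul_single_apply_of_ne _ _ _ _ _ hx, zero_mul]
      · simp
    rw [h2]; exact Submodule.subset_span h
  have h3 : ∀ γ : GL (Fin 2) k, kr ι γ.1 * Matrix.single a b (Θ a b) * kr ι (γ⁻¹).1 =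
      Θ a b • (kr ι γ.1 * Matrix.single a b (1 : k) * kr ι (γ⁻¹).1) := by
    intro γ
    rw [← Matrix.smul_mul, ← Matrix.mul_smul, Matrix.smul_single, smul_eq_mul, mul_one]
  simp only [h3]
  rw [← Finset.smul_sum]
  exact Submodule.smul_mem _ _ key


def eps (k : Type) [Field k] (x y : Fin 2) : k :=
  if x = 0 ∧ y = 1 then 1 else if x = 1 ∧ y = 0 then -1 else 0

lemma eps_det (A : Matrix (Fin 2) (Fin 2) k) (x y : Fin 2) :
    ∑ u : Fin 2 → Fin 2, A x (u 0) * A y (u 1) * eps k (u 0) (u 1) = A.det * eps k x y := by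
  rw [← (finTwoArrowEquiv (Fin 2)).symm.sum_comp, Fintype.sum_prod_type]
  fin_cases x <;> fin_cases y <;> simp [eps, Matrix.det_fin_two, finTwoArrowEquiv] <;> ring

lemma eps_det' (A : Matrix (Fin 2) (Fin 2) k) (x y : Fin 2) :
    ∑ u : Fin 2 → Fin 2, eps k (u 0) (u 1) * (A (u 0) x * A (u 1) y) = A.det * eps k x y := by
  rw [← (finTwoArrowEquiv (Fin 2)).symm.sum_comp, Fintype.sum_prod_type]
  fin_cases x <;> fin_cases y <;> simp [eps, Matrix.det_fin_two, finTwoArrowEquiv] <;> ring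

/-- cup -/
def cup (k : Type) [Field k] (κ : Type) [Fintype κ] [DecidableEq κ] :
    Matrix (Fin 2 ⊕ κ → Fin 2) (κ → Fin 2) k :=
  Matrix.of fun i h => if i ∘ Sum.inr = h then eps k (i (.inl 0)) (i (.inl 1)) else 0

lemma cup_comm (A : Matrix (Fin 2) (Fin 2) k) :
    kr (Fin 2 ⊕ κ) A * cup k κ = A.det • (cup k κ * kr κ A) := by
  ext i h
  simp only [kr, cup, Matrix.of_apply, Matrix.mul_apply, Matrix.smul_apply, Fintype.prod_sum_type,
    ite_mul, zero_mul, mul_ite, mul_zero]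
  rw [Finset.sum_ite_eq Finset.univ]
  rw [← (Equiv.sumArrowEquivProdArrow (Fin 2) κ (Fin 2)).symm.sum_comp, Fintype.sum_prod_type]
  have e : ∀ (u : Fin 2 → Fin 2) (v : κ → Fin 2),
    ((Equiv.sumArrowEquivProdArrow (Fin 2) κ (Fin 2)).symm (u, v)) ∘ Sum.inr = v := fun u v => rfl
  simp only [e, Finset.sum_ite_eq', Finset.mem_univ, if_true, Fin.prod_univ_two]
  simp only [Equiv.sumArrowEquivProdArrow, Equiv.coe_fn_symm_mk, Sum.elim_inl, Sum.elim_inr]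
  rw [smul_eq_mul, ← mul_assoc, ← eps_det, Finset.sum_mul]
  refine Finset.sum_congr rfl fun u _ => ?_
  simp only [Function.comp]
  ring

lemma cup_comm' (A : Matrix (Fin 2) (Fin 2) k) :
    A.det • (kr κ A * (cup k κ)ᵀ) = (cup k κ)ᵀ * kr (Fin 2 ⊕ κ) A := by
  have h := congrArg Matrix.transpose (cup_comm (κ := κ) Aᵀ)
  have h1 : ∀ (ν : Type) [Fintype ν], (kr ν Aᵀ)ᵀ = kr ν A := fun ν _ => rfl
  simp only [Matrix.transpose_mul, Matrix.transpose_smul, Matrix.det_transpose, h1] at h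
  exact h.symm

lemma cup_cap : cup k κ * (cup k κ)ᵀ = 1 - Pm k (swap (Sum.inl 0 : Fin 2 ⊕ κ) (Sum.inl 1)) := by
  ext i j
  simp only [cup, Matrix.mul_apply, Matrix.of_apply, Matrix.transpose_apply, ite_mul, zero_mul, mul_ite, mul_zero,
    Matrix.sub_apply, Matrix.one_apply, Pm]
  rw [Finset.sum_ite_eq Finset.univ]
  have h1 : i = j ↔ (i ∘ Sum.inr = j ∘ Sum.inr ∧ i (.inl 0) = j (.inl 0) ∧ i (.inl 1) = j (.inl 1)) := by
    simp only [funext_iff, Sum.forall, Fin.forall_fin_two, Function.comp]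
    constructor
    · rintro ⟨a, b⟩; exact ⟨b, a⟩
    · rintro ⟨a, b⟩; exact ⟨b, a⟩
  have h2 : i = j ∘ swap (Sum.inl 0 : Fin 2 ⊕ κ) (Sum.inl 1) ↔ (i ∘ Sum.inr = j ∘ Sum.inr ∧ i (.inl 0) = j (.inl 1) ∧ i (.inl 1) = j (.inl 0)) := by
    have : ∀ x : κ, swap (Sum.inl 0 : Fin 2 ⊕ κ) (Sum.inl 1) (Sum.inr x) = Sum.inr x := fun x =>
      swap_apply_of_ne_of_ne (by simp) (by simp)
    simp only [funext_iff, Sum.forall, Fin.forall_fin_two, Function.comp, swap_apply_left,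
      swap_apply_right, this]
    constructor
    · rintro ⟨a, b⟩; exact ⟨b, a⟩
    · rintro ⟨a, b⟩; exact ⟨b, a⟩
  simp only [h1, h2]
  by_cases h : i ∘ Sum.inr = j ∘ Sum.inr
  · simp only [h, true_and, Finset.mem_univ, if_true]
    generalize i (.inl 0) = a
    generalize i (.inl 1) = b
    generalize j (.inl 0) = c
    generalize j (.inl 1) = d
    fin_cases a <;> fin_cases b <;> fin_cases c <;> fin_cases d <;> simp [eps]
  · simp [h]

lemma exists_equiv_two (a b : ι) (hab : a ≠ b) :
    ∃ e : ι ≃ Fin 2 ⊕ Fin (Fintype.card ι - 2), e a = .inl 0 ∧ e b = .inl 1 := by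
  have hc : 2 ≤ Fintype.card ι := by
    have := Fintype.one_lt_card_iff.2 ⟨a, b, hab⟩; omega
  have e0 : ι ≃ Fin 2 ⊕ Fin (Fintype.card ι - 2) := Fintype.equivOfCardEq (by simp; omega)
  let e1 := e0.trans (swap (e0 a) (.inl 0))
  have h1 : e1 a = .inl 0 := by simp [e1]
  let e2 := e1.trans (swap (e1 b) (.inl 1))
  refine ⟨e2, ?_, by simp [e2]⟩
  simp only [e2, Equiv.trans_apply, h1]
  refine swap_apply_of_ne_of_ne ?_ (by simp)
  rw [← h1]; exact fun h => hab (e1.injective h)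

lemma Bd_swap {D : ℕ} (a b : ι) (hab : a ≠ b)
    (ih : (1 : Matrix (Fin (Fintype.card ι - 2) → Fin 2) (Fin (Fintype.card ι - 2) → Fin 2) k) ∈
      Bd k D (Fin (Fintype.card ι - 2))) :
    1 - Pm k (swap a b) ∈ Bd k D ι := by
  obtain ⟨e, ha, hb⟩ := exists_equiv_two a b hab
  have h1 := Bd_conj ((Units.coeHom k).comp (Matrix.GeneralLinearGroup.det)) (cup k _) (cup k _)ᵀ
    (fun γ => cup_comm γ.1) (fun γ => cup_comm' γ.1) 1 ih
  rw [Matrix.mul_one, cup_cap] at h1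
  have h2 := Bd_conj_one (Pm k e) (Pm k e.symm) (fun γ => kr_Pm _ _) (fun γ => kr_Pm _ _) _ h1
  rw [Matrix.mul_sub, Matrix.sub_mul, Matrix.mul_one, ← Pm_trans, ← Pm_trans, ← Pm_trans,
    e.self_trans_symm, Pm_refl, ← ha, ← hb] at h2
  convert h2 using 3
  ext l
  simp only [Equiv.trans_apply]
  rw [← Equiv.symm_trans_swap_trans a b e]
  simp only [Equiv.trans_apply, Equiv.symm_apply_apply]

lemma Bd_perm {D : ℕ} 
    (ih : 2 ≤ Fintype.card ι → (1 : Matrix (Fin (Fintype.card ι - 2) → Fin 2) (Fin (Fintype.card ι - 2) → Fin 2) k) ∈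
      Bd k D (Fin (Fintype.card ι - 2))) (σ : Perm ι) :
    1 - Pm k σ ∈ Bd k D ι := by
  induction σ using Equiv.Perm.swap_induction_on with
  | one => 
    have : Pm k (1 : Perm ι) = 1 := Pm_refl
    rw [this, sub_self]; exact Submodule.zero_mem _
  | swap_mul f x y hxy hf =>
    have hc : 2 ≤ Fintype.card ι := by
      have := Fintype.one_lt_card_iff.2 ⟨x, y, hxy⟩; omega
    have h1 := Bd_swap (D := D) x y hxy (ih hc)
    have h2 : Pm k (swap x y * f) = Pm k f * Pm k (swap x y) := by
      rw [← Pm_trans]; rfl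
    have h3 := Bd_conj_one (Pm k f) 1 (fun γ => kr_Pm _ _) (by simp) _ h1
    rw [h2]
    have h4 : (1 : Matrix (ι → Fin 2) (ι → Fin 2) k) - Pm k f * Pm k (swap x y) =
      (1 - Pm k f) + Pm k f * (1 - Pm k (swap x y)) * 1 := by
      rw [Matrix.mul_sub, Matrix.mul_one, Matrix.mul_one]; abel
    rw [h4]
    exact Submodule.add_mem _ hf h3
end mat

end TwoDim

namespace TwoDim
open Equiv Matrix
set_option linter.unusedSectionVars false
section tr
variable {k : Type} [Field k] [Fintype k] [DecidableEq k]

lemma S_zero : ∑ t : k, t ^ 0 = 0 := by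
  simp

lemma S_pos (e : ℕ) (he : e ≠ 0) : ∑ t : k, t ^ e = if Fintype.card k - 1 ∣ e then -1 else 0 := by
  rw [← FiniteField.sum_pow_units k e]
  symm
  refine Finset.sum_of_injOn (fun x : kˣ => x.1) (fun x _ y _ h => Units.ext h) (by simp) ?_ ?_
  · intro a _ ha
    have : a = 0 := by
      by_contra h
      exact ha ⟨Units.mk0 a h, by simp, rfl⟩
    rw [this, zero_pow he]
  · intro x _; rfl

lemma S_mul (N e : ℕ) (hN : N = Fintype.card k - 1) (he : e ≤ 2 * N) :
    (∑ t : k, t ^ (2 * N - e)) * (∑ t : k, t ^ e) = if e = N then 1 else 0 := by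
  have hN0 : 0 < N := by have := Fintype.one_lt_card (α := k); omega
  rcases Nat.eq_zero_or_pos e with rfl | h0
  · rw [S_zero, mul_zero, if_neg (by omega)]
  · rcases eq_or_ne e (2 * N) with rfl | h1
    · rw [Nat.sub_self, S_zero, zero_mul, if_neg (by omega)]
    · split_ifs with h
      · subst h
        rw [show 2 * e - e = e by omega, S_pos e (by omega), ← hN]; simp
      · rw [S_pos e (by omega), ← hN, if_neg, mul_zero]
        rintro ⟨q, rfl⟩
        have : q < 2 := by
          by_contra hq
          have : N * 2 ≤ N * q := Nat.mul_le_mul_left _ (by omega)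
          exact h1 (by omega)
        interval_cases q <;> omega

lemma sum_four (N w v : ℕ) (hN : N = Fintype.card k - 1) (hw : w ≤ N) (hv : v ≤ N) :
    ∑ a : k, ∑ b : k, ∑ c : k, ∑ d : k,
      (a ^ (N - w) * c ^ w * (d ^ (N - v) * (-b) ^ v)) * (a * d - b * c) ^ N =
    if w = v then (-1) ^ N * (N.choose w : k) else 0 := by
  have h1 : ∀ a b c d : k, (a ^ (N - w) * c ^ w * (d ^ (N - v) * (-b) ^ v)) * (a * d - b * c) ^ N =
      ∑ s ∈ Finset.range (N + 1), ((-1) ^ (v + s) * (N.choose s : k)) *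
        (a ^ (2 * N - (w + s)) * c ^ (w + s) * (d ^ (2 * N - (v + s)) * b ^ (v + s))) := by
    intro a b c d
    rw [show a * d - b * c = -(b * c) + a * d by ring, add_pow, Finset.mul_sum]
    refine Finset.sum_congr rfl fun s hs => ?_
    rw [Finset.mem_range] at hs
    rw [show 2 * N - (w + s) = (N - w) + (N - s) by omega,
      show 2 * N - (v + s) = (N - v) + (N - s) by omega, neg_pow (b * c), neg_pow b]
    simp only [pow_add, mul_pow]
    ring
  simp only [h1]
  have h2 : ∑ a : k, ∑ b : k, ∑ c : k, ∑ d : k, ∑ s ∈ Finset.range (N + 1),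
      ((-1) ^ (v + s) * (N.choose s : k)) *
        (a ^ (2 * N - (w + s)) * c ^ (w + s) * (d ^ (2 * N - (v + s)) * b ^ (v + s))) =
      ∑ s ∈ Finset.range (N + 1), ((-1) ^ (v + s) * (N.choose s : k)) *
        (((∑ a : k, a ^ (2 * N - (w + s))) * (∑ c : k, c ^ (w + s))) *
         ((∑ d : k, d ^ (2 * N - (v + s))) * (∑ b : k, b ^ (v + s)))) := by
    simp only [Finset.sum_comm (t := Finset.range (N + 1))]
    refine Finset.sum_congr rfl fun s hs => ?_
    simp only [← Finset.mul_sum]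
    congr 1
    simp only [← Finset.sum_mul, ← Finset.mul_sum]
  rw [h2]
  rw [Finset.sum_eq_single (N - w)]
  · rw [S_mul N _ hN (by omega), S_mul N _ hN (by omega), if_pos (by omega)]
    split_ifs with h3 h4 h4
    · rw [show v + (N - w) = N by omega, Nat.choose_symm hw]; ring
    · omega
    · omega
    · simp
  · intro s hs hne
    rw [Finset.mem_range] at hs
    rw [S_mul N _ hN (by omega), if_neg (by omega)]; simp
  · intro h; simp at h

lemma neg_one_pow (N : ℕ) (hN : N = Fintype.card k - 1) : (-1 : k) ^ N = 1 := by
  rw [hN]; exact FiniteField.pow_card_sub_one_eq_one _ (by simp)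

lemma prod_word {N : ℕ} (i : Fin N → Fin 2) (f : Fin 2 → k) :
    ∏ l, f (i l) = f 0 ^ (N - wt i) * f 1 ^ wt i := by
  rw [← card_zero, wt, Fintype.card_subtype, Fintype.card_subtype,
    ← Finset.prod_fiberwise (s := Finset.univ) (g := i), Fin.prod_univ_two]
  congr 1
  · rw [Finset.prod_congr rfl (g := fun _ => f 0), Finset.prod_const]
    intro x hx; rw [(Finset.mem_filter.1 hx).2]
  · rw [Finset.prod_congr rfl (g := fun _ => f 1), Finset.prod_const]
    intro x hx; rw [(Finset.mem_filter.1 hx).2]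

lemma sum_mat (F : Matrix (Fin 2) (Fin 2) k → k) :
    ∑ A, F A = ∑ a : k, ∑ b : k, ∑ c : k, ∑ d : k, F !![a, b; c, d] := by
  let e : Matrix (Fin 2) (Fin 2) k ≃ k × k × k × k :=
    ⟨fun A => (A 0 0, A 0 1, A 1 0, A 1 1), fun x => !![x.1, x.2.1; x.2.2.1, x.2.2.2],
      fun A => (Matrix.eta_fin_two A).symm, fun x => rfl⟩
  rw [← e.symm.sum_comp]
  simp only [Fintype.sum_prod_type]
  rfl

lemma sum_GL {N : ℕ} (hN : N = Fintype.card k - 1) (i j : Fin N → Fin 2) :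
    ∑ γ : GL (Fin 2) k, ∏ l, γ.1 (i l) 0 * (γ⁻¹).1 0 (j l) =
      if wt i = wt j then (N.choose (wt i) : k) else 0 := by
  have hN0 : N ≠ 0 := by have := Fintype.one_lt_card (α := k); omega
  let F : Matrix (Fin 2) (Fin 2) k → k := fun A =>
    (∏ l, A (i l) 0) * (∏ l, A.adjugate 0 (j l)) * A.det ^ N
  have h1 : ∑ γ : GL (Fin 2) k, ∏ l, γ.1 (i l) 0 * (γ⁻¹).1 0 (j l) = ∑ A, F A := by
    refine Finset.sum_of_injOn (fun γ => γ.1) (fun x _ y _ h => Units.ext h) (by simp) ?_ ?_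
    · intro A _ hA
      have : A.det = 0 := by
        by_contra hd
        exact hA ⟨Matrix.GeneralLinearGroup.mkOfDetNeZero A hd, by simp, rfl⟩
      simp [F, this, hN0]
    · intro γ _
      have hd : γ.1.det ≠ 0 := by
        have := (Matrix.isUnit_iff_isUnit_det _).1 γ.isUnit
        exact this.ne_zero
      have hinv : ∀ x, (γ⁻¹).1 0 x = (γ.1.det)⁻¹ * γ.1.adjugate 0 x := by
        intro x
        rw [Matrix.coe_units_inv, Matrix.inv_def, Matrix.smul_apply, Ring.inverse_eq_inv', smul_eq_mul]
      have hp : γ.1.det ^ N = 1 := by rw [hN]; exact FiniteField.pow_card_sub_one_eq_one _ hd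
      simp only [hinv, F, Finset.prod_mul_distrib, Finset.prod_const, Finset.card_univ, Fintype.card_fin, inv_pow, hp]
      simp
  rw [h1, sum_mat]
  have h2 : ∀ a b c d : k, F !![a, b; c, d] =
    (a ^ (N - wt i) * c ^ (wt i) * (d ^ (N - wt j) * (-b) ^ (wt j))) * (a * d - b * c) ^ N := by
    intro a b c d
    simp only [F]
    rw [prod_word i (fun x => !![a, b; c, d] x 0), prod_word j (fun x => (!![a, b; c, d]).adjugate 0 x),
      Matrix.det_fin_two, Matrix.adjugate_fin_two]
    simp
  simp only [h2]
  rw [sum_four N _ _ hN (wt_le i) (wt_le j), neg_one_pow N hN, one_mul]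

lemma kr_sum_apply {α β : Type} [Fintype α] [Fintype β] (A : Matrix (Fin 2) (Fin 2) k)
    (i j : α ⊕ β → Fin 2) :
    kr (α ⊕ β) A i j = kr α A (i ∘ Sum.inl) (j ∘ Sum.inl) * kr β A (i ∘ Sum.inr) (j ∘ Sum.inr) := by
  simp [kr, Fintype.prod_sum_type]

def Theta (k : Type) [Field k] (N r : ℕ) :
    Matrix (Fin N ⊕ Fin r → Fin 2) (Fin N ⊕ Fin r → Fin 2) k :=
  Matrix.of fun i j => if i ∘ Sum.inl = (fun _ => 0) ∧ j = i then 1 else 0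

abbrev Tm (k : Type) [Field k] (N r : ℕ) (γ : GL (Fin 2) k) :
    Matrix (Fin N ⊕ Fin r → Fin 2) (Fin N ⊕ Fin r → Fin 2) k :=
  kr (Fin N ⊕ Fin r) γ.1 * Theta k N r * kr (Fin N ⊕ Fin r) (γ⁻¹).1

lemma trace_entry {N r : ℕ} (hN : N = Fintype.card k - 1) (i j : Fin N ⊕ Fin r → Fin 2) :
    (∑ γ : GL (Fin 2) k, Tm k N r γ) i j =
    if wt (i ∘ Sum.inl) = wt (j ∘ Sum.inl) ∧ i ∘ Sum.inr = j ∘ Sum.inr then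
      (N.choose (wt (i ∘ Sum.inl)) : k) else 0 := by
  have h1 : ∀ γ : GL (Fin 2) k, (Tm k N r γ) i j =
      (∏ l, γ.1 ((i ∘ Sum.inl) l) 0 * (γ⁻¹).1 0 ((j ∘ Sum.inl) l)) *
        (if i ∘ Sum.inr = j ∘ Sum.inr then 1 else 0) := by
    intro γ
    have h2 : (kr (Fin r) γ.1 * kr (Fin r) (γ⁻¹).1) (i ∘ Sum.inr) (j ∘ Sum.inr) =
        if i ∘ Sum.inr = j ∘ Sum.inr then 1 else 0 := by
      rw [← kr_mul, ← Units.val_mul, mul_inv_cancel, Units.val_one, kr_one, Matrix.one_apply]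
    rw [← h2, Tm, Matrix.mul_apply, Matrix.mul_apply, Finset.mul_sum]
    rw [← (Equiv.sumArrowEquivProdArrow (Fin N) (Fin r) (Fin 2)).symm.sum_comp,
      Fintype.sum_prod_type, Finset.sum_eq_single (fun _ => 0)]
    · refine Finset.sum_congr rfl fun v _ => ?_
      set u := (Equiv.sumArrowEquivProdArrow (Fin N) (Fin r) (Fin 2)).symm ((fun _ => 0), v) with hu
      have hul : u ∘ Sum.inl = fun _ => 0 := rfl
      have hur : u ∘ Sum.inr = v := rfl
      rw [Matrix.mul_apply, Finset.sum_eq_single u]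
      · rw [kr_sum_apply, kr_sum_apply, hul, hur]
        simp only [Theta, Matrix.of_apply, hul, and_self, if_true, Finset.prod_mul_distrib, kr]
        ring
      · intro x _ hx
        rw [Theta, Matrix.of_apply, if_neg, mul_zero]
        rintro ⟨_, h⟩; exact hx h.symm
      · simp
    · intro w _ hw
      refine Finset.sum_eq_zero fun v _ => ?_
      rw [Matrix.mul_apply, Finset.sum_eq_zero, zero_mul]
      intro x _
      rw [Theta, Matrix.of_apply, if_neg, mul_zero]
      rintro ⟨h, h'⟩
      rw [← h'] at h
      exact hw h
    · simp
  rw [Matrix.sum_apply]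
  simp only [h1]
  rw [← Finset.sum_mul, sum_GL hN]
  by_cases h3 : wt (i ∘ Sum.inl) = wt (j ∘ Sum.inl) <;>
  by_cases h4 : i ∘ Sum.inr = j ∘ Sum.inr <;> simp [h3, h4]

lemma Bd_step (p : ℕ) [Fact p.Prime] [CharP k p] {N r D : ℕ} (hN : N = Fintype.card k - 1)
    (hD : Fintype.card (GL (Fin 2) k) ≤ D)
    (hperm : ∀ σ : Perm (Fin N ⊕ Fin r), 1 - Pm k σ ∈ Bd k D (Fin N ⊕ Fin r)) :
    (1 : Matrix (Fin N ⊕ Fin r → Fin 2) (Fin N ⊕ Fin r → Fin 2) k) ∈ Bd k D (Fin N ⊕ Fin r) := by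
  have hch : ∀ w ≤ N, (N.choose w : k) = (-1) ^ w := by
    intro w hw; rw [hN] at hw ⊢; exact choose_sq k p w hw
  obtain ⟨c, hc⟩ := exists_coeff p N (fun w hw h => by
    have := (CharP.cast_eq_zero_iff k p _).2 h
    rw [hch w hw] at this
    exact absurd this (by simp)) k
  have hc' : ∀ i j, comb c i j = if wt i = wt j then (N.choose (wt i) : k) else 0 := by
    intro i j
    have h1 := hc i j
    rw [hch _ (wt_le i)] at h1 ⊢
    have h2 : ((-1 : k) ^ wt i) * (-1) ^ wt i = 1 := by rw [← mul_pow]; simp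
    calc comb c i j = (comb c i j * (-1) ^ wt i) * (-1) ^ wt i := by rw [mul_assoc, h2, mul_one]
      _ = _ := by rw [h1]; split_ifs <;> simp
  have hsum : ∑ σ, c σ = 1 := by
    have h1 := hc' (fun _ => 0) (fun _ => 0)
    have h2 : wt (fun _ : Fin N => (0 : Fin 2)) = 0 := by simp [wt]
    rw [if_pos rfl, h2, Nat.choose_zero_right, Nat.cast_one] at h1
    rw [← h1, comb]
    refine Finset.sum_congr rfl fun σ _ => ?_
    rw [if_pos]; rfl
  have hT := Bd_trace hD (Theta k N r)
  have hT2 : (∑ γ : GL (Fin 2) k, Tm k N r γ) =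
      ∑ σ : Perm (Fin N), c σ • Pm k (Equiv.sumCongr σ (Equiv.refl (Fin r))) := by
    ext i j
    rw [trace_entry hN, Matrix.sum_apply]
    have h3 : ∀ σ : Perm (Fin N), i = j ∘ (Equiv.sumCongr σ (Equiv.refl (Fin r))) ↔
        (i ∘ Sum.inl = (j ∘ Sum.inl) ∘ σ ∧ i ∘ Sum.inr = j ∘ Sum.inr) := by
      intro σ
      simp [funext_iff, Sum.forall]
    simp only [Matrix.smul_apply, Pm, Matrix.of_apply, h3, smul_eq_mul, mul_ite, mul_one, mul_zero]
    have := hc' (i ∘ Sum.inl) (j ∘ Sum.inl)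
    rw [comb] at this
    by_cases h4 : i ∘ Sum.inr = j ∘ Sum.inr
    · simp only [h4, and_true]
      exact this.symm
    · simp [h4]
  rw [hT2] at hT
  have h5 : (1 : Matrix (Fin N ⊕ Fin r → Fin 2) (Fin N ⊕ Fin r → Fin 2) k) =
      ∑ σ : Perm (Fin N), c σ • (1 - Pm k (Equiv.sumCongr σ (Equiv.refl (Fin r)))) +
      ∑ σ : Perm (Fin N), c σ • Pm k (Equiv.sumCongr σ (Equiv.refl (Fin r))) := by
    rw [← Finset.sum_add_distrib]
    simp only [← smul_add, sub_add_cancel]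
    rw [← Finset.sum_smul, hsum, one_smul]
  rw [h5]
  exact Submodule.add_mem _ (Submodule.sum_mem _ fun σ _ => Submodule.smul_mem _ _ (hperm _)) hT

lemma Bd_all (p : ℕ) [Fact p.Prime] [CharP k p] : ∃ D : ℕ, ∀ m : ℕ,
    (1 : Matrix (Fin m → Fin 2) (Fin m → Fin 2) k) ∈ Bd k D (Fin m) := by
  obtain ⟨N, hN⟩ : ∃ N, N = Fintype.card k - 1 := ⟨_, rfl⟩
  refine ⟨max (2 ^ N) (Fintype.card (GL (Fin 2) k)), fun m => ?_⟩
  induction m using Nat.strong_induction_on with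
  | _ m ih =>
    by_cases hm : m < N
    · refine Bd_self (le_trans ?_ (le_max_left _ _))
      rw [Fintype.card_fin]
      exact Nat.pow_le_pow_right (by norm_num) hm.le
    · obtain ⟨r, rfl⟩ := Nat.exists_eq_add_of_le (not_lt.1 hm)
      refine Bd_equiv finSumFinEquiv.symm (Bd_step p hN (le_max_right _ _) fun σ => ?_)
      refine Bd_perm (fun h2 => ?_) σ
      refine ih _ ?_
      simp only [Fintype.card_sum, Fintype.card_fin] at h2 ⊢
      omega
end tr
end TwoDim

namespace TwoDim
open Matrix

section lin
variable {k : Type} [Field k] {G : Type} [Monoid G]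

lemma exists_idem {R : Type*} [Monoid R] [Finite R] (x : R) :
    ∃ t, 1 ≤ t ∧ x ^ t * x ^ t = x ^ t := by
  obtain ⟨a, b, hab, h⟩ : ∃ a b : ℕ, a < b ∧ x ^ a = x ^ b := by
    obtain ⟨a, b, hne, h⟩ := Finite.exists_ne_map_eq_of_infinite (fun n : ℕ => x ^ n)
    rcases lt_or_gt_of_ne hne with h1 | h1
    · exact ⟨a, b, h1, h⟩
    · exact ⟨b, a, h1, h.symm⟩
  obtain ⟨c, rfl⟩ := Nat.exists_eq_add_of_lt hab
  have key : ∀ j s, x ^ (a + s + j * (c + 1)) = x ^ (a + s) := by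
    intro j s
    induction j with
    | zero => simp
    | succ j ih =>
      have : a + s + (j + 1) * (c + 1) = (a + c + 1) + (s + j * (c + 1)) := by ring
      rw [this, pow_add, ← h, ← pow_add, ← add_assoc, ih]
  refine ⟨(a + 1) * (c + 1), Nat.mul_pos (by omega) (by omega), ?_⟩
  have h2 : a ≤ (a + 1) * (c + 1) := by nlinarith
  obtain ⟨s, hs⟩ := Nat.exists_eq_add_of_le h2
  rw [← pow_add]
  have := key (a + 1) s
  rw [← hs] at this
  exact this

variable {N : Type*} [AddCommGroup N] [Module k N]

lemma nil_or_unit [Finite (Module.End k N)] (ρ : G →* Module.End k N)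
    (hid : ∀ e : Module.End k N, (∀ g, Commute e (ρ g)) → e * e = e → e = 0 ∨ e = 1)
    (φ : Module.End k N) (hφ : ∀ g, Commute φ (ρ g)) : IsNilpotent φ ∨ IsUnit φ := by
  obtain ⟨t, ht, h⟩ := exists_idem φ
  rcases hid (φ ^ t) (fun g => (hφ g).pow_left t) h with h | h
  · exact Or.inl ⟨t, h⟩
  · exact Or.inr (IsUnit.of_pow_eq_one h (by omega))

def Jn [Finite (Module.End k N)] [Nontrivial N] (ρ : G →* Module.End k N)
    (hid : ∀ e : Module.End k N, (∀ g, Commute e (ρ g)) → e * e = e → e = 0 ∨ e = 1) :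
    Submodule k (Module.End k N) where
  carrier := {φ | (∀ g, Commute φ (ρ g)) ∧ ¬ IsUnit φ}
  zero_mem' := ⟨fun g => Commute.zero_left _, not_isUnit_zero⟩
  add_mem' := by
    rintro φ ψ ⟨h1, h2⟩ ⟨h3, h4⟩
    refine ⟨fun g => (h1 g).add_left (h3 g), ?_⟩
    rintro ⟨u, hu⟩
    have hc : ∀ g, Commute (↑u⁻¹ : Module.End k N) (ρ g) := fun g =>
      Commute.units_inv_left (by rw [hu]; exact (h1 g).add_left (h3 g))
    rcases nil_or_unit ρ hid ((↑u⁻¹ : Module.End k N) * φ) (fun g => (hc g).mul_left (h1 g)) with h | h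
    · have h5 : (↑u⁻¹ : Module.End k N) * ψ = 1 - (↑u⁻¹ : Module.End k N) * φ := by
        rw [eq_sub_iff_add_eq, ← mul_add, add_comm, ← hu, Units.inv_mul]
      have h6 := h.isUnit_one_sub
      rw [← h5] at h6
      exact h4 ((Units.isUnit_units_mul _ _).1 h6)
    · exact h2 ((Units.isUnit_units_mul _ _).1 h)
  smul_mem' := by
    rintro c φ ⟨h1, h2⟩
    refine ⟨fun g => (h1 g).smul_left c, fun h => ?_⟩
    by_cases hc : c = 0
    · subst hc; rw [zero_smul] at h; exact not_isUnit_zero h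
    · apply h2
      have := h.smul (Units.mk0 c hc)⁻¹
      simpa [Units.smul_def, smul_smul, hc] using this

lemma bound [Finite (Module.End k N)] [Nontrivial N] [Module.Finite k N] {W : Type*} [AddCommGroup W] [Module k W]
    {ρ : G →* Module.End k N} {τ : G →* Module.End k W}
    (hid : ∀ e : Module.End k N, (∀ g, Commute e (ρ g)) → e * e = e → e = 0 ∨ e = 1)
    (i : N →ₗ[k] W) (r : W →ₗ[k] N) (hi : ∀ g x, i (ρ g x) = τ g (i x))
    (hr : ∀ g x, r (τ g x) = ρ g (r x)) (hir : ∀ x, r (i x) = x)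
    {m D : ℕ} (h1 : (1 : Matrix (Fin m → Fin 2) (Fin m → Fin 2) k) ∈ Bd k D (Fin m))
    (Φ : W ≃ₗ[k] ((Fin m → Fin 2) → k)) (a : G →* GL (Fin 2) k)
    (hΦ : ∀ g x, Φ (τ g x) = kr (Fin m) (a g).1 *ᵥ (Φ x)) : Module.finrank k N ≤ D := by
  let L : Matrix (Fin m → Fin 2) (Fin m → Fin 2) k →ₗ[k] Module.End k N :=
    { toFun := fun X => r ∘ₗ Φ.symm.toLinearMap ∘ₗ Matrix.toLin' X ∘ₗ Φ.toLinearMap ∘ₗ i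
      map_add' := by intro X Y; ext x; simp [Matrix.add_mulVec]
      map_smul' := by intro c X; ext x; simp [Matrix.smul_mulVec] }
  have hL1 : L 1 = 1 := by ext x; simp [L, hir]
  by_contra hlt
  have hle : Bd k D (Fin m) ≤ (Jn ρ hid).comap L := by
    refine Submodule.span_le.2 ?_
    rintro X ⟨d, hd, σ, f, g, rfl, hfg⟩
    refine ⟨fun γ => ?_, fun hu => ?_⟩
    · have hsymm : ∀ y, Φ.symm (kr (Fin m) (a γ).1 *ᵥ y) = τ γ (Φ.symm y) := by
        intro y; rw [LinearEquiv.symm_apply_eq, hΦ, LinearEquiv.apply_symm_apply]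
      ext x
      have h2 := hfg (a γ)
      simp only [L, LinearMap.coe_mk, AddHom.coe_mk, Module.End.mul_apply, LinearMap.comp_apply,
        LinearEquiv.coe_coe, Matrix.toLin'_apply, hi, hΦ]
      rw [← hr, ← hsymm, Matrix.mulVec_mulVec, Matrix.mulVec_mulVec, Matrix.mul_assoc, ← h2.1,
        ← Matrix.mul_assoc, ← Matrix.mul_assoc, ← h2.2]
    · have hinj : Function.Injective (Matrix.toLin' f ∘ₗ Φ.toLinearMap ∘ₗ i) := by
        have h3 := ((Module.End.isUnit_iff _).1 hu).1
        intro x y hxy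
        apply h3
        have hxy' : f *ᵥ Φ (i x) = f *ᵥ Φ (i y) := by simpa using hxy
        simp only [L, LinearMap.coe_mk, AddHom.coe_mk, LinearMap.comp_apply,
          LinearEquiv.coe_coe, Matrix.toLin'_apply, ← Matrix.mulVec_mulVec, hxy']
      have := LinearMap.finrank_le_finrank_of_injective hinj
      rw [Module.finrank_fin_fun] at this
      omega
  have := hle h1
  rw [Submodule.mem_comap, hL1] at this
  exact this.2 isUnit_one

end lin
end TwoDim

namespace TwoDim
open Matrix AlgebraicModule

section fin
variable {k : Type} [Field k] {G : Type} [Group G]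

lemma tensor_rho (X Y : FDRep k G) (g : G) :
    (X ⊗ Y : FDRep k G).ρ g = TensorProduct.map (X.ρ g) (Y.ρ g) := rfl

lemma kr_snoc {m : ℕ} (A : Matrix (Fin 2) (Fin 2) k) (i j : Fin (m + 1) → Fin 2) :
    kr (Fin (m + 1)) A i j =
      kr (Fin m) A (Fin.init i) (Fin.init j) * A (i (Fin.last m)) (j (Fin.last m)) := by
  simp only [kr, Matrix.of_apply, Fin.prod_univ_castSucc, Fin.init]

lemma basis_one {V : Type*} [AddCommGroup V] [Module k V] (b : Module.Basis (Fin 2) k V) :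
    ∃ B : Module.Basis (Fin 1 → Fin 2) k V, ∀ f : V →ₗ[k] V,
      LinearMap.toMatrix B B f = kr (Fin 1) (LinearMap.toMatrix b b f) := by
  refine ⟨b.reindex (Equiv.funUnique (Fin 1) (Fin 2)).symm, fun f => ?_⟩
  ext i j
  rw [LinearMap.toMatrix_apply, Module.Basis.reindex_apply, Module.Basis.repr_reindex_apply]
  simp [kr, LinearMap.toMatrix_apply]

lemma basis_snoc {V W : Type*} [AddCommGroup V] [Module k V] [AddCommGroup W] [Module k W] {m : ℕ}
    (B : Module.Basis (Fin m → Fin 2) k V) (b : Module.Basis (Fin 2) k W) :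
    ∃ B' : Module.Basis (Fin (m + 1) → Fin 2) k (TensorProduct k V W),
      ∀ (f : V →ₗ[k] V) (h : W →ₗ[k] W),
      LinearMap.toMatrix B B f = kr (Fin m) (LinearMap.toMatrix b b h) →
      LinearMap.toMatrix B' B' (TensorProduct.map f h) =
        kr (Fin (m + 1)) (LinearMap.toMatrix b b h) := by
  let e : (Fin m → Fin 2) × Fin 2 ≃ (Fin (m + 1) → Fin 2) :=
    (Equiv.prodComm _ _).trans (Fin.snocEquiv (fun _ => Fin 2))
  refine ⟨(B.tensorProduct b).reindex e, fun f h hf => ?_⟩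
  have h2 := TensorProduct.toMatrix_map B b B b f h
  ext i j
  rw [kr_snoc, ← hf]
  have h3 := congrFun (congrFun h2 (e.symm i)) (e.symm j)
  rw [Matrix.kroneckerMap_apply] at h3
  refine Eq.trans ?_ h3
  rw [LinearMap.toMatrix_apply, LinearMap.toMatrix_apply, Module.Basis.reindex_apply,
    Module.Basis.repr_reindex_apply]

lemma tensor_basis (M : FDRep k G) (b : Module.Basis (Fin 2) k M) (n : ℕ) :
    ∃ B : Module.Basis (Fin (n + 1) → Fin 2) k (tensorPow M n),
      ∀ g, LinearMap.toMatrix B B ((tensorPow M n).ρ g) =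
        kr (Fin (n + 1)) (LinearMap.toMatrix b b (M.ρ g)) := by
  induction n with
  | zero =>
    obtain ⟨B, hB⟩ := basis_one b
    exact ⟨B, fun g => hB (M.ρ g)⟩
  | succ n ih =>
    obtain ⟨B, hB⟩ := ih
    obtain ⟨B', hB'⟩ := basis_snoc B b
    exact ⟨B', fun g => hB' _ _ (hB g)⟩

noncomputable def mkHom {X Y : FDRep k G} (f : X →ₗ[k] Y) (hf : ∀ g x, f (X.ρ g x) = Y.ρ g (f x)) : X ⟶ Y :=
  ⟨InducedCategory.homMk (ModuleCat.ofHom f), fun g => by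
    ext x; exact hf g x⟩

noncomputable def mkEnd {X Y : FDRep k G} (f : X ⟶ Y) : X →ₗ[k] Y := f.hom.hom.hom

lemma mkEnd_comm {X Y : FDRep k G} (f : X ⟶ Y) (g : G) (x : X) :
    mkEnd f (X.ρ g x) = Y.ρ g (mkEnd f x) :=
  ConcreteCategory.congr_hom ((forget (FGModuleCat k)).congr_map (f.comm g)) x

lemma hom_ext' {X Y : FDRep k G} {f f' : X ⟶ Y} (h : mkEnd f = mkEnd f') : f = f' := by
  apply Action.Hom.ext
  ext x
  exact LinearMap.congr_fun h x

noncomputable def mkIso' {X Y : FDRep k G} (f : X ≃ₗ[k] Y) (hf : ∀ g x, f (X.ρ g x) = Y.ρ g (f x)) : X ≅ Y where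
  hom := mkHom f.toLinearMap hf
  inv := mkHom f.symm.toLinearMap (fun g x => by
    rw [LinearEquiv.coe_coe, LinearEquiv.symm_apply_eq, hf, LinearEquiv.apply_symm_apply])
  hom_inv_id := hom_ext' (LinearMap.ext fun x => f.symm_apply_apply x)
  inv_hom_id := hom_ext' (LinearMap.ext fun x => f.apply_symm_apply x)

noncomputable def matRep {d : ℕ} (φ : G →* Matrix (Fin d) (Fin d) k) : FDRep k G :=
  FDRep.of (V := Fin d → k) ((Matrix.toLinAlgEquiv' (R := k) (n := Fin d)).toMonoidHom.comp φ)

lemma iso_matRep (N : FDRep k G) : ∃ φ : G →* Matrix (Fin (Module.finrank k N)) (Fin (Module.finrank k N)) k,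
    Nonempty (N ≅ matRep φ) := by
  let b := Module.finBasis k N
  refine ⟨(LinearMap.toMatrixAlgEquiv b).toMonoidHom.comp N.ρ, ⟨mkIso' b.equivFun fun g x => ?_⟩⟩
  exact (LinearMap.toMatrix_mulVec_repr b b (N.ρ g) x).symm

lemma exists_list [Finite k] [Finite G] (D : ℕ) : ∃ L : List (FDRep k G), ∀ N : FDRep k G,
    Module.finrank k N ≤ D → ∃ N' ∈ L, Nonempty (N ≅ N') := by
  classical
  have : Finite ((d : Fin (D + 1)) × (G →* Matrix (Fin d) (Fin d) k)) := by
    have : ∀ d : Fin (D + 1), Finite (G →* Matrix (Fin d) (Fin d) k) := fun d =>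
      Finite.of_injective (fun f => (f : G → Matrix (Fin d) (Fin d) k)) DFunLike.coe_injective
    infer_instance
  cases nonempty_fintype ((d : Fin (D + 1)) × (G →* Matrix (Fin d) (Fin d) k))
  refine ⟨(Finset.univ : Finset ((d : Fin (D + 1)) × (G →* Matrix (Fin d) (Fin d) k))).toList.map
    (fun x => matRep x.2), fun N hN => ?_⟩
  obtain ⟨φ, hφ⟩ := iso_matRep N
  refine ⟨matRep φ, ?_, hφ⟩
  rw [List.mem_map]
  exact ⟨⟨⟨Module.finrank k N, by omega⟩, φ⟩, by simp, rfl⟩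

end fin
end TwoDim

open AlgebraicModule

/-- Every `2`-dimensional module over a finite field `k` of characteristic `p`
for a finite group `G` is algebraic. -/
theorem two_dimensional_algebraic (p : ℕ) (hp : p.Prime)
    (k : Type) [Field k] [Fintype k] (hk : CharP k p)
    (G : Type) [Group G] [Finite G] (M : FDRep k G)
    (hM : Module.finrank k M = 2) : IsAlgebraic M := by
  classical
  have := Fact.mk hp
  obtain ⟨D, hD⟩ := TwoDim.Bd_all (k := k) p
  obtain ⟨L, hL⟩ := TwoDim.exists_list (k := k) (G := G) D
  refine ⟨L, fun N hN hS => hL N ?_⟩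
  obtain ⟨n, i, r, hir⟩ := hS
  let b : Module.Basis (Fin 2) k M := Module.finBasisOfFinrankEq k M hM
  obtain ⟨B, hB⟩ := TwoDim.tensor_basis M b n
  let a : G →* Matrix.GeneralLinearGroup (Fin 2) k :=
    ((LinearMap.toMatrixAlgEquiv b).toMonoidHom.comp M.ρ).toHomUnits
  have hid : ∀ e : Module.End k N, (∀ g, Commute e (N.ρ g)) → e * e = e → e = 0 ∨ e = 1 := by
    intro e he hee
    rcases hN.2 (TwoDim.mkHom e fun g x => LinearMap.congr_fun (he g) x)
      (TwoDim.hom_ext' hee) with h | h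
    · left; exact congrArg TwoDim.mkEnd h
    · right; exact congrArg TwoDim.mkEnd h
  have : Nontrivial N := by
    by_contra hnt
    have := not_nontrivial_iff_subsingleton.1 hnt
    apply hN.1
    rw [Limits.IsZero.iff_id_eq_zero]
    apply TwoDim.hom_ext'
    ext x
    exact Subsingleton.elim _ _
  have : Finite N := Module.finite_of_finite k
  have : Finite (Module.End k N) :=
    Finite.of_injective (fun f => (f : N → N)) DFunLike.coe_injective
  refine TwoDim.bound (ρ := N.ρ) (τ := (tensorPow M n).ρ) hid (TwoDim.mkEnd i) (TwoDim.mkEnd r)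
    (TwoDim.mkEnd_comm i) (TwoDim.mkEnd_comm r)
    (fun x => LinearMap.congr_fun (congrArg TwoDim.mkEnd hir) x) (hD (n + 1)) B.equivFun a
    (fun g x => ?_)
  have h : (a g).1 = LinearMap.toMatrix b b (M.ρ g) := rfl
  rw [h, ← hB]
  exact (LinearMap.toMatrix_mulVec_repr B B ((tensorPow M n).ρ g) x).symm
end

section
/- Let G be a finite group, k a field of characteristic p, and M an indecomposable kG-module. If M ⊗ M is isomorphic to M ⊕ X for some algebraic kG-module X, then M is algebraic. -/
open CategoryTheory CategoryTheory.MonoidalCategory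

open AlgebraicModule

noncomputable instance {k G : Type} [Field k] [Group G] :
    Limits.HasBinaryBiproducts (FDRep k G) :=
  Limits.HasBinaryBiproducts.of_hasBinaryProducts

namespace AlgebraicModule

section aux
variable {k G : Type} [Field k] [Group G]

/-- Closure of a class of objects under finite sums and retracts. -/
inductive AddC (P : FDRep k G → Prop) : FDRep k G → Prop
  | of (A : FDRep k G) : P A → AddC P A
  | zero (A : FDRep k G) : Limits.IsZero A → AddC P A
  | split (A B C : FDRep k G) (f₁ : A ⟶ B) (g₁ : B ⟶ A) (f₂ : A ⟶ C) (g₂ : C ⟶ A) :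
      f₁ ≫ g₁ + f₂ ≫ g₂ = 𝟙 A → AddC P B → AddC P C → AddC P A

theorem AddC.retract {P : FDRep k G → Prop} {A B : FDRep k G} (h : IsSummand A B)
    (hB : AddC P B) : AddC P A := by
  obtain ⟨i, r, h⟩ := h
  exact AddC.split A B B i r 0 0 (by simp [h]) hB hB

theorem AddC.bind {P Q : FDRep k G → Prop} {A : FDRep k G} (hA : AddC P A)
    (h : ∀ B, P B → AddC Q B) : AddC Q A := by
  induction hA with
  | of A hA => exact h A hA
  | zero A hA => exact AddC.zero A hA
  | split A B C f₁ g₁ f₂ g₂ e _ _ ihB ihC => exact AddC.split A B C f₁ g₁ f₂ g₂ e ihB ihC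

theorem AddC.tensorRight {P Q : FDRep k G → Prop} {A : FDRep k G} (M : FDRep k G)
    (hA : AddC P A) (h : ∀ B, P B → AddC Q (B ⊗ M)) : AddC Q (A ⊗ M) := by
  induction hA with
  | of A hA => exact h A hA
  | zero A hA =>
    refine AddC.zero _ ?_
    rw [Limits.IsZero.iff_id_eq_zero] at hA ⊢
    rw [← id_whiskerRight, hA, MonoidalPreadditive.zero_whiskerRight]
  | split A B C f₁ g₁ f₂ g₂ e _ _ ihB ihC =>
    refine AddC.split _ _ _ (f₁ ▷ M) (g₁ ▷ M) (f₂ ▷ M) (g₂ ▷ M) ?_ ihB ihC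
    rw [← comp_whiskerRight, ← comp_whiskerRight, ← MonoidalPreadditive.add_whiskerRight, e,
      id_whiskerRight]

theorem isUnit_or_nilp {R : Type*} [Ring R] [Algebra k R] [Module.Finite k R]
    (hR : ∀ e : R, e * e = e → e = 0 ∨ e = 1) (x : R) : IsUnit x ∨ IsNilpotent x := by
  have hint : IsIntegral k x := Algebra.IsIntegral.isIntegral x
  have hne := minpoly.ne_zero hint
  obtain ⟨q, hq, hq0⟩ := Polynomial.exists_eq_pow_rootMultiplicity_mul_and_not_dvd
    (minpoly k x) hne 0
  rw [Polynomial.C_0, sub_zero] at hq hq0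
  set n := (minpoly k x).rootMultiplicity 0
  have hcop : IsCoprime (Polynomial.X ^ n : Polynomial k) q :=
    IsCoprime.pow_left ((Polynomial.irreducible_X.coprime_iff_not_dvd).2 hq0)
  obtain ⟨a, b, hab⟩ := hcop
  have h0 : x ^ n * Polynomial.aeval x q = 0 := by
    have := minpoly.aeval k x
    rw [hq] at this
    simpa using this
  have h1 : Polynomial.aeval x a * x ^ n + Polynomial.aeval x b * Polynomial.aeval x q = 1 := by
    have := congrArg (Polynomial.aeval x) hab
    simpa using this
  have c1 : ∀ f g : Polynomial k, Polynomial.aeval x f * Polynomial.aeval x g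
      = Polynomial.aeval x g * Polynomial.aeval x f := fun f g => by
    rw [← map_mul, mul_comm, map_mul]
  have cx : ∀ f : Polynomial k, x ^ n * Polynomial.aeval x f
      = Polynomial.aeval x f * x ^ n := fun f => by
    simpa using c1 (Polynomial.X ^ n) f
  have hid : (Polynomial.aeval x a * x ^ n) * (Polynomial.aeval x a * x ^ n)
      = Polynomial.aeval x a * x ^ n := by
    conv_rhs => rw [← mul_one (Polynomial.aeval x a * x ^ n), ← h1]
    rw [mul_add, mul_assoc (Polynomial.aeval x a) (x ^ n) (Polynomial.aeval x b * _),
      c1 b q, ← mul_assoc (x ^ n) (Polynomial.aeval x q), h0]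
    simp
  rcases hR _ hid with h | h
  · right
    refine ⟨n, ?_⟩
    rw [h, zero_add] at h1
    rw [← mul_one (x ^ n), ← h1, c1 b q, ← mul_assoc, h0, zero_mul]
  · rcases Nat.eq_zero_or_pos n with hn | hn
    · left
      rw [hn, pow_zero, one_mul] at h0
      have hz : minpoly k x = q := by rw [hq, hn]; simp
      have hc : Polynomial.aeval x (Polynomial.X * q.divX + Polynomial.C (q.coeff 0)) = 0 := by
        rw [Polynomial.X_mul_divX_add, h0]
      have hq0' : q.coeff 0 ≠ 0 := fun hh => hq0 (Polynomial.X_dvd_iff.2 hh)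
      have hd : x * Polynomial.aeval x q.divX = - algebraMap k R (q.coeff 0) := by
        rw [eq_neg_iff_add_eq_zero]
        rwa [map_add, map_mul, Polynomial.aeval_X, Polynomial.aeval_C] at hc
      have hd' : Polynomial.aeval x q.divX * x = - algebraMap k R (q.coeff 0) := by
        rw [← hd]; simpa using (c1 q.divX Polynomial.X)
      have hu : IsUnit (- algebraMap k R (q.coeff 0)) :=
        ((IsUnit.mk0 _ hq0').map (algebraMap k R)).neg
      have : Commute x (Polynomial.aeval x q.divX) := by rw [Commute, SemiconjBy, hd, hd']
      exact (this.isUnit_mul_iff.1 (hd ▸ hu)).1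
    · left
      have : Commute (Polynomial.aeval x a) (x ^ n) := (cx a).symm
      have := (this.isUnit_mul_iff.1 (h ▸ isUnit_one)).2
      exact (isUnit_pow_iff hn.ne').1 this

theorem summand_trans_unit {N A : FDRep k G} (i : N ⟶ A) (r : A ⟶ N)
    (h : IsUnit (M := End N) (i ≫ r)) : IsSummand N A := by
  obtain ⟨u, hu⟩ := h
  refine ⟨i, r ≫ (u⁻¹ : (End N)ˣ).val, ?_⟩
  have : (u⁻¹ : (End N)ˣ).val * u.val = 1 := u.inv_mul
  rw [hu] at this
  rw [← Category.assoc]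
  exact this

theorem AddC.exists_summand {P : FDRep k G → Prop} {A : FDRep k G} (hA : AddC P A) :
    ∀ N : FDRep k G, Indecomposable N → IsSummand N A → ∃ B, P B ∧ IsSummand N B := by
  induction hA with
  | of A hA => exact fun N _ h => ⟨A, hA, h⟩
  | zero A hA =>
    rintro N hN ⟨i, r, h⟩
    exfalso
    apply hN.1
    rw [Limits.IsZero.iff_id_eq_zero, ← h, hA.eq_zero_of_tgt i, Limits.zero_comp]
  | split A B C f₁ g₁ f₂ g₂ e _ _ ihB ihC =>
    rintro N hN ⟨i, r, h⟩
    have hR : ∀ e : End N, e * e = e → e = 0 ∨ e = 1 := fun e he => hN.2 e he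
    have : Module.Finite k (End N) := inferInstanceAs (Module.Finite k (N ⟶ N))
    have hsum : (i ≫ f₁) ≫ (g₁ ≫ r) + (i ≫ f₂) ≫ (g₂ ≫ r) = 𝟙 N := by
      have : i ≫ (f₁ ≫ g₁ + f₂ ≫ g₂) ≫ r = 𝟙 N := by rw [e, Category.id_comp, h]
      simpa using this
    rcases isUnit_or_nilp (k := k) hR ((i ≫ f₁) ≫ (g₁ ≫ r) : N ⟶ N) with hu | hn
    · exact ihB N hN (summand_trans_unit _ _ hu)
    · have := hn.isUnit_one_sub
      refine ihC N hN (summand_trans_unit (i ≫ f₂) (g₂ ≫ r) ?_)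
      have hs : (i ≫ f₂) ≫ (g₂ ≫ r) = 𝟙 N - (i ≫ f₁) ≫ (g₁ ≫ r) := eq_sub_of_add_eq' hsum
      rw [hs]
      exact this

theorem summand_indec_iso {N A : FDRep k G} (hN : Indecomposable N) (hA : Indecomposable A)
    (h : IsSummand N A) : Nonempty (N ≅ A) := by
  obtain ⟨i, r, h⟩ := h
  rcases hA.2 (r ≫ i) (by simp [reassoc_of% h]) with h0 | h1
  · exfalso
    apply hN.1
    rw [Limits.IsZero.iff_id_eq_zero, ← h, ← Category.id_comp i, ← h]
    simp [h0]
  · exact ⟨⟨i, r, h, h1⟩⟩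

theorem IsSummand.trans {A B C : FDRep k G} (h : IsSummand A B) (h' : IsSummand B C) :
    IsSummand A C := by
  obtain ⟨i, r, h⟩ := h
  obtain ⟨i', r', h'⟩ := h'
  exact ⟨i ≫ i', r' ≫ r, by simp [reassoc_of% h', h]⟩

theorem finrank_lt {A Y : FDRep k G} (i : Y ⟶ A) (r : A ⟶ Y) (h : i ≫ r = 𝟙 Y)
    (h1 : r ≫ i ≠ 𝟙 A) : Module.finrank k (Y ⟶ Y) < Module.finrank k (A ⟶ A) := by
  let φ : (Y ⟶ Y) →ₗ[k] (A ⟶ A) :=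
    { toFun := fun f => r ≫ f ≫ i
      map_add' := by intros; simp
      map_smul' := by intros; simp }
  have hinj : Function.Injective φ := by
    intro f g hfg
    have hfg : r ≫ f ≫ i = r ≫ g ≫ i := hfg
    have := congrArg (fun t => i ≫ t ≫ r) hfg
    simpa [h, reassoc_of% h] using this
  refine lt_of_le_of_ne (LinearMap.finrank_le_finrank_of_injective hinj) fun heq => h1 ?_
  have hs : Function.Surjective φ :=
    (LinearMap.injective_iff_surjective_of_finrank_eq_finrank heq).1 hinj
  obtain ⟨f, hf⟩ := hs (𝟙 A)
  have hf : r ≫ f ≫ i = 𝟙 A := hf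
  calc r ≫ i = (r ≫ f ≫ i) ≫ r ≫ i := by rw [hf, Category.id_comp]
    _ = r ≫ f ≫ i := by simp [reassoc_of% h]
    _ = _ := hf

theorem decompose (n : ℕ) : ∀ A : FDRep k G, Module.finrank k (A ⟶ A) = n →
    ∃ L : List (FDRep k G), (∀ B ∈ L, Indecomposable B ∧ IsSummand B A) ∧ AddC (· ∈ L) A := by
  induction n using Nat.strong_induction_on with
  | _ n ih =>
    intro A hn
    by_cases hz : Limits.IsZero A
    · exact ⟨[], by simp, AddC.zero A hz⟩
    by_cases hI : Indecomposable A
    · exact ⟨[A], by simpa using ⟨hI, 𝟙 A, 𝟙 A, by simp⟩, AddC.of A (by simp)⟩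
    have : ∃ e : A ⟶ A, e ≫ e = e ∧ e ≠ 0 ∧ e ≠ 𝟙 A := by
      by_contra! hc
      exact hI ⟨hz, fun e he => or_iff_not_imp_left.2 (hc e he)⟩
    obtain ⟨e, he, h0, h1⟩ := this
    obtain ⟨B, i, r, hir, hri⟩ := IsIdempotentComplete.idempotents_split A e he
    obtain ⟨C, j, s, hjs, hsj⟩ := IsIdempotentComplete.idempotents_split A (𝟙 A - e)
      (by simp [he])
    obtain ⟨L₁, hL₁, hB⟩ := ih _ (hn ▸ finrank_lt i r hir (by rw [hri]; exact h1)) B rfl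
    obtain ⟨L₂, hL₂, hC⟩ := ih _ (hn ▸ finrank_lt j s hjs
      (by rw [hsj]; intro hh; exact h0 (by simpa using hh))) C rfl
    refine ⟨L₁ ++ L₂, ?_, AddC.split A B C r i s j (by rw [hri, hsj]; simp)
      (hB.bind fun D hD => AddC.of D (List.mem_append_left _ hD))
      (hC.bind fun D hD => AddC.of D (List.mem_append_right _ hD))⟩
    intro D hD
    rcases List.mem_append.1 hD with hD | hD
    · exact ⟨(hL₁ D hD).1, (hL₁ D hD).2.trans ⟨i, r, hir⟩⟩
    · exact ⟨(hL₂ D hD).1, (hL₂ D hD).2.trans ⟨j, s, hjs⟩⟩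

theorem decompose_list (L : List (FDRep k G)) : ∃ L' : List (FDRep k G),
    (∀ B ∈ L', Indecomposable B) ∧ ∀ A ∈ L, AddC (· ∈ L') A := by
  induction L with
  | nil => exact ⟨[], by simp, by simp⟩
  | cons A L ih =>
    obtain ⟨L₁, h₁, h₁'⟩ := ih
    obtain ⟨L₂, h₂, h₂'⟩ := decompose _ A rfl
    refine ⟨L₁ ++ L₂, ?_, ?_⟩
    · intro B hB
      rcases List.mem_append.1 hB with hB | hB
      · exact h₁ B hB
      · exact (h₂ B hB).1
    · intro B hB
      rcases List.mem_cons.1 hB with rfl | hB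
      · exact h₂'.bind fun D hD => AddC.of D (List.mem_append_right _ hD)
      · exact (h₁' B hB).bind fun D hD => AddC.of D (List.mem_append_left _ hD)

end aux

end AlgebraicModule

/-- If `M` is indecomposable and `M ⊗ M ≅ M ⊕ X` with `X` algebraic, then `M` is
algebraic. -/
theorem algebraic_of_tensor_square_eq_self_add (p : ℕ) (k : Type) [Field k] (hk : CharP k p)
    (G : Type) [Group G] [Finite G] (M X : FDRep k G)
    (hM : AlgebraicModule.Indecomposable M) (hX : IsAlgebraic X)
    (h : Nonempty (M ⊗ M ≅ M ⊞ X)) : IsAlgebraic M := by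
  obtain ⟨φ⟩ := h
  obtain ⟨L, hL⟩ := hX
  have hXpow : ∀ j, AddC (· ∈ L) (tensorPow X j) := by
    intro j
    obtain ⟨L₀, h₀, h₀'⟩ := decompose _ (tensorPow X j) rfl
    refine h₀'.bind fun B hB => ?_
    obtain ⟨N', hN', ⟨ψ⟩⟩ := hL B (h₀ B hB).1 ⟨j, (h₀ B hB).2⟩
    exact AddC.retract ⟨ψ.hom, ψ.inv, ψ.hom_inv_id⟩ (AddC.of N' hN')
  -- the tensor powers of `M` lie in the additive closure of `M`, `X^j`, `X^j ⊗ M`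
  let Q : FDRep k G → Prop := fun B =>
    B = M ∨ ∃ j, B = tensorPow X j ∨ B = tensorPow X j ⊗ M
  have hφ : (φ.hom ≫ Limits.biprod.fst) ≫ (Limits.biprod.inl ≫ φ.inv) +
      (φ.hom ≫ Limits.biprod.snd) ≫ (Limits.biprod.inr ≫ φ.inv) = 𝟙 (M ⊗ M) := by
    have : φ.hom ≫ (Limits.biprod.fst ≫ Limits.biprod.inl +
      Limits.biprod.snd ≫ Limits.biprod.inr) ≫ φ.inv = 𝟙 (M ⊗ M) := by
      rw [Limits.biprod.total, Category.id_comp, φ.hom_inv_id]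
    rw [Preadditive.add_comp, Preadditive.comp_add] at this
    simpa only [Category.assoc] using this
  have hMpow : ∀ n, AddC Q (tensorPow M n) := by
    intro n
    induction n with
    | zero => exact AddC.of _ (Or.inl rfl)
    | succ n ih =>
      refine AddC.tensorRight M ih ?_
      rintro B (rfl | ⟨j, rfl | rfl⟩)
      · exact AddC.split _ _ _ _ _ _ _ hφ (AddC.of _ (Or.inl rfl))
          (AddC.of _ (Or.inr ⟨0, Or.inl rfl⟩))
      · exact AddC.of _ (Or.inr ⟨j, Or.inr rfl⟩)
      · refine AddC.retract ⟨(α_ _ _ _).hom, (α_ _ _ _).inv, (α_ _ _ _).hom_inv_id⟩ ?_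
        have e := congrArg (fun t => tensorPow X j ◁ t) hφ
        simp only [MonoidalPreadditive.whiskerLeft_add] at e
        rw [MonoidalCategory.whiskerLeft_comp, MonoidalCategory.whiskerLeft_comp _
          (φ.hom ≫ Limits.biprod.snd), MonoidalCategory.whiskerLeft_id] at e
        exact AddC.split _ _ _ _ _ _ _ e (AddC.of _ (Or.inr ⟨j, Or.inr rfl⟩))
          (AddC.of _ (Or.inr ⟨j + 1, Or.inl rfl⟩))
  obtain ⟨L', hL', hL''⟩ := decompose_list (M :: (L ++ L.map (fun B => B ⊗ M)))
  refine ⟨L', ?_⟩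
  rintro N hN ⟨n, hn⟩
  have key : AddC (· ∈ L') (tensorPow M n) := by
    refine (hMpow n).bind ?_
    rintro B (rfl | ⟨j, rfl | rfl⟩)
    · exact hL'' _ (by simp)
    · exact (hXpow j).bind fun D hD => hL'' _ (by simp [hD])
    · refine AddC.tensorRight M (hXpow j) fun D hD => hL'' _ ?_
      exact List.mem_cons_of_mem _ (List.mem_append_right _ (List.mem_map.2 ⟨D, hD, rfl⟩))
  obtain ⟨B, hB, hNB⟩ := key.exists_summand N hN hn
  exact ⟨B, hB, summand_indec_iso hN (hL' B hB) hNB⟩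
end

section
/- Let q be a power of a prime p, let n ≥ 3, let k be the field with q elements, and let G = SL_n(q) act on the natural module M = k^n by matrix multiplication. Then M is a non-algebraic kG-module. -/
open CategoryTheory CategoryTheory.MonoidalCategory

open AlgebraicModule

namespace NatSL

open Polynomial TensorProduct

section Lin
variable {k : Type} [Field k]

/-- The operator `(g - 1) + t (h - 1)` on `V[t]`. -/
noncomputable def theta {V : Type} [AddCommGroup V] [Module k V] (g h : V →ₗ[k] V) :
    (k[X] ⊗[k] V) →ₗ[k[X]] (k[X] ⊗[k] V) :=
  (g - LinearMap.id).baseChange k[X] + (X : k[X]) • (h - LinearMap.id).baseChange k[X]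

/-- Extension of a functional to `V[t]`. -/
noncomputable def ev {V : Type} [AddCommGroup V] [Module k V] (f : V →ₗ[k] k) :
    (k[X] ⊗[k] V) →ₗ[k[X]] k[X] :=
  (TensorProduct.AlgebraTensorModule.rid k k[X] k[X]).toLinearMap ∘ₗ f.baseChange k[X]

/-- formal derivative -/
noncomputable def der (V : Type) [AddCommGroup V] [Module k V] :
    (k[X] ⊗[k] V) →ₗ[k] (k[X] ⊗[k] V) :=
  LinearMap.rTensor V (Polynomial.derivative (R := k))

variable {V W : Type} [AddCommGroup V] [Module k V] [AddCommGroup W] [Module k W]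

@[simp] lemma ev_tmul (f : V →ₗ[k] k) (p : k[X]) (v : V) : ev f (p ⊗ₜ v) = f v • p := by
  simp [ev]

@[simp] lemma theta_tmul (g h : V →ₗ[k] V) (p : k[X]) (v : V) :
    theta g h (p ⊗ₜ v) = p ⊗ₜ[k] (g v - v) + (X * p) ⊗ₜ[k] (h v - v) := by
  simp [theta, smul_tmul', tmul_sub, smul_sub]

@[simp] lemma der_tmul (p : k[X]) (v : V) :
    der V (p ⊗ₜ[k] v) = (derivative p) ⊗ₜ[k] v := by
  simp [der]

lemma der_theta (g h : V →ₗ[k] V) (w : k[X] ⊗[k] V) :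
    der V (theta g h w) = theta g h (der V w) + (h - LinearMap.id).baseChange k[X] w := by
  induction w with
  | zero => simp
  | add x y hx hy => simp only [map_add, hx, hy]; abel
  | tmul p v => simp [add_tmul, tmul_sub]; abel

lemma ev_baseChange (f : W →ₗ[k] k) (i : V →ₗ[k] W) (w : k[X] ⊗[k] V) :
    ev f (i.baseChange k[X] w) = ev (f ∘ₗ i) w := by
  induction w with
  | zero => simp
  | add x y hx hy => simp only [map_add, hx, hy]
  | tmul p v => simp

lemma theta_baseChange {g h : V →ₗ[k] V} {g' h' : W →ₗ[k] W} (i : V →ₗ[k] W)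
    (hg : ∀ v, i (g v) = g' (i v)) (hh : ∀ v, i (h v) = h' (i v)) (w : k[X] ⊗[k] V) :
    theta g' h' (i.baseChange k[X] w) = i.baseChange k[X] (theta g h w) := by
  induction w with
  | zero => simp
  | add x y hx hy => simp only [map_add, hx, hy]
  | tmul p v => simp [hg, hh]

lemma ev_bound (w : k[X] ⊗[k] V) : ∃ D : ℕ, ∀ f : V →ₗ[k] k, (ev f w).natDegree ≤ D := by
  induction w with
  | zero => exact ⟨0, by simp⟩
  | add x y hx hy =>
    obtain ⟨a, ha⟩ := hx
    obtain ⟨b, hb⟩ := hy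
    refine ⟨max a b, fun f => ?_⟩
    rw [map_add]
    exact (natDegree_add_le _ _).trans (max_le_max (ha f) (hb f))
  | tmul p v =>
    refine ⟨p.natDegree, fun f => ?_⟩
    rw [ev_tmul]
    exact natDegree_smul_le _ _

/-- Low degree kernel elements. -/
def low (g h : V →ₗ[k] V) (D : ℕ) : Set (k[X] ⊗[k] V) :=
  {z | theta g h z = 0 ∧ ∀ f : V →ₗ[k] k, (ev f z).natDegree ≤ D}

/-- The kernel of `theta` is generated in degree at most `D`. -/
def Good (g h : V →ₗ[k] V) (D : ℕ) : Prop :=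
  ∀ w, theta g h w = 0 → w ∈ Submodule.span k[X] (low g h D)

lemma Good.mono {g h : V →ₗ[k] V} {D D' : ℕ} (H : Good g h D) (hD : D ≤ D') : Good g h D' :=
  have hs : low g h D ⊆ low g h D' := fun _ hz => ⟨hz.1, fun f => (hz.2 f).trans hD⟩
  fun w hw => Submodule.span_mono hs (H w hw)

lemma exists_good [Module.Finite k V] (g h : V →ₗ[k] V) : ∃ D, Good g h D := by
  have : (LinearMap.ker (theta g h)).FG := IsNoetherian.noetherian _
  obtain ⟨S, hS⟩ := this
  choose D hD using fun w : k[X] ⊗[k] V => ev_bound w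
  refine ⟨S.sup D, fun w hw => ?_⟩
  have hw' : w ∈ Submodule.span k[X] (S : Set (k[X] ⊗[k] V)) := by rw [hS]; exact hw
  have hs : (S : Set (k[X] ⊗[k] V)) ⊆ low g h (S.sup D) := by
    intro z hz
    refine ⟨?_, fun f => (hD z f).trans (Finset.le_sup (f := D) hz)⟩
    have : z ∈ LinearMap.ker (theta g h) := by rw [← hS]; exact Submodule.subset_span hz
    exact this
  exact Submodule.span_mono hs hw'

lemma map_span_low {g h : V →ₗ[k] V} {g' h' : W →ₗ[k] W} (i : V →ₗ[k] W)
    (hg : ∀ v, i (g v) = g' (i v)) (hh : ∀ v, i (h v) = h' (i v)) {D : ℕ} {w : k[X] ⊗[k] V}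
    (hw : w ∈ Submodule.span k[X] (low g h D)) :
    i.baseChange k[X] w ∈ Submodule.span k[X] (low g' h' D) := by
  have h1 := Submodule.mem_map_of_mem (f := i.baseChange k[X]) hw
  rw [Submodule.map_span] at h1
  refine Submodule.span_mono ?_ h1
  rintro _ ⟨z, hz, rfl⟩
  refine ⟨by rw [theta_baseChange i hg hh, hz.1, map_zero], fun f => ?_⟩
  rw [ev_baseChange]
  exact hz.2 _

/-- invariant functional -/
def Inv (g h : V →ₗ[k] V) (f : V →ₗ[k] k) : Prop := (∀ v, f (g v) = f v) ∧ ∀ v, f (h v) = f v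

/-- Chains of linked invariant functionals. -/
inductive Ch (g h : V →ₗ[k] V) : ℕ → (V →ₗ[k] k) → (V →ₗ[k] k) → Prop
  | refl (f) : Inv g h f → Ch g h 0 f f
  | step (m : ℕ) (f f' f'' c : V →ₗ[k] k) : Ch g h m f f' → Inv g h f'' →
      (∀ v, c (g v) = c v + f'' v) → (∀ v, c (h v) = c v + f' v) → Ch g h (m + 1) f f''

lemma Ch.inv {g h : V →ₗ[k] V} {m f f'} (H : Ch g h m f f') : Inv g h f' := by
  cases H <;> assumption

lemma link {g h : V →ₗ[k] V} {f' f'' c : V →ₗ[k] k}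
    (h1 : ∀ v, c (g v) = c v + f'' v) (h2 : ∀ v, c (h v) = c v + f' v) (w : k[X] ⊗[k] V) :
    ev c (theta g h w) = ev f'' w + X * ev f' w := by
  induction w with
  | zero => simp
  | add x y hx hy => simp only [map_add, hx, hy]; ring
  | tmul p v => simp [h1, h2]

lemma Ch.ev_eq {g h : V →ₗ[k] V} {m f f'} (H : Ch g h m f f') {w : k[X] ⊗[k] V}
    (hw : theta g h w = 0) : ev f' w = (-X) ^ m * ev f w := by
  induction H with
  | refl f _ => simp
  | step m f f' f'' c _ _ h1 h2 ih =>
    have := link h1 h2 w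
    rw [hw, map_zero, ih] at this
    rw [pow_succ]
    linear_combination -this

/-- product functional -/
noncomputable def prd (f : V →ₗ[k] k) (e : W →ₗ[k] k) : V ⊗[k] W →ₗ[k] k :=
  LinearMap.mul' k k ∘ₗ TensorProduct.map f e

@[simp] lemma prd_tmul (f : V →ₗ[k] k) (e : W →ₗ[k] k) (v : V) (w : W) :
    prd f e (v ⊗ₜ w) = f v * e w := by simp [prd]

lemma ext_tens {f : V ⊗[k] W → k} {f' : V ⊗[k] W → k}
    (ha : ∀ x y, f (x + y) = f x + f y) (ha' : ∀ x y, f' (x + y) = f' x + f' y)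
    (h : ∀ v w, f (v ⊗ₜ w) = f' (v ⊗ₜ w)) (x : V ⊗[k] W) : f x = f' x := by
  induction x with
  | zero => simpa using h 0 0
  | add x y hx hy => rw [ha, ha', hx, hy]
  | tmul v w => exact h v w

lemma Inv.prd {g h : V →ₗ[k] V} {g' h' : W →ₗ[k] W} {f e} (hf : Inv g h f) (he : Inv g' h' e) :
    Inv (TensorProduct.map g g') (TensorProduct.map h h') (prd f e) := by
  constructor <;> refine ext_tens (by simp) (by simp) fun v w => ?_
  · simp [hf.1, he.1]
  · simp [hf.2, he.2]

lemma Ch.prd {g h : V →ₗ[k] V} {g' h' : W →ₗ[k] W} {m f f' e} (H : Ch g h m f f')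
    (he : Inv g' h' e) :
    Ch (TensorProduct.map g g') (TensorProduct.map h h') m (NatSL.prd f e) (NatSL.prd f' e) := by
  induction H with
  | refl f hf => exact .refl _ (hf.prd he)
  | step m f f' f'' c _ hi h1 h2 ih =>
    refine .step m _ _ _ (NatSL.prd c e) ih (hi.prd he) ?_ ?_
    · refine ext_tens (by simp) (by intros; simp; ring) fun v w => ?_
      simp [h1, he.1]; ring
    · refine ext_tens (by simp) (by intros; simp; ring) fun v w => ?_
      simp [h2, he.2]; ring

/-- The data obstructing generation in degree `< m`. -/
def Obs (g h : V →ₗ[k] V) (m : ℕ) : Prop :=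
  ∃ (w : k[X] ⊗[k] V) (f f' : V →ₗ[k] k), theta g h w = 0 ∧ Ch g h m f f' ∧ ev f w = 1

lemma Obs.not_good {g h : V →ₗ[k] V} {m D : ℕ} (H : Obs g h m) (hD : D < m) : ¬ Good g h D := by
  obtain ⟨w, f, f', hw, hc, h1⟩ := H
  intro hG
  have h2 : w ∈ LinearMap.ker (ev f) := by
    refine Submodule.span_le.mpr ?_ (hG w hw)
    intro z hz
    by_contra h0
    have h0 : ev f z ≠ 0 := h0
    have h3 := hc.ev_eq hz.1
    have h4 := hz.2 f'
    rw [h3, natDegree_mul (pow_ne_zero _ (neg_ne_zero.mpr X_ne_zero)) h0] at h4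
    simp at h4
    omega
  have h2 : ev f w = 0 := h2
  rw [h2] at h1
  exact zero_ne_one h1

/-- Basic setup on the natural module: vectors `a b c` and functionals. -/
structure Setup (g h : W →ₗ[k] W) where
  a : W
  b : W
  c : W
  ea : W →ₗ[k] k
  eb : W →ₗ[k] k
  ec : W →ₗ[k] k
  ga : g a = a + c
  gb : g b = b
  gc : g c = c
  ha : h a = a
  hb : h b = b + c
  hc : h c = c
  iva : Inv g h ea
  ivb : Inv g h eb
  cg : ∀ v, ec (g v) = ec v + ea v
  ch : ∀ v, ec (h v) = ec v + eb v
  eba : eb a = 0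
  ebb : eb b = 1
  ebc : eb c = 0

lemma Setup.base {g h : W →ₗ[k] W} (S : Setup g h) : Obs g h 1 := by
  refine ⟨1 ⊗ₜ S.b - X ⊗ₜ S.a, S.eb, S.ea, ?_, ?_, ?_⟩
  · simp [S.ga, S.gb, S.ha, S.hb]
  · exact .step 0 _ _ _ S.ec (.refl _ S.ivb) S.iva S.cg S.ch
  · simp [S.eba, S.ebb]

/-- `w ↦ w ⊗ x` -/
noncomputable def tw (V : Type) [AddCommGroup V] [Module k V] (x : W) :
    (k[X] ⊗[k] V) →ₗ[k[X]] (k[X] ⊗[k] (V ⊗[k] W)) :=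
  ((TensorProduct.mk k V W).flip x).baseChange k[X]

@[simp] lemma tw_tmul (x : W) (p : k[X]) (v : V) : tw V x (p ⊗ₜ v) = p ⊗ₜ[k] (v ⊗ₜ[k] x) := by
  simp [tw]

lemma ev_prd (f : V →ₗ[k] k) (e : W →ₗ[k] k) (x : W) (w : k[X] ⊗[k] V) :
    ev (prd f e) (tw V x w) = e x • ev f w := by
  induction w with
  | zero => simp
  | add x y hx hy => simp only [map_add, hx, hy, smul_add]
  | tmul p v => simp [smul_smul, mul_comm]

variable {g h : V →ₗ[k] V} {g' h' : W →ₗ[k] W}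

lemma theta_b (S : Setup g' h') (w : k[X] ⊗[k] V) :
    theta (TensorProduct.map g g') (TensorProduct.map h h') (tw V S.b w) =
      tw V S.b (theta g h w) + (X : k[X]) • tw V S.c (h.baseChange k[X] w) := by
  induction w with
  | zero => simp
  | add x y hx hy => simp only [map_add, hx, hy, smul_add]; abel
  | tmul p v =>
    simp [S.gb, S.hb, smul_tmul', tmul_add, tmul_sub]; abel

lemma theta_a (S : Setup g' h') (w : k[X] ⊗[k] V) :
    theta (TensorProduct.map g g') (TensorProduct.map h h') (tw V S.a w) =
      tw V S.a (theta g h w) + tw V S.c (g.baseChange k[X] w) := by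
  induction w with
  | zero => simp
  | add x y hx hy => simp only [map_add, hx, hy]; abel
  | tmul p v =>
    simp [S.ga, S.ha, tmul_add, tmul_sub]; abel

lemma theta_c (S : Setup g' h') (w : k[X] ⊗[k] V) :
    theta (TensorProduct.map g g') (TensorProduct.map h h') (tw V S.c w) =
      tw V S.c (theta g h w) := by
  induction w with
  | zero => simp
  | add x y hx hy => simp only [map_add, hx, hy]
  | tmul p v =>
    simp [S.gc, S.hc, tmul_sub]

lemma Setup.succ (S : Setup g' h') {m : ℕ} (H : Obs g h m) :
    Obs (TensorProduct.map g g') (TensorProduct.map h h') (m + 1) := by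
  obtain ⟨w, f, f', hw, hc, h1⟩ := H
  refine ⟨tw V S.b w - (X : k[X]) • tw V S.a w + (X ^ 2 + X : k[X]) • tw V S.c (der V w),
    prd f S.eb, prd f' S.ea, ?_, ?_, ?_⟩
  · have hd := der_theta g h w
    rw [hw, map_zero] at hd
    have hy : h.baseChange k[X] w = (h - LinearMap.id).baseChange k[X] w + w := by
      simp [LinearMap.baseChange_sub]
    have hx : g.baseChange k[X] w = w - (X : k[X]) • (h - LinearMap.id).baseChange k[X] w := by
      have : (g - LinearMap.id).baseChange k[X] w +
          (X : k[X]) • (h - LinearMap.id).baseChange k[X] w = 0 := hw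
      rw [← sub_eq_zero, ← this]
      simp [LinearMap.baseChange_sub]
      abel
    have hz : theta g h (der V w) = - (h - LinearMap.id).baseChange k[X] w :=
      eq_neg_of_add_eq_zero_left hd.symm
    rw [map_add, map_sub, map_smul, map_smul, theta_a (g := g) (h := h) S,
      theta_b (g := g) (h := h) S, theta_c (g := g) (h := h) S, hw, hz, hx, hy]
    simp only [map_zero, map_add, map_sub, map_neg, map_smul]
    module
  · exact .step m _ _ _ (prd f' S.ec) (hc.prd S.ivb) (hc.inv.prd S.iva)
      (ext_tens (by simp) (by intros; simp; ring) fun v w => by simp [hc.inv.1, S.cg]; ring)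
      (ext_tens (by simp) (by intros; simp; ring) fun v w => by simp [hc.inv.2, S.ch]; ring)
  · simp [ev_prd, S.eba, S.ebb, S.ebc, h1]

end Lin
end NatSL
namespace NatSL

section Rep
variable {k G : Type} [Field k] [Monoid G]

/-- The linear map underlying a morphism. -/
noncomputable abbrev lin {A B : FDRep k G} (f : A ⟶ B) : A →ₗ[k] B := f.hom.hom.hom

lemma lin_comm {A B : FDRep k G} (f : A ⟶ B) (g : G) (v : A) :
    lin f (A.ρ g v) = B.ρ g (lin f v) :=
  ConcreteCategory.congr_hom ((forget (FGModuleCat k)).congr_map (f.comm g)) v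

lemma lin_comp {A B C : FDRep k G} (f : A ⟶ B) (f' : B ⟶ C) :
    lin (f ≫ f') = lin f' ∘ₗ lin f := rfl

lemma lin_id (A : FDRep k G) : lin (𝟙 A) = LinearMap.id := rfl

lemma lin_add {A B : FDRep k G} (f f' : A ⟶ B) : lin (f + f') = lin f + lin f' := rfl

lemma lin_inj {A B : FDRep k G} {f f' : A ⟶ B} (h : lin f = lin f') : f = f' := by
  apply Action.Hom.ext
  apply FGModuleCat.hom_ext
  exact h

/-- `Good` for a representation. -/
def GoodRep (g h : G) (D : ℕ) (N : FDRep k G) : Prop := Good (N.ρ g) (N.ρ h) D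

lemma GoodRep.push {g h : G} {D : ℕ} {A B : FDRep k G} (HA : GoodRep g h D A)
    (r : B ⟶ A) (i : A ⟶ B) {w} (hw : theta (B.ρ g) (B.ρ h) w = 0) :
    (lin (r ≫ i)).baseChange (Polynomial k) w ∈
      Submodule.span (Polynomial k) (low (B.ρ g) (B.ρ h) D) := by
  rw [lin_comp, LinearMap.baseChange_comp]
  refine map_span_low (lin i) (lin_comm i g) (lin_comm i h) (HA _ ?_)
  rw [theta_baseChange (lin r) (lin_comm r g) (lin_comm r h), hw, map_zero]

lemma GoodRep.of_retract {g h : G} {D : ℕ} {A B : FDRep k G} (HA : GoodRep g h D A)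
    (r : B ⟶ A) (i : A ⟶ B) (hri : r ≫ i = 𝟙 B) : GoodRep g h D B := by
  intro w hw
  have := HA.push r i hw
  rw [hri, lin_id, LinearMap.baseChange_id] at this
  exact this

lemma finrank_lt {A B : FDRep k G} (i : A ⟶ B) (r : B ⟶ A) (h1 : i ≫ r = 𝟙 A)
    (h2 : r ≫ i ≠ 𝟙 B) : Module.finrank k A < Module.finrank k B := by
  have hr : lin r ∘ₗ lin i = LinearMap.id := by rw [← lin_comp, h1, lin_id]
  have hinj : Function.Injective (lin i) :=
    Function.LeftInverse.injective (g := lin r) fun v => LinearMap.congr_fun hr v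
  refine lt_of_le_of_ne (LinearMap.finrank_le_finrank_of_injective hinj) fun he => h2 ?_
  have hsurj : Function.Surjective (lin i) :=
    (LinearMap.injective_iff_surjective_of_finrank_eq_finrank he).mp hinj
  apply lin_inj
  rw [lin_comp, lin_id]
  ext v
  obtain ⟨u, rfl⟩ := hsurj v
  exact congrArg (lin i) (LinearMap.congr_fun hr u)

lemma good_of_indec {g h : G} {D : ℕ} {T : FDRep k G}
    (H : ∀ N, AlgebraicModule.Indecomposable N → IsSummand N T → GoodRep g h D N) :
    ∀ (d : ℕ) (N : FDRep k G), Module.finrank k N = d → IsSummand N T → GoodRep g h D N := by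
  intro d
  induction d using Nat.strong_induction_on with
  | _ d ih =>
  intro N hd hN
  by_cases hI : AlgebraicModule.Indecomposable N
  · exact H N hI hN
  by_cases hz : Limits.IsZero N
  · intro w hw
    have h0 : lin (𝟙 N) = lin (0 : N ⟶ N) := by rw [hz.eq_of_src (𝟙 N) 0]
    have h1 : w = (lin (𝟙 N)).baseChange (Polynomial k) w := by
      rw [lin_id, LinearMap.baseChange_id]; rfl
    have h2 : lin (0 : N ⟶ N) = 0 := rfl
    rw [h1, h0, h2, LinearMap.baseChange_zero, LinearMap.zero_apply]
    exact Submodule.zero_mem _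
  · have : ∃ e : N ⟶ N, e ≫ e = e ∧ e ≠ 0 ∧ e ≠ 𝟙 N := by
      by_contra hc
      refine hI ⟨hz, fun e he => ?_⟩
      by_contra hh
      rw [not_or] at hh
      exact hc ⟨e, he, hh⟩
    obtain ⟨e, he, he0, he1⟩ := this
    have key : ∀ e : N ⟶ N, e ≫ e = e → e ≠ 𝟙 N → ∀ w, theta (N.ρ g) (N.ρ h) w = 0 →
        (lin e).baseChange (Polynomial k) w ∈
          Submodule.span (Polynomial k) (low (N.ρ g) (N.ρ h) D) := by
      intro e he he1 w hw
      obtain ⟨Y, i, r, h1, h2⟩ := IsIdempotentComplete.idempotents_split N e he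
      have hlt := finrank_lt i r h1 (by rw [h2]; exact he1)
      obtain ⟨i', r', h3⟩ := hN
      have hY : GoodRep g h D Y := ih _ (hd ▸ hlt) Y rfl
        ⟨i ≫ i', r' ≫ r, by
          rw [Category.assoc, ← Category.assoc i', h3, Category.id_comp, h1]⟩
      rw [← h2]
      exact hY.push r i hw
    intro w hw
    have hs := Submodule.add_mem _ (key e he he1 w hw)
      (key (𝟙 N - e) (Idempotents.idem_of_id_sub_idem e he) (by simpa using he0) w hw)
    rw [← LinearMap.add_apply, ← LinearMap.baseChange_add, ← lin_add, add_sub_cancel, lin_id,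
      LinearMap.baseChange_id] at hs
    exact hs

lemma obs_tensorPow {g h : G} (M : FDRep k G) (S : Setup (M.ρ g) (M.ρ h)) (n : ℕ) :
    Obs ((tensorPow M n).ρ g) ((tensorPow M n).ρ h) (n + 1) := by
  induction n with
  | zero => exact S.base
  | succ n ih => exact S.succ ih

lemma exists_bound (g h : G) (L : List (FDRep k G)) : ∃ D, ∀ N ∈ L, GoodRep g h D N := by
  induction L with
  | nil => exact ⟨0, by simp⟩
  | cons N L ih =>
    obtain ⟨D, hD⟩ := ih
    obtain ⟨D', hD'⟩ := exists_good (N.ρ g) (N.ρ h)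
    refine ⟨max D D', fun N' hN' => ?_⟩
    rcases List.mem_cons.mp hN' with rfl | h'
    · exact hD'.mono (le_max_right _ _)
    · exact Good.mono (hD N' h') (le_max_left _ _)

theorem not_algebraic {g h : G} (M : FDRep k G) (S : Setup (M.ρ g) (M.ρ h)) :
    ¬ IsAlgebraic M := by
  rintro ⟨L, hL⟩
  obtain ⟨D, hD⟩ := exists_bound g h L
  refine (obs_tensorPow M S D).not_good (Nat.lt_succ_self D) ?_
  refine good_of_indec (T := tensorPow M D) (fun N hN hs => ?_) _ (tensorPow M D) rfl
    ⟨𝟙 _, 𝟙 _, Category.id_comp _⟩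
  obtain ⟨N', hN', ⟨φ⟩⟩ := hL N hN ⟨D, hs⟩
  exact (hD N' hN').of_retract φ.hom φ.inv φ.hom_inv_id

end Rep

/-- Elementary transvection. -/
def tv (k : Type) [Field k] (n : ℕ) (i j : Fin n) (hij : i ≠ j) :
    Matrix.SpecialLinearGroup (Fin n) k :=
  ⟨Matrix.transvection i j 1, Matrix.det_transvection_of_ne i j hij 1⟩

lemma tv_apply (k : Type) [Field k] (n : ℕ) (i j : Fin n) (hij : i ≠ j) (v : Fin n → k) :
    SLnatRep k n (tv k n i j hij) v = v + Pi.single i (v j) := by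
  change Matrix.mulVec (Matrix.transvection i j 1) v = _
  rw [Matrix.transvection, Matrix.add_mulVec, Matrix.one_mulVec, Matrix.single_mulVec]
  ext l
  simp [Function.update_apply, Pi.single_apply]

/-- The natural module carries the required vectors. -/
noncomputable def natSetup (k : Type) [Field k] (n : ℕ) (x y z : Fin n) (hxy : x ≠ y)
    (hxz : x ≠ z) (hyz : y ≠ z) :
    Setup (SLnatRep k n (tv k n x y hxy)) (SLnatRep k n (tv k n x z hxz)) where
  a := Pi.single y 1
  b := Pi.single z 1
  c := Pi.single x 1
  ea := LinearMap.proj y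
  eb := LinearMap.proj z
  ec := LinearMap.proj x
  ga := by simp [tv_apply]
  gb := by simp [tv_apply, hyz]
  gc := by simp [tv_apply, hxy.symm]
  ha := by simp [tv_apply, hyz.symm]
  hb := by simp [tv_apply]
  hc := by simp [tv_apply, hxz.symm]
  iva := by constructor <;> simp [tv_apply, hxy.symm]
  ivb := by constructor <;> simp [tv_apply, hxz.symm]
  cg := by simp [tv_apply]
  ch := by simp [tv_apply]
  eba := by simp [hyz.symm]
  ebb := by simp
  ebc := by simp [hxz.symm]

end NatSL

/-- For `q` a power of a prime and `n ≥ 3`, the natural module `k^n` for `SL_n(q)` is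
non-algebraic. -/
theorem natural_module_SLn_nonalgebraic (p s : ℕ) [Fact p.Prime] (hs : s ≠ 0)
    (n : ℕ) (hn : 3 ≤ n) :
    ¬ IsAlgebraic (FDRep.of (SLnatRep (GaloisField p s) n)) := by
    exact NatSL.not_algebraic _ (NatSL.natSetup (GaloisField p s) n ⟨0, by omega⟩ ⟨1, by omega⟩
    ⟨2, by omega⟩ (by simp) (by simp) (by simp))
end
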